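/- For each integer s ≥ 2 there exists m₀ such that the following holds for all m ≥ m₀: if G is a balanced bipartite graph on 2n = 2ms vertices with δ(G) ≥ n/2 + s − 1 when m is even, and δ(G) ≥ (n+3s)/2 − 2 when m is odd, then G can be tiled with K_{s,s}. -/

import Mathlib

open scoped Classical
open Finset

namespace PaperTiling

variable {V : Type*} [Fintype V] [DecidableEq V]

/-- The number of neighbours of `v` inside the set `S`. -/
noncomputable def degS (G : SimpleGraph V) (v : V) (S : Finset V) : ℕ :=
  (S.filter fun w => G.Adj v w).card

/-- The number of edges of `G` with one end in `A` and the other in `B`. -/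
noncomputable def eAB (G : SimpleGraph V) (A B : Finset V) : ℕ :=
  ∑ v ∈ A, degS G v B

/-- The edge density `d(A,B) = e(A,B)/(|A||B|)`. -/
noncomputable def dens (G : SimpleGraph V) (A B : Finset V) : ℝ :=
  (eAB G A B : ℝ) / ((A.card : ℝ) * (B.card : ℝ))

/-- `G` is a bipartite graph with parts `A` and `B`. -/
def IsBipartition (G : SimpleGraph V) (A B : Finset V) : Prop :=
  Disjoint A B ∧ A ∪ B = Finset.univ ∧
    ∀ u v : V, G.Adj u v → (u ∈ A ∧ v ∈ B) ∨ (u ∈ B ∧ v ∈ A)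

/-- `(S, T)` spans a copy of the complete bipartite graph `K_{s,t}` in `G`,
with `S` the side of size `s` and `T` the side of size `t`. -/
def IsKst (G : SimpleGraph V) (s t : ℕ) (S T : Finset V) : Prop :=
  Disjoint S T ∧ S.card = s ∧ T.card = t ∧ ∀ u ∈ S, ∀ v ∈ T, G.Adj u v

/-- `𝒯` is a perfect `K_{s,t}`-tiling of `G`: a collection of pairwise
vertex-disjoint copies of `K_{s,t}` covering all vertices. -/
def IsKstTiling (G : SimpleGraph V) (s t : ℕ)
    (𝒯 : Finset (Finset V × Finset V)) : Prop :=
  (∀ P ∈ 𝒯, IsKst G s t P.1 P.2) ∧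
  (𝒯 : Set (Finset V × Finset V)).PairwiseDisjoint (fun P => P.1 ∪ P.2) ∧
  𝒯.sup (fun P => P.1 ∪ P.2) = Finset.univ

/-- `G` can be tiled with `K_{s,t}`. -/
def KstTileable (G : SimpleGraph V) (s t : ℕ) : Prop :=
  ∃ 𝒯 : Finset (Finset V × Finset V), IsKstTiling G s t 𝒯

/-- `G` can be tiled with the complete graph `K_s`. -/
def CliqueTileable (G : SimpleGraph V) (s : ℕ) : Prop :=
  ∃ 𝒞 : Finset (Finset V),
    (∀ S ∈ 𝒞, S.card = s ∧ G.IsClique (S : Set V)) ∧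
    (𝒞 : Set (Finset V)).PairwiseDisjoint id ∧
    𝒞.sup id = Finset.univ

/-- The minimum degree of `G` equals the real number `c`. -/
def MinDegreeIs (G : SimpleGraph V) (c : ℝ) : Prop :=
  (∀ v : V, c ≤ (degS G v Finset.univ : ℝ)) ∧
  ∃ v : V, (degS G v Finset.univ : ℝ) = c

/-- `(c, L)` is an `h`-star with centre `c ∈ A` and `h` leaves `L ⊆ B`. -/
def IsStar (G : SimpleGraph V) (h : ℕ) (A B : Finset V) (c : V) (L : Finset V) : Prop :=
  c ∈ A ∧ L ⊆ B ∧ L.card = h ∧ ∀ v ∈ L, G.Adj c v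

/-- `𝒮` is a family of pairwise vertex-disjoint `h`-stars from `A` to `B`. -/
def StarFamily (G : SimpleGraph V) (h : ℕ) (A B : Finset V)
    (𝒮 : Finset (V × Finset V)) : Prop :=
  (∀ S ∈ 𝒮, IsStar G h A B S.1 S.2) ∧
  (𝒮 : Set (V × Finset V)).PairwiseDisjoint (fun S => insert S.1 S.2)

/-- The structure hypotheses (H) for the extremal construction of the paper:
`1 ≤ s < t`, `t ≥ 2s+1`, `k ≥ 1`, `G` is bipartite with parts
`U₀ ∪ U₁ ∪ U₂` and `V₀ ∪ V₁ ∪ V₂`, with the prescribed part sizes,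
complete pairs `(U₁,V₁)`, `(U₂,V₂)`, `(U₀, V₁∪V₂)`, `(V₀, U₁∪U₂)`,
no edges between `U₀` and `V₀`, and sparse `K_{2,2}`-free diagonal pairs. -/
structure StructH (G : SimpleGraph V) (s t k : ℕ)
    (U0 U1 U2 V0 V1 V2 : Finset V) : Prop where
  hs : 1 ≤ s
  hst : s < t
  ht : 2 * s + 1 ≤ t
  hk : 1 ≤ k
  bip : IsBipartition G (U0 ∪ U1 ∪ U2) (V0 ∪ V1 ∪ V2)
  hU01 : Disjoint U0 U1
  hU02 : Disjoint U0 U2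
  hU12 : Disjoint U1 U2
  hV01 : Disjoint V0 V1
  hV02 : Disjoint V0 V2
  hV12 : Disjoint V1 V2
  cardU0 : U0.card = s - 1
  cardV0 : V0.card = s - 1
  cardU1 : U1.card = k * (s + t) + (t + 1) / 2
  cardV2 : V2.card = k * (s + t) + (t + 1) / 2
  cardV1 : V1.card = k * (s + t) + (t + 2) / 2
  cardU2 : U2.card = k * (s + t) + (t + 2) / 2
  compU1V1 : ∀ u ∈ U1, ∀ v ∈ V1, G.Adj u v
  compU2V2 : ∀ u ∈ U2, ∀ v ∈ V2, G.Adj u v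
  compU0 : ∀ u ∈ U0, ∀ v ∈ V1 ∪ V2, G.Adj u v
  compV0 : ∀ v ∈ V0, ∀ u ∈ U1 ∪ U2, G.Adj u v
  emptyU0V0 : ∀ u ∈ U0, ∀ v ∈ V0, ¬ G.Adj u v
  K22freeU1V2 : ∀ S T : Finset V, S ⊆ U1 → T ⊆ V2 → ¬ IsKst G 2 2 S T
  K22freeU2V1 : ∀ S T : Finset V, S ⊆ U2 → T ⊆ V1 → ¬ IsKst G 2 2 S T
  degU1 : ∀ u ∈ U1, degS G u V2 ≤ s - 1
  degU2 : ∀ u ∈ U2, degS G u V1 ≤ s - 1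
  degV1 : ∀ v ∈ V1, degS G v U2 ≤ s - 1
  degV2 : ∀ v ∈ V2, degS G v U1 ≤ s - 1

/-- The vertex set `W` of a copy of `K_{s,t}` is crossing. -/
def Crossing (U1 V1 U2 V2 W : Finset V) : Prop :=
  (W ∩ (U1 ∪ V1)).Nonempty ∧ (W ∩ (U2 ∪ V2)).Nonempty

/-- `W` is crossing from the set `A`, where `AD = A^D` is the diagonal set of `A`
and `AM = A^M` is the opposite middle set of `A`. -/
def CrossingFrom (W A AD AM : Finset V) : Prop :=
  (W ∩ A).card = 1 ∧
    (2 ≤ (W ∩ AD).card ∨ ((W ∩ AD).card = 1 ∧ (W ∩ AM).Nonempty))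

/-- `W` is of Type 1 (crossing from `A`), where `AD = A^D`, `AN = A^N`,
`ANM = (A^N)^M`. -/
def Type1From (s t : ℕ) (W AD AN ANM : Finset V) : Prop :=
  ∃ p : ℕ, 2 ≤ p ∧ p ≤ s - 1 ∧ (W ∩ ANM).card = s - 1 ∧
    (W ∩ AN).card = t - p ∧ (W ∩ AD).card = p

/-- `W` is of Type 2 (crossing from `A`), where `AD = A^D`, `AM = A^M`,
`AND = (A^N)^D`. -/
def Type2From (s t : ℕ) (W AD AM AND : Finset V) : Prop :=
  ∃ p : ℕ, 1 ≤ p ∧ p ≤ s - 1 ∧ (W ∩ AND).card = t - 1 ∧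
    (W ∩ AM).card = s - p ∧ (W ∩ AD).card = p

end PaperTiling

namespace PaperTiling

set_option linter.unusedSectionVars false

variable {V : Type*} [DecidableEq V]

/-- `Til G s X Y`: the pair `(X, Y)` splits into copies of `K_{s,s}` whose first sides partition
`X` and whose second sides partition `Y`. -/
inductive Til (G : SimpleGraph V) (s : ℕ) : Finset V → Finset V → Prop
  | empty : Til G s ∅ ∅
  | add {S T X Y : Finset V} : IsKst G s s S T → Disjoint S X → Disjoint T Y → Til G s X Y →
      Til G s (S ∪ X) (T ∪ Y)

section Basic

variable {G : SimpleGraph V} {s : ℕ} {A B X Y Z X' Y' S T : Finset V} {v : V}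

theorem IsKst.symm {t : ℕ} (h : IsKst G s t S T) : IsKst G t s T S :=
  ⟨h.1.symm, h.2.2.1, h.2.1, fun u hu v hv => (h.2.2.2 v hv u hu).symm⟩

theorem Til.card_eq (h : Til G s X Y) : X.card = Y.card := by
  induction h with
  | empty => rfl
  | add hk h1 h2 _ ih =>
    rw [card_union_of_disjoint h1, card_union_of_disjoint h2, ih, hk.2.1, hk.2.2.1]

theorem Til.dvd_card (h : Til G s X Y) : s ∣ X.card := by
  induction h with
  | empty => simp
  | add hk h1 h2 _ ih =>
    rw [card_union_of_disjoint h1, hk.2.1]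
    exact (Nat.dvd_add_right dvd_rfl).2 ih

theorem Til.symm (h : Til G s X Y) : Til G s Y X := by
  induction h with
  | empty => exact .empty
  | add hk h1 h2 _ ih => exact .add hk.symm h2 h1 ih

theorem Til.of_isKst (h : IsKst G s s S T) : Til G s S T := by
  have := Til.add h (disjoint_empty_right S) (disjoint_empty_right T) .empty
  simpa using this

theorem Til.union (h : Til G s X Y) (h' : Til G s X' Y') (hX : Disjoint X X')
    (hY : Disjoint Y Y') : Til G s (X ∪ X') (Y ∪ Y') := by
  induction h with
  | empty => simpa using h'
  | add hk h1 h2 _ ih =>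
    rw [disjoint_union_left] at hX hY
    rw [union_assoc, union_assoc]
    exact .add hk (disjoint_union_right.2 ⟨h1, hX.1⟩) (disjoint_union_right.2 ⟨h2, hY.1⟩)
      (ih hX.2 hY.2)

theorem Til.of_parts (h : Til G s X Y) (h' : Til G s (A \ X) (B \ Y)) (hX : X ⊆ A) (hY : Y ⊆ B) :
    Til G s A B := by
  have := h.union h' disjoint_sdiff disjoint_sdiff
  rwa [union_sdiff_of_subset hX, union_sdiff_of_subset hY] at this

theorem Til.biUnion {ι : Type*} (F : Finset ι) (f g : ι → Finset V)
    (h : ∀ i ∈ F, Til G s (f i) (g i))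
    (hf : ∀ i ∈ F, ∀ j ∈ F, i ≠ j → Disjoint (f i) (f j))
    (hg : ∀ i ∈ F, ∀ j ∈ F, i ≠ j → Disjoint (g i) (g j)) :
    Til G s (F.biUnion f) (F.biUnion g) := by
  induction F using Finset.induction_on with
  | empty => exact .empty
  | insert a F ha ih =>
    rw [biUnion_insert, biUnion_insert]
    refine (h a (mem_insert_self _ _)).union (ih ?_ ?_ ?_) ?_ ?_
    · exact fun i hi => h i (mem_insert_of_mem hi)
    · exact fun i hi j hj => hf i (mem_insert_of_mem hi) j (mem_insert_of_mem hj)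
    · exact fun i hi j hj => hg i (mem_insert_of_mem hi) j (mem_insert_of_mem hj)
    · rw [disjoint_biUnion_right]
      exact fun i hi => hf a (mem_insert_self _ _) i (mem_insert_of_mem hi)
        (by rintro rfl; exact ha hi)
    · rw [disjoint_biUnion_right]
      exact fun i hi => hg a (mem_insert_self _ _) i (mem_insert_of_mem hi)
        (by rintro rfl; exact ha hi)

theorem Til.kstTileable [Fintype V] (h : Til G s A B) (hd : Disjoint A B)
    (hu : A ∪ B = univ) : KstTileable G s s := by
  suffices H : ∃ 𝒯 : Finset (Finset V × Finset V), (∀ P ∈ 𝒯, IsKst G s s P.1 P.2) ∧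
      (𝒯 : Set (Finset V × Finset V)).PairwiseDisjoint (fun P => P.1 ∪ P.2) ∧
      𝒯.sup (fun P => P.1 ∪ P.2) = A ∪ B by
    obtain ⟨𝒯, h1, h2, h3⟩ := H
    exact ⟨𝒯, h1, h2, h3.trans hu⟩
  clear hu
  induction h with
  | empty => exact ⟨∅, by simp⟩
  | @add S T X Y hk h1 h2 _ ih =>
    simp only [disjoint_union_left, disjoint_union_right] at hd
    obtain ⟨𝒯, e1, e2, e3⟩ := ih hd.2.2
    have key : ∀ P ∈ 𝒯, P.1 ∪ P.2 ⊆ X ∪ Y := fun P hP => by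
      rw [← e3]; exact Finset.le_sup (f := fun P : Finset V × Finset V => P.1 ∪ P.2) hP
    refine ⟨insert (S, T) 𝒯, ?_, ?_, ?_⟩
    · intro P hP
      rcases mem_insert.1 hP with rfl | hP
      · exact hk
      · exact e1 P hP
    · rw [coe_insert]
      refine e2.insert fun P hP _ => ?_
      refine Disjoint.mono_right (key P hP) ?_
      simp only [disjoint_union_left, disjoint_union_right]
      exact ⟨⟨h1, hd.1.2.symm⟩, hd.2.1, h2⟩
    · rw [sup_insert, e3]
      ext x
      simp only [sup_eq_union, mem_union]
      tauto

/-- The neighbours of `v` inside `Y`. -/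
noncomputable def nb (G : SimpleGraph V) (v : V) (Y : Finset V) : Finset V :=
  Y.filter fun w => G.Adj v w

theorem mem_nb {w : V} : w ∈ nb G v Y ↔ w ∈ Y ∧ G.Adj v w := mem_filter

theorem nb_subset : nb G v Y ⊆ Y := filter_subset _ _

theorem card_nb : (nb G v Y).card = degS G v Y := rfl

theorem degS_le_card : degS G v Y ≤ Y.card := card_le_card nb_subset

theorem degS_mono (h : X ⊆ Y) : degS G v X ≤ degS G v Y :=
  card_le_card (filter_subset_filter _ h)

theorem degS_union (h : Disjoint X Y) : degS G v (X ∪ Y) = degS G v X + degS G v Y := by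
  unfold degS
  rw [filter_union, card_union_of_disjoint (disjoint_filter_filter h)]

theorem degS_union_le : degS G v (X ∪ Y) ≤ degS G v X + degS G v Y := by
  unfold degS
  rw [filter_union]
  exact card_union_le _ _

theorem degS_sdiff (h : X ⊆ Y) : degS G v (Y \ X) + degS G v X = degS G v Y := by
  rw [← degS_union sdiff_disjoint, sdiff_union_of_subset h]

theorem degS_le_sdiff : degS G v Y ≤ degS G v (Y \ X) + X.card := by
  have : degS G v Y ≤ degS G v ((Y \ X) ∪ X) := degS_mono (by simp)
  exact this.trans (degS_union_le.trans (Nat.add_le_add_left degS_le_card _))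

theorem degS_add_nonadj :
    degS G v Y + (Y.filter fun w => ¬ G.Adj v w).card = Y.card :=
  card_filter_add_card_filter_not _

theorem eAB_comm : eAB G X Y = eAB G Y X := by
  unfold eAB degS
  simp only [card_filter]
  rw [sum_comm]
  simp only [G.adj_comm]

theorem eAB_le_card_mul : eAB G X Y ≤ X.card * Y.card := by
  unfold eAB
  exact (sum_le_card_nsmul _ _ _ fun _ _ => degS_le_card).trans (by simp)

theorem eAB_mono (h : X ⊆ X') (h' : Y ⊆ Y') : eAB G X Y ≤ eAB G X' Y' :=
  (sum_le_sum fun _ _ => degS_mono h').trans (sum_le_sum_of_subset h)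

theorem eAB_union_left (h : Disjoint X X') : eAB G (X ∪ X') Y = eAB G X Y + eAB G X' Y :=
  sum_union h

theorem eAB_union_right (h : Disjoint Y Y') : eAB G X (Y ∪ Y') = eAB G X Y + eAB G X Y' := by
  rw [eAB_comm, eAB_union_left h, eAB_comm, eAB_comm (X := Y')]

/-- The common neighbours of the set `S` inside `Y`. -/
noncomputable def cnb (G : SimpleGraph V) (S Y : Finset V) : Finset V :=
  Y.filter fun w => ∀ u ∈ S, G.Adj u w

theorem mem_cnb {w : V} : w ∈ cnb G S Y ↔ w ∈ Y ∧ ∀ u ∈ S, G.Adj u w := mem_filter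

theorem cnb_subset : cnb G S Y ⊆ Y := filter_subset _ _

theorem card_le_card_cnb {D : ℕ} (h : ∀ u ∈ S, Y.card ≤ degS G u Y + D) :
    Y.card ≤ (cnb G S Y).card + S.card * D := by
  have h1 : Y \ cnb G S Y ⊆ S.biUnion fun u => Y.filter fun w => ¬ G.Adj u w := by
    intro w hw
    rw [mem_sdiff, mem_cnb] at hw
    simp only [mem_biUnion, mem_filter]
    by_contra! hc
    exact hw.2 ⟨hw.1, fun u hu => hc u hu hw.1⟩
  have h2 := (card_le_card h1).trans (card_biUnion_le_card_mul S _ D fun u hu => by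
    have := degS_add_nonadj (G := G) (v := u) (Y := Y)
    have := h u hu
    omega)
  have h3 := card_sdiff_add_card_eq_card (cnb_subset (G := G) (S := S) (Y := Y))
  omega

end Basic

section Finishing

variable {G : SimpleGraph V} {s : ℕ} {A B X Y Z X' Y' S T : Finset V} {v : V}

theorem exists_blocks (X : Finset V) (s k : ℕ) (h : k * s ≤ X.card) :
    ∃ f : ℕ → Finset V, (∀ i < k, f i ⊆ X ∧ (f i).card = s) ∧
      ∀ i < k, ∀ j < k, i ≠ j → Disjoint (f i) (f j) := by
  induction k with
  | zero => exact ⟨fun _ => ∅, by simp, by simp⟩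
  | succ k ih =>
    obtain ⟨f, h1, h2⟩ := ih (le_trans (by gcongr; omega) h)
    have hc : ((range k).biUnion f).card ≤ k * s := by
      refine (card_biUnion_le_card_mul _ _ s fun i hi => ?_).trans (by simp)
      exact (h1 i (mem_range.1 hi)).2.le
    obtain ⟨S, hS, hSc⟩ := exists_subset_card_eq (s := X \ (range k).biUnion f) (n := s) (by
      have := le_card_sdiff ((range k).biUnion f) X
      rw [add_mul] at h
      omega)
    have hSd : ∀ i < k, Disjoint S (f i) := fun i hi =>
      (disjoint_sdiff_self_left.mono_left hS).mono_right
        (subset_biUnion_of_mem f (mem_range.2 hi))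
    refine ⟨fun i => if i = k then S else f i, fun i hi => ?_, fun i hi j hj hij => ?_⟩
    · rcases eq_or_ne i k with rfl | hik
      · simpa using ⟨hS.trans sdiff_subset, hSc⟩
      · simpa [hik] using h1 i (by omega)
    · rcases eq_or_ne i k with rfl | hik
      · simpa [hij.symm] using hSd j (by omega)
      · rcases eq_or_ne j k with rfl | hjk
        · simpa [hij] using (hSd i (by omega)).symm
        · simpa [hik, hjk] using h2 i (by omega) j (by omega) hij

theorem exists_partition_blocks (X : Finset V) (s k : ℕ) (h : X.card = k * s) :
    ∃ f : Fin k → Finset V, (∀ i, f i ⊆ X ∧ (f i).card = s) ∧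
      (∀ i j, i ≠ j → Disjoint (f i) (f j)) ∧ univ.biUnion f = X := by
  obtain ⟨f, h1, h2⟩ := exists_blocks X s k h.ge
  have hd : ∀ i j : Fin k, i ≠ j → Disjoint (f i) (f j) := fun i j hij =>
    h2 i i.2 j j.2 (by rwa [Ne, Fin.val_inj])
  refine ⟨fun i => f i, fun i => h1 i i.2, hd, ?_⟩
  refine eq_of_subset_of_card_le (biUnion_subset.2 fun i _ => (h1 i i.2).1) ?_
  rw [card_biUnion fun i _ j _ hij => hd i j hij,
    sum_congr rfl fun (i : Fin k) _ => (h1 i i.2).2, h]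
  simp

/-- In a family of disjoint blocks, few blocks fail to be completely joined to a small set. -/
theorem card_bad_blocks_le {k D : ℕ} {f : Fin k → Finset V}
    (hd : ∀ i j, i ≠ j → Disjoint (f i) (f j)) (hf : ∀ i, f i ⊆ Y)
    (hS : ∀ u ∈ S, Y.card ≤ degS G u Y + D) :
    (univ.filter fun i => ¬ ∀ u ∈ S, ∀ w ∈ f i, G.Adj u w).card ≤ S.card * D := by
  have h1 : (univ.filter fun i => ¬ ∀ u ∈ S, ∀ w ∈ f i, G.Adj u w).card ≤
      (Y \ cnb G S Y).card := by
    refine (card_le_card_biUnion (f := fun i => f i ∩ (Y \ cnb G S Y))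
      (fun i _ j _ hij => (hd i j hij).mono inter_subset_left inter_subset_left) ?_).trans
      (card_le_card (biUnion_subset.2 fun _ _ => inter_subset_right))
    intro i hi
    simp only [mem_filter, mem_univ, true_and] at hi
    push Not at hi
    obtain ⟨u, hu, w, hw, h⟩ := hi
    exact ⟨w, mem_inter.2 ⟨hw, mem_sdiff.2 ⟨hf i hw, fun hc => h ((mem_cnb.1 hc).2 u hu)⟩⟩⟩
  have h3 := card_le_card_cnb hS
  have h4 := card_sdiff_add_card_eq_card (cnb_subset (G := G) (S := S) (Y := Y))
  omega

theorem til_of_nearComplete {D : ℕ} (hXY : Disjoint X Y) (hc : X.card = Y.card)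
    (hs : s ∣ X.card) (hD : 2 * s * s * D ≤ X.card) (hs0 : 0 < s)
    (hX : ∀ x ∈ X, Y.card ≤ degS G x Y + D) (hY : ∀ y ∈ Y, X.card ≤ degS G y X + D) :
    Til G s X Y := by
  obtain ⟨k, hk⟩ := hs
  rw [mul_comm] at hk
  have hkD : 2 * s * D ≤ k := by
    rw [hk] at hD
    by_contra hcon
    nlinarith
  obtain ⟨f, f1, f2, f3⟩ := exists_partition_blocks X s k hk
  obtain ⟨g, g1, g2, g3⟩ := exists_partition_blocks Y s k (hc ▸ hk)
  let N : Fin k → Finset (Fin k) := fun i => univ.filter fun j => ∀ u ∈ f i, ∀ w ∈ g j, G.Adj u w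
  have hN : ∀ i, k ≤ (N i).card + s * D := fun i => by
    have h1 := card_bad_blocks_le (G := G) (S := f i) (Y := Y) g2 (fun j => (g1 j).1)
      (fun u hu => hX u ((f1 i).1 hu))
    have h2 := card_filter_add_card_filter_not (s := (univ : Finset (Fin k)))
      (fun j => ∀ u ∈ f i, ∀ w ∈ g j, G.Adj u w)
    rw [(f1 i).2] at h1
    simp only [card_univ, Fintype.card_fin] at h2
    simp only [N]
    omega
  obtain ⟨m, m1, m2⟩ := (all_card_le_biUnion_card_iff_exists_injective N).1 fun J => by
    rcases J.eq_empty_or_nonempty with rfl | ⟨i, hi⟩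
    · simp
    by_cases hJ : J.card ≤ s * D
    · have := card_le_card (subset_biUnion_of_mem N hi)
      have := hN i
      nlinarith
    · have : J.biUnion N = univ := by
        refine eq_univ_of_forall fun j => ?_
        by_contra hj
        have h1 := card_bad_blocks_le (G := G) (S := g j) (Y := X) f2 (fun j => (f1 j).1)
          (fun u hu => hY u ((g1 j).1 hu))
        rw [(g1 j).2] at h1
        refine hJ ((card_le_card fun i hi => ?_).trans h1)
        rw [mem_filter]
        refine ⟨mem_univ _, fun hc => hj ?_⟩
        exact mem_biUnion.2 ⟨i, hi, mem_filter.2 ⟨mem_univ _, fun u hu w hw => (hc w hw u hu).symm⟩⟩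
      rw [this]
      exact card_le_univ _
  have hm : Function.Bijective m := Finite.injective_iff_bijective.1 m1
  have key := Til.biUnion (G := G) (s := s) univ f (fun i => g (m i)) (fun i _ => Til.of_isKst
    ⟨hXY.mono (f1 i).1 (g1 _).1, (f1 i).2, (g1 _).2, (mem_filter.1 (m2 i)).2⟩)
    (fun i _ j _ => f2 i j) (fun i _ j _ hij => g2 _ _ (m1.ne hij))
  have e : univ.biUnion (fun i => g (m i)) = Y := by
    rw [← g3]
    ext x
    simp only [mem_biUnion, mem_univ, true_and]
    exact ⟨fun ⟨i, hi⟩ => ⟨_, hi⟩, fun ⟨j, hj⟩ => by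
      obtain ⟨i, rfl⟩ := hm.2 j
      exact ⟨i, hj⟩⟩
  rwa [f3, e] at key

/-- `ℓ` assigns to the vertices of `P` pairwise disjoint sets of `s` neighbours inside `Y`. -/
structure Leaf (G : SimpleGraph V) (s : ℕ) (P Y : Finset V) (ℓ : V → Finset V) : Prop where
  subset : ∀ x ∈ P, ℓ x ⊆ Y
  card : ∀ x ∈ P, (ℓ x).card = s
  adj : ∀ x ∈ P, ∀ w ∈ ℓ x, G.Adj x w
  disj : ∀ x ∈ P, ∀ y ∈ P, x ≠ y → Disjoint (ℓ x) (ℓ y)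

variable {P E F Xg Xb Yg Yb : Finset V} {ℓ : V → Finset V}

theorem Leaf.mono (h : Leaf G s P Y ℓ) (hX : X ⊆ P) (hY : Y ⊆ Y') : Leaf G s X Y' ℓ :=
  ⟨fun x hx => (h.subset x (hX hx)).trans hY, fun x hx => h.card x (hX hx),
    fun x hx => h.adj x (hX hx), fun x hx y hy => h.disj x (hX hx) y (hX hy)⟩

theorem Leaf.empty : Leaf G s ∅ Y ℓ := ⟨by simp, by simp, by simp, by simp⟩

theorem Leaf.biUnion_subset (h : Leaf G s P Y ℓ) : P.biUnion ℓ ⊆ Y :=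
  Finset.biUnion_subset.2 h.subset

theorem Leaf.card_biUnion (h : Leaf G s P Y ℓ) : (P.biUnion ℓ).card = P.card * s := by
  rw [Finset.card_biUnion h.disj, sum_congr rfl h.card]
  simp

theorem Leaf.exists_insert {x : V} (h : Leaf G s P Y ℓ) (hx : x ∉ P) (hT : T ⊆ Y)
    (hTc : T.card = s) (hTa : ∀ w ∈ T, G.Adj x w) (hTd : Disjoint T (P.biUnion ℓ)) :
    ∃ ℓ', Leaf G s (insert x P) Y ℓ' := by
  rw [disjoint_biUnion_right] at hTd
  have key : ∀ y ∈ P, y ≠ x := fun y hy => by rintro rfl; exact hx hy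
  refine ⟨Function.update ℓ x T, ⟨?_, ?_, ?_, ?_⟩⟩
  · intro y hy
    rcases mem_insert.1 hy with rfl | hy
    · simpa using hT
    · simpa [key y hy] using h.subset y hy
  · intro y hy
    rcases mem_insert.1 hy with rfl | hy
    · simpa using hTc
    · simpa [key y hy] using h.card y hy
  · intro y hy
    rcases mem_insert.1 hy with rfl | hy
    · simpa using hTa
    · simpa [key y hy] using h.adj y hy
  · intro y hy z hz hyz
    rcases mem_insert.1 hy with hy | hy <;> rcases mem_insert.1 hz with hz | hz
    · exact absurd (hy.trans hz.symm) hyz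
    · simpa [key z hz, hy] using hTd z hz
    · simpa [key y hy, hz] using (hTd y hy).symm
    · simpa [key y hy, key z hz] using h.disj y hy z hz hyz

theorem Leaf.exists_union (h : Leaf G s P Y ℓ) (hd : Disjoint E P)
    (hE : ∀ x ∈ E, (P.card + E.card) * s ≤ degS G x Y) : ∃ ℓ', Leaf G s (E ∪ P) Y ℓ' := by
  induction E using Finset.induction_on with
  | empty => exact ⟨ℓ, by simpa using h⟩
  | insert x E hx ih =>
    rw [disjoint_insert_left] at hd
    obtain ⟨ℓ', h'⟩ := ih hd.2 fun y hy => by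
      refine le_trans ?_ (hE y (mem_insert_of_mem hy))
      gcongr
      exact subset_insert _ _
    have hdeg := hE x (mem_insert_self _ _)
    rw [card_insert_of_notMem hx] at hdeg
    obtain ⟨T, hT, hTc⟩ := exists_subset_card_eq (s := nb G x Y \ (E ∪ P).biUnion ℓ') (n := s) (by
      have h1 := le_card_sdiff ((E ∪ P).biUnion ℓ') (nb G x Y)
      rw [h'.card_biUnion, card_union_of_disjoint hd.2, card_nb] at h1
      have : (P.card + (E.card + 1)) * s = (E.card + P.card) * s + s := by ring
      omega)
    rw [insert_union]
    refine h'.exists_insert (x := x) (T := T) (by simp [hx, hd.1])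
      (hT.trans (sdiff_subset.trans nb_subset)) hTc (fun w hw => ?_)
      (disjoint_sdiff_self_left.mono_left hT)
    exact (mem_nb.1 (mem_sdiff.1 (hT hw)).1).2

/-- Complete stars with centres in `P` to copies of `K_{s,s}`. -/
theorem Leaf.exists_cover {D : ℕ} (h : Leaf G s P Y ℓ) (hY : ∀ y ∈ Y, X.card ≤ degS G y X + D)
    (hPX : Disjoint P X) (hPY : Disjoint (P ∪ X) Y) (hs : 0 < s)
    (hc : F.card + P.card * (s - 1) + s * D ≤ X.card) :
    ∃ X' ⊆ X \ F, X'.card = P.card * (s - 1) ∧ Til G s (P ∪ X') (P.biUnion ℓ) := by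
  induction P using Finset.induction_on with
  | empty => exact ⟨∅, by simp, by simp, by simpa using Til.empty⟩
  | insert x P hx ih =>
    rw [card_insert_of_notMem hx, add_mul, one_mul] at hc
    rw [disjoint_insert_left] at hPX
    rw [insert_union, disjoint_insert_left] at hPY
    obtain ⟨X', h1, h2, h3⟩ := ih (h.mono (subset_insert _ _) subset_rfl) hPX.2 hPY.2 (by omega)
    have hx0 := mem_insert_self x P
    obtain ⟨M, hM, hMc⟩ := exists_subset_card_eq (s := cnb G (ℓ x) X \ (F ∪ X')) (n := s - 1) (by
      have e1 := le_card_sdiff (F ∪ X') (cnb G (ℓ x) X)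
      have e2 := card_union_le F X'
      have e3 := card_le_card_cnb (G := G) (S := ℓ x) (Y := X) (D := D)
        fun u hu => hY u (h.subset x hx0 hu)
      rw [h.card x hx0] at e3
      omega)
    have hMX : M ⊆ X := hM.trans (sdiff_subset.trans cnb_subset)
    have hMF : Disjoint M (F ∪ X') := disjoint_sdiff_self_left.mono_left hM
    rw [disjoint_union_right] at hMF
    have hX'X : X' ⊆ X := h1.trans sdiff_subset
    have hxM : x ∉ M := fun hc => hPX.1 (hMX hc)
    refine ⟨M ∪ X', union_subset (fun w hw => mem_sdiff.2 ⟨hMX hw, disjoint_left.1 hMF.1 hw⟩) h1,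
      ?_, ?_⟩
    · rw [card_union_of_disjoint hMF.2, hMc, h2, card_insert_of_notMem hx]
      ring
    · have hk : IsKst G s s (insert x M) (ℓ x) := by
        refine ⟨?_, ?_, h.card x hx0, ?_⟩
        · rw [disjoint_insert_left]
          exact ⟨fun hc => hPY.1 (h.subset x hx0 hc),
            hPY.2.mono (hMX.trans subset_union_right) (h.subset x hx0)⟩
        · rw [card_insert_of_notMem hxM]
          omega
        · intro u hu w hw
          rcases mem_insert.1 hu with rfl | hu
          · exact h.adj _ hx0 w hw
          · exact ((mem_cnb.1 (mem_sdiff.1 (hM hu)).1).2 w hw).symm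
      have := Til.add hk (X := P ∪ X') (Y := P.biUnion ℓ) ?_ ?_ h3
      · rw [biUnion_insert]
        rwa [insert_union, union_left_comm, ← insert_union] at this
      · simp only [disjoint_insert_left, disjoint_union_right]
        exact ⟨⟨hx, hPX.2.symm.mono_left hMX⟩, fun h => hPX.1 (hX'X h), hMF.2⟩
      · rw [disjoint_biUnion_right]
        exact fun y hy => h.disj _ hx0 _ (mem_insert_of_mem hy) (by rintro rfl; exact hx hy)

theorem degS_sdiff_bound {D : ℕ} (h : Y.card ≤ degS G v Y + D) :
    (Y \ S).card ≤ degS G v (Y \ S) + D := by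
  have h1 := degS_add_nonadj (G := G) (v := v) (Y := Y)
  have h2 := degS_add_nonadj (G := G) (v := v) (Y := Y \ S)
  have h3 : ((Y \ S).filter fun w => ¬ G.Adj v w).card ≤ (Y.filter fun w => ¬ G.Adj v w).card :=
    card_le_card (filter_subset_filter _ sdiff_subset)
  omega

/-- A nearly complete pair together with few vertices that are centres of disjoint stars. -/
theorem til_of_leaves {D N : ℕ} {ℓ' : V → Finset V} (hs : 0 < s)
    (hX : Disjoint Xg Xb) (hY : Disjoint Yg Yb) (hXY : Disjoint (Xg ∪ Xb) (Yg ∪ Yb))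
    (hc : Xg.card + Xb.card = Yg.card + Yb.card) (hd : s ∣ Xg.card + Xb.card)
    (h1 : ∀ x ∈ Xg, Yg.card ≤ degS G x Yg + D) (h2 : ∀ y ∈ Yg, Xg.card ≤ degS G y Xg + D)
    (hXb : Xb.card ≤ N) (hYb : Yb.card ≤ N)
    (hXg : 2 * s * N + s * D + 2 * s * s * D ≤ Xg.card)
    (hYg : 2 * s * N + s * D + 2 * s * s * D ≤ Yg.card)
    (hl : Leaf G s Xb Yg ℓ) (hl' : Leaf G s Yb Xg ℓ') :
    Til G s (Xg ∪ Xb) (Yg ∪ Yb) := by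
  simp only [disjoint_union_left, disjoint_union_right] at hXY
  have a1 : Xb.card * s ≤ N * s := by gcongr
  have a2 : Yb.card * s ≤ N * s := by gcongr
  have a3 : Xb.card * (s - 1) ≤ N * s := by gcongr; omega
  have a4 : Yb.card * (s - 1) ≤ N * s := by gcongr; omega
  have e : 2 * s * N = N * s + N * s := by ring
  obtain ⟨X', x1, x2, x3⟩ := hl.exists_cover (F := Yb.biUnion ℓ') h2 hX.symm
    (by rw [disjoint_union_left]; exact ⟨hXY.1.2, hXY.1.1⟩) hs
    (by rw [hl'.card_biUnion]; omega)
  obtain ⟨Y', y1, y2, y3⟩ := hl'.exists_cover (F := Xb.biUnion ℓ) h1 hY.symm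
    (by rw [disjoint_union_left]; exact ⟨hXY.2.1.symm, hXY.1.1.symm⟩) hs
    (by rw [hl.card_biUnion]; omega)
  set LX := Xb.biUnion ℓ
  set LY := Yb.biUnion ℓ'
  have hX' : X' ⊆ Xg := x1.trans sdiff_subset
  have hY' : Y' ⊆ Yg := y1.trans sdiff_subset
  have hX'd : Disjoint X' LY := disjoint_sdiff_self_left.mono_left x1
  have hY'd : Disjoint Y' LX := disjoint_sdiff_self_left.mono_left y1
  have hLX : LX ⊆ Yg := hl.biUnion_subset
  have hLY : LY ⊆ Xg := hl'.biUnion_subset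
  have t := x3.union y3.symm (by
    simp only [disjoint_union_left]
    exact ⟨hX.symm.mono_right hLY, hX'd⟩) (by
    simp only [disjoint_union_right]
    exact ⟨hY.mono_left hLX, hY'd.symm⟩)
  have c1 : (X' ∪ LY).card = Xb.card * (s - 1) + Yb.card * s := by
    rw [card_union_of_disjoint hX'd, x2, hl'.card_biUnion]
  have c2 : (Y' ∪ LX).card = Yb.card * (s - 1) + Xb.card * s := by
    rw [card_union_of_disjoint hY'd, y2, hl.card_biUnion]
  have c3 := card_sdiff_add_card_eq_card (union_subset hX' hLY)
  have c4 := card_sdiff_add_card_eq_card (union_subset hY' hLX)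
  have b1 : Xb.card * s = Xb.card * (s - 1) + Xb.card := by
    rw [Nat.mul_sub, mul_one, Nat.sub_add_cancel (Nat.le_mul_of_pos_right _ hs)]
  have b2 : Yb.card * s = Yb.card * (s - 1) + Yb.card := by
    rw [Nat.mul_sub, mul_one, Nat.sub_add_cancel (Nat.le_mul_of_pos_right _ hs)]
  have t2 : Til G s (Xg \ (X' ∪ LY)) (Yg \ (Y' ∪ LX)) := by
    refine til_of_nearComplete (D := D) (hXY.1.1.mono sdiff_subset sdiff_subset) (by omega) ?_
      (by omega) hs (fun x hx => degS_sdiff_bound (h1 x (mem_sdiff.1 hx).1))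
      (fun x hx => degS_sdiff_bound (h2 x (mem_sdiff.1 hx).1))
    obtain ⟨k, hk⟩ := hd
    have : (Xg \ (X' ∪ LY)).card + (Xb.card + Yb.card) * s = s * k := by
      rw [add_mul]; omega
    exact (Nat.dvd_add_left (Dvd.intro_left _ rfl)).1 (this ▸ Dvd.intro _ rfl)
  have := t.union t2 (by
    simp only [disjoint_union_left]
    have := hX.mono_left (sdiff_subset (s := Xg) (t := X' ∪ LY))
    exact ⟨⟨this.symm, disjoint_sdiff.mono_left subset_union_left⟩,
      disjoint_sdiff.mono_left subset_union_right⟩) (by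
    simp only [disjoint_union_left]
    have := hY.mono_left (sdiff_subset (s := Yg) (t := Y' ∪ LX))
    exact ⟨disjoint_sdiff.mono_left subset_union_right, this.symm,
      disjoint_sdiff.mono_left subset_union_left⟩)
  rwa [union_assoc Xb, union_assoc Xb, union_sdiff_of_subset (union_subset hX' hLY),
    union_comm Xb, union_comm LX, union_assoc Yb, union_assoc Yb,
    union_sdiff_of_subset (union_subset hY' hLX), union_comm Yb] at this

end Finishing

section TwoSided

variable {G : SimpleGraph V} {s : ℕ} {A1 A2 A0 B1 B2 B0 X Y F : Finset V}

theorem til_side {Xg Xc X0 Yg Yc Y0 : Finset V} {D N : ℕ} {ℓ ℓ' : V → Finset V} (hs : 0 < s)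
    (x1 : Disjoint Xg Xc) (x2 : Disjoint Xg X0) (x3 : Disjoint X0 Xc)
    (y1 : Disjoint Yg Yc) (y2 : Disjoint Yg Y0) (y3 : Disjoint Y0 Yc)
    (hXY : Disjoint (Xg ∪ (X0 ∪ Xc)) (Yg ∪ (Y0 ∪ Yc)))
    (hc : Xg.card + X0.card + Xc.card = Yg.card + Y0.card + Yc.card)
    (hd : s ∣ Xg.card + X0.card + Xc.card)
    (h1 : ∀ x ∈ Xg, Yg.card ≤ degS G x Yg + D) (h2 : ∀ y ∈ Yg, Xg.card ≤ degS G y Xg + D)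
    (hX0 : ∀ x ∈ X0, N * s ≤ degS G x Yg) (hY0 : ∀ y ∈ Y0, N * s ≤ degS G y Xg)
    (hXb : X0.card + Xc.card ≤ N) (hYb : Y0.card + Yc.card ≤ N)
    (hXg : 2 * s * N + s * D + 2 * s * s * D ≤ Xg.card)
    (hYg : 2 * s * N + s * D + 2 * s * s * D ≤ Yg.card)
    (hl : Leaf G s Xc Yg ℓ) (hl' : Leaf G s Yc Xg ℓ') :
    Til G s (Xg ∪ (X0 ∪ Xc)) (Yg ∪ (Y0 ∪ Yc)) := by
  obtain ⟨m, hm⟩ := hl.exists_union x3 fun x hx => le_trans (by gcongr; omega) (hX0 x hx)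
  obtain ⟨m', hm'⟩ := hl'.exists_union y3 fun x hx => le_trans (by gcongr; omega) (hY0 x hx)
  have e1 := card_union_of_disjoint x3
  have e2 := card_union_of_disjoint y3
  exact til_of_leaves hs (disjoint_union_right.2 ⟨x2, x1⟩) (disjoint_union_right.2 ⟨y2, y1⟩) hXY
    (by omega) (by rwa [e1, ← add_assoc]) h1 h2 (by omega) (by omega) hXg hYg hm hm'

/-- Pairwise disjoint `s`-stars between `X` and `Y`: `p` with centre in `X`, `q` with centre
in `Y`. -/
def Stars (G : SimpleGraph V) (s : ℕ) (X Y : Finset V) (p q : ℕ) : Prop :=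
  ∃ CX ⊆ X, ∃ CY ⊆ Y, CX.card = p ∧ CY.card = q ∧
    (∃ ℓ, Leaf G s CX (Y \ CY) ℓ) ∧ ∃ ℓ, Leaf G s CY (X \ CX) ℓ

theorem Stars.zero : Stars G s X Y 0 0 :=
  ⟨∅, by simp, ∅, by simp, rfl, rfl, ⟨fun _ => ∅, .empty⟩, ⟨fun _ => ∅, .empty⟩⟩

theorem Stars.symm {p q : ℕ} (h : Stars G s X Y p q) : Stars G s Y X q p := by
  obtain ⟨CX, h1, CY, h2, h3, h4, h5, h6⟩ := h
  exact ⟨CY, h2, CX, h1, h4, h3, h6, h5⟩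

/-- The parts `A₁, A₂, A₀` of one side and `B₁, B₂, B₀` of the other side are disjoint. -/
structure Parts (A1 A2 A0 B1 B2 B0 : Finset V) : Prop where
  a12 : Disjoint A1 A2
  a10 : Disjoint A1 A0
  a20 : Disjoint A2 A0
  b12 : Disjoint B1 B2
  b10 : Disjoint B1 B0
  b20 : Disjoint B2 B0
  ab : Disjoint (A1 ∪ A2 ∪ A0) (B1 ∪ B2 ∪ B0)

theorem Parts.mono {A1' A2' A0' B1' B2' B0' : Finset V} (h : Parts A1 A2 A0 B1 B2 B0)
    (h1 : A1' ⊆ A1) (h2 : A2' ⊆ A2) (h3 : A0' ⊆ A0) (h4 : B1' ⊆ B1) (h5 : B2' ⊆ B2)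
    (h6 : B0' ⊆ B0) : Parts A1' A2' A0' B1' B2' B0' :=
  ⟨h.a12.mono h1 h2, h.a10.mono h1 h3, h.a20.mono h2 h3, h.b12.mono h4 h5, h.b10.mono h4 h6,
    h.b20.mono h5 h6, h.ab.mono (union_subset_union (union_subset_union h1 h2) h3)
      (union_subset_union (union_subset_union h4 h5) h6)⟩

/-- The pairs `(A₁, B₁)` and `(A₂, B₂)` are nearly complete and the vertices of `A₀` and `B₀` have
many neighbours in both parts of the other side. -/
structure Typical (G : SimpleGraph V) (D R : ℕ) (A1 A2 A0 B1 B2 B0 : Finset V) : Prop where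
  a1 : ∀ x ∈ A1, B1.card ≤ degS G x B1 + D
  a2 : ∀ x ∈ A2, B2.card ≤ degS G x B2 + D
  b1 : ∀ x ∈ B1, A1.card ≤ degS G x A1 + D
  b2 : ∀ x ∈ B2, A2.card ≤ degS G x A2 + D
  a01 : ∀ x ∈ A0, R ≤ degS G x B1
  a02 : ∀ x ∈ A0, R ≤ degS G x B2
  b01 : ∀ x ∈ B0, R ≤ degS G x A1
  b02 : ∀ x ∈ B0, R ≤ degS G x A2

theorem til_of_stars {D N R T : ℕ} (hs : 0 < s) (hP : Parts A1 A2 A0 B1 B2 B0)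
    (hG : Typical G D R A1 A2 A0 B1 B2 B0)
    (hc : A1.card + A2.card + A0.card = B1.card + B2.card + B0.card)
    (hd : s ∣ A1.card + A2.card + A0.card) (hT : s ∣ T)
    (hR : N * s + N ≤ R)
    (hNA : A0.card + (A1.card - T) + (T - A1.card - A0.card) ≤ N)
    (hNB : B0.card + (T - B1.card - B0.card) + (B1.card - T) ≤ N)
    (hA1 : 2 * s * N + s * D + 2 * s * s * D + N ≤ A1.card)
    (hA2 : 2 * s * N + s * D + 2 * s * s * D + N ≤ A2.card)
    (hB1 : 2 * s * N + s * D + 2 * s * s * D + N ≤ B1.card)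
    (hB2 : 2 * s * N + s * D + 2 * s * s * D + N ≤ B2.card)
    (h12 : Stars G s A1 B2 (A1.card - T) (T - B1.card - B0.card))
    (h21 : Stars G s A2 B1 (T - A1.card - A0.card) (B1.card - T)) :
    Til G s (A1 ∪ A2 ∪ A0) (B1 ∪ B2 ∪ B0) := by
  obtain ⟨CA1, ca1, CB2, cb2, ka1, kb2, ⟨ℓa, ha⟩, ⟨ℓb, hb⟩⟩ := h12
  obtain ⟨CA2, ca2, CB1, cb1, ka2, kb1, ⟨ℓc, hc'⟩, ⟨ℓd, hd'⟩⟩ := h21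
  have la1 := card_le_card ca1
  have la2 := card_le_card ca2
  have lb1 := card_le_card cb1
  have lb2 := card_le_card cb2
  obtain ⟨A0', a0, ka0⟩ := exists_subset_card_eq (s := A0) (n := T + CA1.card - A1.card - CA2.card)
    (by omega)
  obtain ⟨B0', b0, kb0⟩ := exists_subset_card_eq (s := B0) (n := T + CB1.card - B1.card - CB2.card)
    (by omega)
  have sa1 := card_sdiff_add_card_eq_card ca1
  have sa2 := card_sdiff_add_card_eq_card ca2
  have sb1 := card_sdiff_add_card_eq_card cb1
  have sb2 := card_sdiff_add_card_eq_card cb2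
  have sa0 := card_sdiff_add_card_eq_card a0
  have sb0 := card_sdiff_add_card_eq_card b0
  have hab := hP.ab
  have big : ∀ {v : V} {Y S : Finset V}, R ≤ degS G v Y → S.card ≤ N →
      N * s ≤ degS G v (Y \ S) := fun {v Y S} h h' => by
    have := degS_le_sdiff (G := G) (v := v) (X := S) (Y := Y)
    omega
  have t1 : Til G s ((A1 \ CA1) ∪ (A0' ∪ CA2)) ((B1 \ CB1) ∪ (B0' ∪ CB2)) := by
    refine til_side (D := D) (N := N) hs (hP.a12.mono sdiff_subset ca2)
      (hP.a10.mono sdiff_subset a0) (hP.a20.symm.mono a0 ca2) (hP.b12.mono sdiff_subset cb2)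
      (hP.b10.mono sdiff_subset b0) (hP.b20.symm.mono b0 cb2) (hab.mono ?_ ?_) (by omega)
      ?_ (fun x hx => degS_sdiff_bound (hG.a1 x (mem_sdiff.1 hx).1))
      (fun x hx => degS_sdiff_bound (hG.b1 x (mem_sdiff.1 hx).1))
      (fun x hx => big (hG.a01 x (a0 hx)) (by omega))
      (fun x hx => big (hG.b01 x (b0 hx)) (by omega))
      (by omega) (by omega) (by omega) (by omega) hc' hb
    · grind
    · grind
    · convert hT using 1
      omega
  have t2 : Til G s ((A2 \ CA2) ∪ ((A0 \ A0') ∪ CA1)) ((B2 \ CB2) ∪ ((B0 \ B0') ∪ CB1)) := by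
    refine til_side (D := D) (N := N) hs (hP.a12.symm.mono sdiff_subset ca1)
      (hP.a20.mono sdiff_subset sdiff_subset) (hP.a10.symm.mono sdiff_subset ca1)
      (hP.b12.symm.mono sdiff_subset cb1)
      (hP.b20.mono sdiff_subset sdiff_subset) (hP.b10.symm.mono sdiff_subset cb1)
      (hab.mono ?_ ?_) (by omega)
      ?_ (fun x hx => degS_sdiff_bound (hG.a2 x (mem_sdiff.1 hx).1))
      (fun x hx => degS_sdiff_bound (hG.b2 x (mem_sdiff.1 hx).1))
      (fun x hx => big (hG.a02 x (mem_sdiff.1 hx).1) (by omega))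
      (fun x hx => big (hG.b02 x (mem_sdiff.1 hx).1) (by omega))
      (by omega) (by omega) (by omega) (by omega) ha hd'
    · grind
    · grind
    · have : (A2 \ CA2).card + (A0 \ A0').card + CA1.card + T = A1.card + A2.card + A0.card := by
        omega
      exact (Nat.dvd_add_left hT).1 (this ▸ hd)
  have a12 := hP.a12
  have a10 := hP.a10
  have a20 := hP.a20
  have b12 := hP.b12
  have b10 := hP.b10
  have b20 := hP.b20
  rw [disjoint_left] at a12 a10 a20 b12 b10 b20
  have := t1.union t2 (by rw [disjoint_left]; grind) (by rw [disjoint_left]; grind)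
  convert this using 1
  · ext x; grind
  · ext x; grind

end TwoSided

section StarLemma

variable {G : SimpleGraph V} {s : ℕ} {X Y X' Y' F L : Finset V} {c : V}

theorem eAB_le_mul {d : ℕ} (h : ∀ x ∈ X, degS G x Y ≤ d) : eAB G X Y ≤ X.card * d :=
  (sum_le_card_nsmul X (fun x => degS G x Y) d h).trans_eq (smul_eq_mul _ _)

theorem mul_le_eAB {d : ℕ} (h : ∀ x ∈ X, d ≤ degS G x Y) : X.card * d ≤ eAB G X Y :=
  (smul_eq_mul _ _).symm.trans_le (card_nsmul_le_sum X (fun x => degS G x Y) d h)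

theorem Stars.add {p q : ℕ} (h : Stars G s X Y p q) (hX : X ⊆ X') (hY : Y ⊆ Y') (hc : c ∈ X')
    (hcX : c ∉ X) (hL : L ⊆ Y') (hLY : Disjoint L Y) (hLc : L.card = s)
    (hLa : ∀ w ∈ L, G.Adj c w) : Stars G s X' Y' (p + 1) q := by
  obtain ⟨CX, h1, CY, h2, h3, h4, ⟨ℓ, h5⟩, ℓ', h6⟩ := h
  have hcC : c ∉ CX := fun h => hcX (h1 h)
  refine ⟨insert c CX, insert_subset hc (h1.trans hX), CY, h2.trans hY, ?_, h4, ?_, ℓ', ?_⟩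
  · rw [card_insert_of_notMem hcC, h3]
  · refine (h5.mono subset_rfl (sdiff_subset_sdiff hY subset_rfl)).exists_insert hcC (T := L)
      ?_ hLc hLa (hLY.mono_right (h5.biUnion_subset.trans sdiff_subset))
    exact fun w hw => mem_sdiff.2 ⟨hL hw, fun hw' => disjoint_left.1 hLY hw (h2 hw')⟩
  · refine h6.mono subset_rfl fun w hw => ?_
    obtain ⟨e1, e2⟩ := mem_sdiff.1 hw
    refine mem_sdiff.2 ⟨hX e1, ?_⟩
    rw [mem_insert]
    rintro (rfl | h)
    · exact hcX e1
    · exact e2 h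

/-- If there are many edges, then there is a star avoiding a small set. -/
theorem exists_star {D : ℕ} (hXY : Disjoint X Y) (hX : ∀ x ∈ X, degS G x Y ≤ D)
    (hY : ∀ y ∈ Y, degS G y X ≤ D) (hs : 0 < s)
    (he : X.card * (s - 1) + F.card * D < eAB G X Y) :
    ∃ c ∈ X \ F, ∃ L ⊆ Y \ F, L.card = s ∧ ∀ w ∈ L, G.Adj c w := by
  by_contra! hcon
  have h1 : ∀ x ∈ X \ F, degS G x (Y \ F) ≤ s - 1 := by
    intro x hx
    by_contra hlt
    obtain ⟨L, hL, hLc⟩ := exists_subset_card_eq (s := nb G x (Y \ F)) (n := s)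
      (by rw [card_nb]; omega)
    obtain ⟨w, hw, hn⟩ := hcon x hx L (hL.trans nb_subset) hLc
    exact hn (mem_nb.1 (hL hw)).2
  have e1 : eAB G X Y = eAB G (X ∩ F) Y + eAB G (X \ F) Y := by
    rw [← eAB_union_left (disjoint_sdiff_inter X F).symm, union_comm, sdiff_union_inter]
  have e2 : eAB G (X \ F) Y = eAB G (X \ F) (Y ∩ F) + eAB G (X \ F) (Y \ F) := by
    rw [← eAB_union_right (disjoint_sdiff_inter Y F).symm, union_comm, sdiff_union_inter]
  have e3 : eAB G (X ∩ F) Y ≤ (X ∩ F).card * D :=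
    eAB_le_mul fun x hx => hX x (mem_inter.1 hx).1
  have e4 : eAB G (X \ F) (Y ∩ F) ≤ (Y ∩ F).card * D := by
    rw [eAB_comm]
    exact eAB_le_mul fun y hy => (degS_mono sdiff_subset).trans (hY y (mem_inter.1 hy).1)
  have e5 : eAB G (X \ F) (Y \ F) ≤ X.card * (s - 1) :=
    (eAB_le_mul h1).trans (by gcongr; exact sdiff_subset)
  have e6 : (X ∩ F).card + (Y ∩ F).card ≤ F.card := by
    rw [← card_union_of_disjoint (hXY.mono inter_subset_left inter_subset_left)]
    exact card_le_card (union_subset inter_subset_right inter_subset_right)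
  have : (X ∩ F).card * D + (Y ∩ F).card * D ≤ F.card * D := by
    rw [← add_mul]; gcongr
  omega

theorem stars_of_eAB {D M : ℕ} (hXY : Disjoint X Y) (hX : ∀ x ∈ X, degS G x Y ≤ D)
    (hY : ∀ y ∈ Y, degS G y X ≤ D) (hs : 0 < s) (hXM : X.card ≤ M) (hYM : Y.card ≤ M)
    (p q : ℕ) (he : M * (s - 1) + (F.card + (p + q) * (s + 1)) * D < eAB G X Y) :
    Stars G s (X \ F) (Y \ F) p q := by
  obtain ⟨k, hk⟩ : ∃ k, p + q = k := ⟨_, rfl⟩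
  rw [hk] at he
  induction k generalizing X Y F p q with
  | zero =>
    obtain ⟨rfl, rfl⟩ : p = 0 ∧ q = 0 := by omega
    exact Stars.zero
  | succ k ih =>
    wlog hp : p ≠ 0 generalizing X Y p q
    · exact (this hXY.symm hY hX hYM hXM q p (by rwa [eAB_comm]) (by omega)
        (by omega)).symm
    obtain ⟨p, rfl⟩ := Nat.exists_eq_succ_of_ne_zero hp
    obtain ⟨c, hc, L, hL, hLc, hLa⟩ := exists_star (F := F) (s := s) hXY hX hY hs (by
      refine lt_of_le_of_lt ?_ he
      gcongr
      omega)
    have h := ih (F := F ∪ insert c L) hXY hX hY hXM hYM p q (by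
      refine lt_of_le_of_lt ?_ he
      have h1 := card_union_le F (insert c L)
      have h2 := card_insert_le c L
      have h3 : (F ∪ insert c L).card + k * (s + 1) ≤ F.card + (k + 1) * (s + 1) := by
        rw [add_mul]
        omega
      gcongr) (by omega)
    refine h.add (sdiff_subset_sdiff subset_rfl subset_union_left)
      (sdiff_subset_sdiff subset_rfl subset_union_left) hc (by simp) hL ?_ hLc hLa
    rw [disjoint_left]
    intro w hw
    simp [hw]

theorem stars_of_degree {D P f t : ℕ} (hXY : Disjoint X Y) (hX : ∀ x ∈ X, degS G x Y ≤ D)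
    (hY : ∀ y ∈ Y, degS G y X ≤ D) (hs : 0 < s) (hP : 1 ≤ P)
    (hdeg : (∀ x ∈ X, s - 1 + P ≤ degS G x Y) ∨ (∀ y ∈ Y, s - 1 + P ≤ degS G y X))
    (hXt : X.card ≤ Y.card + t) (hYt : Y.card ≤ X.card + t) (hF : F.card ≤ f)
    (hXb : (s - 1) * t + (4 * (s + 1) + f) * D < X.card)
    (hYb : (s - 1) * t + (4 * (s + 1) + f) * D < Y.card)
    {p q : ℕ} (hpq : p + q ≤ 4 * P) :
    Stars G s (X \ F) (Y \ F) p q := by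
  wlog h : ∀ x ∈ X, s - 1 + P ≤ degS G x Y generalizing X Y p q
  · exact (this hXY.symm hY hX hdeg.symm hYt hXt hYb hXb (by omega) (hdeg.resolve_left h)).symm
  refine stars_of_eAB hXY hX hY hs (M := X.card + t) (by omega) hYt p q ?_
  refine lt_of_lt_of_le ?_ (mul_le_eAB h)
  have h1 : (s - 1) * t + (F.card + (p + q) * (s + 1)) * D ≤
      P * ((s - 1) * t + (4 * (s + 1) + f) * D) := by
    have h2 : (s - 1) * t ≤ P * ((s - 1) * t) := Nat.le_mul_of_pos_left _ hP
    have h3 : F.card ≤ P * f := hF.trans (Nat.le_mul_of_pos_left _ hP)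
    calc (s - 1) * t + (F.card + (p + q) * (s + 1)) * D
        ≤ P * ((s - 1) * t) + (P * f + 4 * P * (s + 1)) * D := by gcongr
      _ = _ := by ring
  have h2 : P * ((s - 1) * t + (4 * (s + 1) + f) * D) < P * X.card := by gcongr
  calc (X.card + t) * (s - 1) + (F.card + (p + q) * (s + 1)) * D
      = X.card * (s - 1) + ((s - 1) * t + (F.card + (p + q) * (s + 1)) * D) := by ring
    _ < X.card * (s - 1) + P * X.card := by omega
    _ = _ := by ring

end StarLemma

section Extremal

variable {G : SimpleGraph V} {s n S D R t D0 k : ℕ} {A1 A2 A0 B1 B2 B0 X Y F : Finset V}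

/-- Size relations between the parameters of an extremal configuration. -/
structure ConfigNum (s n S D R t : ℕ) : Prop where
  sparse : 2 * ((s - 1) * (2 * t) + (4 * (s + 1) + 2 * s) * S + t) < n
  large : 2 * (2 * s * (6 * t + 6 * s) + s * D + 2 * s * s * D + (6 * t + 6 * s) + t + 2 * s) ≤ n
  deg : (6 * t + 6 * s) * s + (6 * t + 6 * s) + 2 * s ≤ R
  degs : (s - 1) * ((s - 1) * (2 * t + 1) + 1) + s + (s - 1) * (2 * t) + 1 ≤ R

/-- All degrees in the bipartite graph between `X` and `Y` are at most `S`. -/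
def SparsePair (G : SimpleGraph V) (S : ℕ) (X Y : Finset V) : Prop :=
  (∀ x ∈ X, degS G x Y ≤ S) ∧ ∀ y ∈ Y, degS G y X ≤ S

theorem SparsePair.symm (h : SparsePair G S X Y) : SparsePair G S Y X := ⟨h.2, h.1⟩

/-- The structure of a graph close to the extremal configurations. -/
structure Config (G : SimpleGraph V) (s n S D R t D0 : ℕ) (A1 A2 A0 B1 B2 B0 : Finset V) :
    Prop where
  num : ConfigNum s n S D R t
  parts : Parts A1 A2 A0 B1 B2 B0
  typ : Typical G D R A1 A2 A0 B1 B2 B0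
  cardA : A1.card + A2.card + A0.card = n
  cardB : B1.card + B2.card + B0.card = n
  a1l : n ≤ 2 * A1.card + 2 * t
  a2l : n ≤ 2 * A2.card + 2 * t
  b1l : n ≤ 2 * B1.card + 2 * t
  b2l : n ≤ 2 * B2.card + 2 * t
  a1u : 2 * A1.card ≤ n + 2 * t
  a2u : 2 * A2.card ≤ n + 2 * t
  b1u : 2 * B1.card ≤ n + 2 * t
  b2u : 2 * B2.card ≤ n + 2 * t
  degA : ∀ x ∈ A1 ∪ A2 ∪ A0, D0 ≤ degS G x (B1 ∪ B2 ∪ B0)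
  degB : ∀ x ∈ B1 ∪ B2 ∪ B0, D0 ≤ degS G x (A1 ∪ A2 ∪ A0)
  sp : SparsePair G S A1 B2
  sp' : SparsePair G S A2 B1 ∨ 2 * A2.card + 2 * s ≤ n ∧ 2 * B1.card + 2 * s ≤ n

theorem Parts.swap (h : Parts A1 A2 A0 B1 B2 B0) : Parts A2 A1 A0 B2 B1 B0 :=
  ⟨h.a12.symm, h.a20, h.a10, h.b12.symm, h.b20, h.b10, by
    rw [union_comm A2, union_comm B2]; exact h.ab⟩

theorem Parts.flip (h : Parts A1 A2 A0 B1 B2 B0) : Parts B2 B1 B0 A2 A1 A0 :=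
  ⟨h.b12.symm, h.b20, h.b10, h.a12.symm, h.a20, h.a10, by
    rw [union_comm A2, union_comm B2]; exact h.ab.symm⟩

theorem Typical.swap (h : Typical G D R A1 A2 A0 B1 B2 B0) : Typical G D R A2 A1 A0 B2 B1 B0 :=
  ⟨h.a2, h.a1, h.b2, h.b1, h.a02, h.a01, h.b02, h.b01⟩

theorem Typical.flip (h : Typical G D R A1 A2 A0 B1 B2 B0) : Typical G D R B2 B1 B0 A2 A1 A0 :=
  ⟨h.b2, h.b1, h.a2, h.a1, h.b02, h.b01, h.a02, h.a01⟩

theorem Config.swap (h : Config G s n S D R t D0 A1 A2 A0 B1 B2 B0) (h' : SparsePair G S A2 B1) :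
    Config G s n S D R t D0 A2 A1 A0 B2 B1 B0 := by
  refine ⟨h.num, h.parts.swap, h.typ.swap, ?_, ?_, h.a2l, h.a1l, h.b2l, h.b1l, h.a2u, h.a1u,
    h.b2u, h.b1u, ?_, ?_, h', .inl h.sp⟩
  · rw [← h.cardA]; ring
  · rw [← h.cardB]; ring
  · rw [union_comm A2, union_comm B2]; exact h.degA
  · rw [union_comm A2, union_comm B2]; exact h.degB

theorem Config.flip (h : Config G s n S D R t D0 A1 A2 A0 B1 B2 B0) :
    Config G s n S D R t D0 B2 B1 B0 A2 A1 A0 := by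
  refine ⟨h.num, h.parts.flip, h.typ.flip, ?_, ?_, h.b2l, h.b1l, h.a2l, h.a1l, h.b2u, h.b1u,
    h.a2u, h.a1u, ?_, ?_, h.sp.symm, h.sp'.imp SparsePair.symm And.symm⟩
  · rw [← h.cardB]; ring
  · rw [← h.cardA]; ring
  · rw [union_comm A2, union_comm B2]; exact h.degB
  · rw [union_comm A2, union_comm B2]; exact h.degA

theorem Config.til_sdiff (h : Config G s n S D R t D0 A1 A2 A0 B1 B2 B0) (hs : 0 < s)
    {T : ℕ} (hF : F.card ≤ 2 * s)
    (hbal : ((A1 ∪ A2 ∪ A0) \ F).card = ((B1 ∪ B2 ∪ B0) \ F).card)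
    (hd : s ∣ ((A1 ∪ A2 ∪ A0) \ F).card) (hT : s ∣ T) (hT1 : n ≤ 2 * T + 2 * s)
    (hT2 : 2 * T ≤ n + 2 * s)
    (h12 : Stars G s (A1 \ F) (B2 \ F) ((A1 \ F).card - T) (T - (B1 \ F).card - (B0 \ F).card))
    (h21 : Stars G s (A2 \ F) (B1 \ F) (T - (A1 \ F).card - (A0 \ F).card) ((B1 \ F).card - T)) :
    Til G s ((A1 ∪ A2 ∪ A0) \ F) ((B1 ∪ B2 ∪ B0) \ F) := by
  have hsd : ∀ Z : Finset V, Z.card ≤ (Z \ F).card + 2 * s ∧ (Z \ F).card ≤ Z.card := fun Z => by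
    have := le_card_sdiff F Z
    exact ⟨by omega, card_le_card sdiff_subset⟩
  have hP : Parts (A1 \ F) (A2 \ F) (A0 \ F) (B1 \ F) (B2 \ F) (B0 \ F) :=
    h.parts.mono sdiff_subset sdiff_subset sdiff_subset sdiff_subset sdiff_subset sdiff_subset
  have eA : (A1 ∪ A2 ∪ A0) \ F = A1 \ F ∪ A2 \ F ∪ A0 \ F := by simp only [union_sdiff_distrib]
  have eB : (B1 ∪ B2 ∪ B0) \ F = B1 \ F ∪ B2 \ F ∪ B0 \ F := by simp only [union_sdiff_distrib]
  have cA : ((A1 ∪ A2 ∪ A0) \ F).card = (A1 \ F).card + (A2 \ F).card + (A0 \ F).card := by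
    rw [eA, card_union_of_disjoint (disjoint_union_left.2 ⟨hP.a10, hP.a20⟩),
      card_union_of_disjoint hP.a12]
  have cB : ((B1 ∪ B2 ∪ B0) \ F).card = (B1 \ F).card + (B2 \ F).card + (B0 \ F).card := by
    rw [eB, card_union_of_disjoint (disjoint_union_left.2 ⟨hP.b10, hP.b20⟩),
      card_union_of_disjoint hP.b12]
  have dg : ∀ {v : V} {Y : Finset V}, R ≤ degS G v Y → R - 2 * s ≤ degS G v (Y \ F) :=
    fun {v Y} h => by
      have := degS_le_sdiff (G := G) (v := v) (X := F) (Y := Y)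
      omega
  have typ := h.typ
  have hG : Typical G D (R - 2 * s) (A1 \ F) (A2 \ F) (A0 \ F) (B1 \ F) (B2 \ F) (B0 \ F) :=
    ⟨fun x hx => degS_sdiff_bound (typ.a1 x (mem_sdiff.1 hx).1),
      fun x hx => degS_sdiff_bound (typ.a2 x (mem_sdiff.1 hx).1),
      fun x hx => degS_sdiff_bound (typ.b1 x (mem_sdiff.1 hx).1),
      fun x hx => degS_sdiff_bound (typ.b2 x (mem_sdiff.1 hx).1),
      fun x hx => dg (typ.a01 x (mem_sdiff.1 hx).1),
      fun x hx => dg (typ.a02 x (mem_sdiff.1 hx).1),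
      fun x hx => dg (typ.b01 x (mem_sdiff.1 hx).1),
      fun x hx => dg (typ.b02 x (mem_sdiff.1 hx).1)⟩
  have n1 := h.num.large
  have n2 := h.num.deg
  have a0 : A0.card ≤ 2 * t := by have := h.cardA; have := h.a1l; have := h.a2l; omega
  have b0 : B0.card ≤ 2 * t := by have := h.cardB; have := h.b1l; have := h.b2l; omega
  have big : ∀ Z : Finset V, n ≤ 2 * Z.card + 2 * t → 2 * s * (6 * t + 6 * s) + s * D +
      2 * s * s * D + (6 * t + 6 * s) ≤ (Z \ F).card := fun Z hZ => by
    have := (hsd Z).1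
    omega
  have few : ∀ Z W : Finset V, n ≤ 2 * Z.card + 2 * t → 2 * Z.card ≤ n + 2 * t →
      W.card ≤ 2 * t → (W \ F).card + ((Z \ F).card - T) + (T - (Z \ F).card - (W \ F).card) ≤
        6 * t + 6 * s := fun Z W h1 h2 h3 => by
    have := hsd Z
    have := hsd W
    clear n1 n2 cA cB
    omega
  rw [cA] at hbal hd
  rw [cB] at hbal
  rw [eA, eB]
  refine til_of_stars (N := 6 * t + 6 * s) hs hP hG hbal hd hT ?_ (few _ _ h.a1l h.a1u a0) ?_
    (big _ h.a1l) (big _ h.a2l) (big _ h.b1l) (big _ h.b2l) h12 h21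
  · clear n1
    omega
  · rw [add_right_comm]
    exact few _ _ h.b1l h.b1u b0

end Extremal

section Cases

variable {G : SimpleGraph V} {s n S D R t D0 k : ℕ} {A1 A2 A0 B1 B2 B0 X Y F : Finset V}

theorem Config.cardAU (h : Config G s n S D R t D0 A1 A2 A0 B1 B2 B0) :
    (A1 ∪ A2 ∪ A0).card = n := by
  rw [card_union_of_disjoint (disjoint_union_left.2 ⟨h.parts.a10, h.parts.a20⟩),
    card_union_of_disjoint h.parts.a12, h.cardA]

theorem Config.cardBU (h : Config G s n S D R t D0 A1 A2 A0 B1 B2 B0) :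
    (B1 ∪ B2 ∪ B0).card = n := by
  rw [card_union_of_disjoint (disjoint_union_left.2 ⟨h.parts.b10, h.parts.b20⟩),
    card_union_of_disjoint h.parts.b12, h.cardB]

theorem Config.deg12 (h : Config G s n S D R t D0 A1 A2 A0 B1 B2 B0) {x : V}
    (hx : x ∈ A1 ∪ A2 ∪ A0) : D0 ≤ degS G x B1 + degS G x B2 + degS G x B0 :=
  (h.degA x hx).trans (degS_union_le.trans (Nat.add_le_add_right degS_union_le _))

theorem Config.le_deg_a1 (h : Config G s n S D R t D0 A1 A2 A0 B1 B2 B0) {x : V} (hx : x ∈ A1) :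
    D0 + B2.card ≤ n + degS G x B2 := by
  have h1 := h.deg12 (x := x) (by simp [hx])
  have h2 := degS_le_card (G := G) (v := x) (Y := B1)
  have h3 := degS_le_card (G := G) (v := x) (Y := B0)
  have := h.cardB
  omega

theorem Config.le_deg_b2 (h : Config G s n S D R t D0 A1 A2 A0 B1 B2 B0) {x : V} (hx : x ∈ B2) :
    D0 + A1.card ≤ n + degS G x A1 := h.flip.le_deg_a1 hx

theorem Config.disj (h : Config G s n S D R t D0 A1 A2 A0 B1 B2 B0) {X Y : Finset V}
    (hX : X ⊆ A1 ∪ A2 ∪ A0) (hY : Y ⊆ B1 ∪ B2 ∪ B0) : Disjoint X Y :=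
  h.parts.ab.mono hX hY

theorem Config.stars12 (h : Config G s n S D R t D0 A1 A2 A0 B1 B2 B0) (hs : 0 < s) {P p q : ℕ}
    (hP : 1 ≤ P) (hd : n + s - 1 + P ≤ D0 + A1.card ∨ n + s - 1 + P ≤ D0 + B2.card)
    (hF : F.card ≤ 2 * s) (hpq : p + q ≤ 4 * P) : Stars G s (A1 \ F) (B2 \ F) p q := by
  have n1 := h.num.sparse
  have h1 := h.a1l
  have h2 := h.a1u
  have h3 := h.b2l
  have h4 := h.b2u
  refine stars_of_degree (t := 2 * t) (f := 2 * s) (D := S) (P := P)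
    (h.disj (subset_union_left.trans subset_union_left)
      (subset_union_right.trans subset_union_left)) h.sp.1 h.sp.2 hs hP ?_
    (by omega) (by omega) hF (by omega) (by omega) hpq
  rcases hd with hd | hd
  · right
    intro y hy
    have := h.le_deg_b2 hy
    omega
  · left
    intro y hy
    have := h.le_deg_a1 hy
    omega

theorem Config.stars21 (h : Config G s n S D R t D0 A1 A2 A0 B1 B2 B0) (hs : 0 < s) {P p q : ℕ}
    (hD : 2 * D0 ≤ n + 3 * s)
    (hP : 1 ≤ P) (hd : n + s - 1 + P ≤ D0 + A2.card ∨ n + s - 1 + P ≤ D0 + B1.card)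
    (hF : F.card ≤ 2 * s) (hpq : p + q ≤ 4 * P) : Stars G s (A2 \ F) (B1 \ F) p q := by
  rcases h.sp' with h' | h'
  · exact (h.swap h').stars12 hs hP hd hF hpq
  · omega

theorem Stars.sdiff_empty {p q : ℕ} (h : Stars G s (X \ ∅) (Y \ ∅) p q) : Stars G s X Y p q := by
  simpa using h

theorem Config.til_of_stars (h : Config G s n S D R t D0 A1 A2 A0 B1 B2 B0) (hs : 0 < s)
    {T : ℕ} (hd : s ∣ n) (hT : s ∣ T) (hT1 : n ≤ 2 * T + 2 * s) (hT2 : 2 * T ≤ n + 2 * s)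
    (h12 : Stars G s A1 B2 (A1.card - T) (T - B1.card - B0.card))
    (h21 : Stars G s A2 B1 (T - A1.card - A0.card) (B1.card - T)) :
    Til G s (A1 ∪ A2 ∪ A0) (B1 ∪ B2 ∪ B0) := by
  have := h.til_sdiff hs (F := ∅) (T := T) (by simp)
    (by rw [sdiff_empty, sdiff_empty, h.cardAU, h.cardBU]) (by rwa [sdiff_empty, h.cardAU])
    hT hT1 hT2 (by simpa using h12) (by simpa using h21)
  simpa using this

theorem Config.til_even (h : Config G s n S D R t D0 A1 A2 A0 B1 B2 B0) (hs : 2 ≤ s)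
    (hn : n = 2 * (k * s)) (hD : D0 = k * s + s - 1) :
    Til G s (A1 ∪ A2 ∪ A0) (B1 ∪ B2 ∪ B0) := by
  have cA := h.cardA
  have cB := h.cardB
  refine h.til_of_stars (T := k * s) (by omega) (by rw [hn]; exact ⟨2 * k, by ring⟩)
    (Dvd.intro_left _ rfl) (by omega) (by omega) ?_ ?_
  · by_cases hc : A1.card ≤ k * s ∧ B2.card ≤ k * s
    · rw [show A1.card - k * s = 0 by omega, show k * s - B1.card - B0.card = 0 by omega]
      exact Stars.zero
    · exact (h.stars12 (F := ∅) (P := max A1.card B2.card - k * s) (by omega) (by omega)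
        (by omega) (by simp) (by omega)).sdiff_empty
  · by_cases hc : A2.card ≤ k * s ∧ B1.card ≤ k * s
    · rw [show B1.card - k * s = 0 by omega, show k * s - A1.card - A0.card = 0 by omega]
      exact Stars.zero
    · exact (h.stars21 (F := ∅) (P := max A2.card B1.card - k * s) (by omega) (by omega) (by omega)
        (by omega) (by simp) (by omega)).sdiff_empty

theorem Stars.one {x : V} (hx : x ∈ X) (hxs : s ≤ degS G x Y) :
    Stars G s X Y 1 0 := by
  obtain ⟨L, hL, hLc⟩ := exists_subset_card_eq (s := nb G x Y) (n := s)
    (by rw [card_nb]; omega)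
  exact (Stars.zero (G := G) (s := s) (X := ∅) (Y := ∅)).add (X' := X) (Y' := Y) (c := x)
    (L := L) (by simp) (by simp) hx (by simp) (hL.trans nb_subset) (by simp) hLc
    fun w hw => (mem_nb.1 (hL hw)).2

/-- The possible numbers of stars needed between `A₁` and `B₂` are available, unless all
degrees are too small. -/
theorem Config.stars_odd (h : Config G s n S D R t D0 A1 A2 A0 B1 B2 B0) (hs : 2 ≤ s)
    (hn : n = 2 * (k * s) + s) (hD : D0 = k * s + 2 * s - 2) :
    (Stars G s A1 B2 (A1.card - k * s) (B2.card - (k * s + s)) ∧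
      Stars G s A1 B2 (A1.card - (k * s + s)) (B2.card - k * s)) ∨
    (A1.card ≤ k * s ∧ B2.card = k * s + 1 ∧
      Stars G s A1 B2 (A1.card - k * s) (B2.card - (k * s + s))) ∨
    (B2.card ≤ k * s ∧ A1.card = k * s + 1 ∧
      Stars G s A1 B2 (A1.card - (k * s + s)) (B2.card - k * s)) ∨
    (A1.card = k * s + 1 ∧ B2.card = k * s + 1 ∧ (∀ x ∈ A1, degS G x B2 ≤ s - 1) ∧
      ∀ y ∈ B2, degS G y A1 ≤ s - 1) := by
  by_cases h1 : k * s + 2 ≤ A1.card ∨ k * s + 2 ≤ B2.card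
  · left
    constructor <;>
    exact (h.stars12 (F := ∅) (P := max A1.card B2.card - k * s - 1) (by omega) (by omega)
        (by omega) (by simp) (by omega)).sdiff_empty
  by_cases h2 : A1.card = k * s + 1 ∧ B2.card = k * s + 1
  · obtain ⟨e1, e2⟩ := h2
    have m1 : ∀ x ∈ A1, s - 1 ≤ degS G x B2 := fun x hx => by
      have := h.le_deg_a1 hx
      omega
    have m2 : ∀ x ∈ B2, s - 1 ≤ degS G x A1 := fun x hx => by
      have := h.le_deg_b2 hx
      omega
    have trans : ∀ {X Y : Finset V}, X.card = Y.card → (∀ y ∈ Y, degS G y X ≤ s - 1) →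
        (∀ x ∈ X, s - 1 ≤ degS G x Y) → ∀ x ∈ X, degS G x Y ≤ s - 1 := by
      intro X Y hc hY hX x hx
      have e1 : eAB G Y X ≤ Y.card * (s - 1) := eAB_le_mul hY
      rw [eAB_comm, ← hc] at e1
      have e2 : degS G x Y + (X.erase x).card * (s - 1) ≤ eAB G X Y := by
        unfold eAB
        rw [← add_sum_erase X _ hx]
        gcongr
        exact mul_le_eAB fun z hz => hX z (mem_of_mem_erase hz)
      rw [card_erase_of_mem hx] at e2
      have : X.card * (s - 1) = (X.card - 1) * (s - 1) + (s - 1) := by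
        rw [← Nat.succ_mul, Nat.succ_eq_add_one, Nat.sub_add_cancel (card_pos.2 ⟨x, hx⟩)]
      omega
    by_cases hA : ∀ x ∈ A1, degS G x B2 ≤ s - 1
    · exact .inr (.inr (.inr ⟨e1, e2, hA, trans (by omega) hA m2⟩))
    · have hB : ¬ ∀ x ∈ B2, degS G x A1 ≤ s - 1 := fun hB => hA (trans (by omega) hB m1)
      push Not at hA hB
      obtain ⟨x, hx, hxs⟩ := hA
      obtain ⟨y, hy, hys⟩ := hB
      left
      rw [e1, e2, show k * s + 1 - k * s = 1 by omega, show k * s + 1 - (k * s + s) = 0 by omega]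
      exact ⟨.one hx (by omega), (Stars.one hy (by omega)).symm⟩
  · rcases le_or_gt A1.card (k * s) with h3 | h3
    · rcases le_or_gt B2.card (k * s) with h4 | h4
      · left
        simp only [Nat.sub_eq_zero_of_le h3, Nat.sub_eq_zero_of_le h4,
          Nat.sub_eq_zero_of_le (h3.trans (Nat.le_add_right _ s)),
          Nat.sub_eq_zero_of_le (h4.trans (Nat.le_add_right _ s))]
        exact ⟨Stars.zero, Stars.zero⟩
      · right; left
        refine ⟨h3, by omega, ?_⟩
        rw [show A1.card - k * s = 0 by omega, show B2.card - (k * s + s) = 0 by omega]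
        exact Stars.zero
    · right; right; left
      refine ⟨by omega, by omega, ?_⟩
      rw [show A1.card - (k * s + s) = 0 by omega, show B2.card - k * s = 0 by omega]
      exact Stars.zero

end Cases

section OddCase

variable {G : SimpleGraph V} {s n S D R t D0 k : ℕ} {A1 A2 A0 B1 B2 B0 X Y F M L : Finset V}

/-- Remove one copy of `K_{s,s}` from an extremal configuration and tile the rest. -/
theorem Config.til_of_isKst (h : Config G s n S D R t D0 A1 A2 A0 B1 B2 B0) (hs : 0 < s)
    {T : ℕ} {P Q : Finset V} (hPQ : IsKst G s s P Q) (hP : P ⊆ A1 ∪ A2 ∪ A0)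
    (hQ : Q ⊆ B1 ∪ B2 ∪ B0) (hd : s ∣ n) (hT : s ∣ T) (hT1 : n ≤ 2 * T + 2 * s)
    (hT2 : 2 * T ≤ n + 2 * s)
    (h12 : Stars G s (A1 \ (P ∪ Q)) (B2 \ (P ∪ Q)) ((A1 \ P).card - T)
      (T - (B1 \ Q).card - (B0 \ Q).card))
    (h21 : Stars G s (A2 \ (P ∪ Q)) (B1 \ (P ∪ Q)) (T - (A1 \ P).card - (A0 \ P).card)
      ((B1 \ Q).card - T)) :
    Til G s (A1 ∪ A2 ∪ A0) (B1 ∪ B2 ∪ B0) := by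
  have hAQ : ∀ Z ⊆ A1 ∪ A2 ∪ A0, Z \ (P ∪ Q) = Z \ P := fun Z hZ => by
    ext x
    have := fun hx : x ∈ Z => disjoint_left.1 (h.disj hZ hQ) hx
    simp only [mem_sdiff, mem_union]
    grind
  have hBP : ∀ Z ⊆ B1 ∪ B2 ∪ B0, Z \ (P ∪ Q) = Z \ Q := fun Z hZ => by
    ext x
    have := fun hx : x ∈ Z => disjoint_right.1 (h.disj hP hZ) hx
    simp only [mem_sdiff, mem_union]
    grind
  have a1 : A1 ⊆ A1 ∪ A2 ∪ A0 := subset_union_left.trans subset_union_left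
  have b1 : B1 ⊆ B1 ∪ B2 ∪ B0 := subset_union_left.trans subset_union_left
  have cA : ((A1 ∪ A2 ∪ A0) \ (P ∪ Q)).card = n - s := by
    rw [hAQ _ subset_rfl, card_sdiff_of_subset hP, h.cardAU, hPQ.2.1]
  have cB : ((B1 ∪ B2 ∪ B0) \ (P ∪ Q)).card = n - s := by
    rw [hBP _ subset_rfl, card_sdiff_of_subset hQ, h.cardBU, hPQ.2.2.1]
  have main := h.til_sdiff hs (F := P ∪ Q) (T := T)
    ((card_union_le _ _).trans (by rw [hPQ.2.1, hPQ.2.2.1]; omega)) (by rw [cA, cB])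
    (by rw [cA]; exact Nat.dvd_sub hd dvd_rfl) hT hT1 hT2
    (by rw [hAQ _ a1, hBP _ b1, hBP _ subset_union_right] at *; exact h12)
    (by rw [hAQ _ a1, hBP _ b1, hAQ _ subset_union_right] at *; exact h21)
  rw [hAQ _ subset_rfl, hBP _ subset_rfl] at main
  exact (Til.of_isKst hPQ).of_parts main hP hQ

theorem card_sdiff_insert {x : V} (hx : x ∈ X) (h : Disjoint X M) :
    (X \ insert x M).card = X.card - 1 := by
  have : X \ insert x M = X.erase x := by
    ext y
    have := fun hy : y ∈ X => disjoint_left.1 h hy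
    simp only [mem_sdiff, mem_insert, mem_erase]
    grind
  rw [this, card_erase_of_mem hx]

theorem adj_of_card_le_degS {v w : V} (h : Y.card ≤ degS G v Y) (hw : w ∈ Y) : G.Adj v w := by
  have : nb G v Y = Y := eq_of_subset_of_card_le nb_subset (by rwa [card_nb])
  exact (mem_nb.1 (this ▸ hw)).2

theorem Config.til_no_star (h : Config G s n S D R t D0 A1 A2 A0 B1 B2 B0) (hs : 2 ≤ s)
    (hn : n = 2 * (k * s) + s) (hD : D0 = k * s + 2 * s - 2) (eA : A1.card = k * s + 1)
    (eB : B2.card = k * s + 1) (dA : ∀ x ∈ A1, degS G x B2 ≤ s - 1)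
    (dB : ∀ y ∈ B2, degS G y A1 ≤ s - 1) :
    Til G s (A1 ∪ A2 ∪ A0) (B1 ∪ B2 ∪ B0) := by
  have cA := h.cardA
  have cB := h.cardB
  have n1 : 2 * t < n := by have := h.num.sparse; omega
  have adA : ∀ x ∈ A1, ∀ y ∈ B1, G.Adj x y := fun x hx y hy => by
    refine adj_of_card_le_degS ?_ hy
    have h1 := h.deg12 (x := x) (by simp [hx])
    have h2 := degS_le_card (G := G) (v := x) (Y := B0)
    have := dA x hx
    omega
  have dA' : ∀ x ∈ A1, degS G x B2 = s - 1 := fun x hx => by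
    have h1 := h.le_deg_a1 hx
    have := dA x hx
    omega
  have adB : ∀ y ∈ B2, ∀ x ∈ A2 ∪ A0, G.Adj y x := fun y hy x hx => by
    refine adj_of_card_le_degS ?_ hx
    have h1 := h.degB y (by simp [hy])
    have h2 := dB y hy
    have h3 := degS_union (G := G) (v := y) (disjoint_union_right.2 ⟨h.parts.a12, h.parts.a10⟩)
    rw [← union_assoc] at h3
    rw [card_union_of_disjoint h.parts.a20]
    omega
  obtain ⟨c, hc⟩ : A1.Nonempty := card_pos.1 (by omega)
  obtain ⟨d, hd⟩ : B1.Nonempty := card_pos.1 (by have := h.b1l; omega)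
  obtain ⟨M, hM, hMc⟩ : ∃ M ⊆ nb G d (A2 ∪ A0), M.card = s - 1 := by
    refine exists_subset_card_eq ?_
    rw [card_nb]
    have h1 := h.degB d (by simp [hd])
    rw [union_assoc] at h1
    have h2 := degS_union_le (G := G) (v := d) (X := A1) (Y := A2 ∪ A0)
    have h3 := degS_le_card (G := G) (v := d) (Y := A1)
    omega
  have hM' : M ⊆ A2 ∪ A0 := hM.trans nb_subset
  have hcM : c ∉ M := fun hcM => disjoint_left.1
    (disjoint_union_right.2 ⟨h.parts.a12, h.parts.a10⟩) hc (hM' hcM)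
  have hL' : nb G c B2 ⊆ B2 := nb_subset
  have hdL : d ∉ nb G c B2 := fun hdL => disjoint_left.1 h.parts.b12 hd (hL' hdL)
  have hP : insert c M ⊆ A1 ∪ A2 ∪ A0 := insert_subset (by simp [hc])
    (hM'.trans (by rw [union_assoc]; exact subset_union_right))
  have hQ : insert d (nb G c B2) ⊆ B1 ∪ B2 ∪ B0 := insert_subset (by simp [hd])
    (hL'.trans (subset_union_right.trans subset_union_left))
  have hK : IsKst G s s (insert c M) (insert d (nb G c B2)) := by
    refine ⟨h.disj hP hQ, ?_, ?_, ?_⟩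
    · rw [card_insert_of_notMem hcM]; omega
    · rw [card_insert_of_notMem hdL, card_nb, dA' c hc]; omega
    · intro u hu v hv
      rcases mem_insert.1 hu with rfl | hu <;> rcases mem_insert.1 hv with rfl | hv
      · exact adA _ hc _ hd
      · exact (mem_nb.1 hv).2
      · exact (mem_nb.1 (hM hu)).2.symm
      · exact (adB v (hL' hv) u (hM' hu)).symm
  have e1 : (A1 \ insert c M).card = k * s := by
    rw [card_sdiff_insert hc ((disjoint_union_right.2 ⟨h.parts.a12, h.parts.a10⟩).mono_right hM'),
      eA, Nat.add_sub_cancel]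
  have e2 : (B1 \ insert d (nb G c B2)).card = B1.card - 1 :=
    card_sdiff_insert hd (h.parts.b12.mono_right hL')
  have e3 : B0 \ insert d (nb G c B2) = B0 := by
    refine sdiff_eq_self_of_disjoint (disjoint_insert_right.2 ⟨?_, ?_⟩)
    · exact disjoint_left.1 h.parts.b10 hd
    · exact h.parts.b20.symm.mono_right hL'
  refine h.til_of_isKst (T := k * s) (by omega) hK hP hQ ?_ (Dvd.intro_left _ rfl) (by omega)
    (by omega) ?_ ?_
  · rw [hn]; exact ⟨2 * k + 1, by ring⟩
  · rw [e1, e2, e3, Nat.sub_self, show k * s - (B1.card - 1) - B0.card = 0 by omega]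
    exact Stars.zero
  · rw [e1, e2, Nat.sub_self, Nat.zero_sub]
    rcases Nat.eq_zero_or_pos (B1.card - 1 - k * s) with h0 | h0
    · rw [h0]; exact Stars.zero
    · refine h.stars21 (P := B1.card - 1 - k * s) (by omega) (by omega) h0 (by omega) ?_ (by omega)
      refine (card_union_le _ _).trans ?_
      rw [hK.2.1, hK.2.2.1]; omega

theorem Config.til_mixed (h : Config G s n S D R t D0 A1 A2 A0 B1 B2 B0) (hs : 2 ≤ s)
    (hn : n = 2 * (k * s) + s) (hD : D0 = k * s + 2 * s - 2) (e1 : A1.card = k * s + 1)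
    (e2 : A2.card = k * s + 1) (l1 : B1.card ≤ k * s) (l2 : B2.card ≤ k * s) :
    Til G s (A1 ∪ A2 ∪ A0) (B1 ∪ B2 ∪ B0) := by
  have cA := h.cardA
  have cB := h.cardB
  have hdn : s ∣ n := by rw [hn]; exact ⟨2 * k + 1, by ring⟩
  by_cases hx : ∃ x ∈ A1, s ≤ degS G x B2
  · obtain ⟨x, hx, hxs⟩ := hx
    refine h.til_of_stars (T := k * s) (by omega) hdn (Dvd.intro_left _ rfl) (by omega)
      (by omega) ?_ ?_
    · rw [e1, Nat.add_sub_cancel_left, show k * s - B1.card - B0.card = 0 by omega]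
      exact .one hx hxs
    · rw [show k * s - A1.card - A0.card = 0 by omega, show B1.card - k * s = 0 by omega]
      exact .zero
  push Not at hx
  have dA : ∀ x ∈ A1, degS G x B2 ≤ s - 1 := fun x h => Nat.le_sub_one_of_lt (hx x h)
  have dB : ∀ y ∈ B2, s - 1 ≤ degS G y A1 := fun y hy => by
    have := h.le_deg_b2 hy
    omega
  have lAB : A1.card ≤ B2.card + 2 * t := by
    have := h.a1u
    have := h.b2l
    omega
  have hle : A1.card * (s - 1) ≤ B2.card * (s - 1) + (s - 1) * (2 * t) := by
    calc _ ≤ (B2.card + 2 * t) * (s - 1) := Nat.mul_le_mul_right _ lAB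
      _ = _ := by ring
  have eU : eAB G A1 B2 ≤ A1.card * (s - 1) := eAB_le_mul dA
  have eL : B2.card * (s - 1) ≤ eAB G A1 B2 := by rw [eAB_comm]; exact mul_le_eAB dB
  have hdegs := h.num.degs
  obtain ⟨z, hz⟩ : B0.Nonempty := card_pos.1 (by omega)
  obtain ⟨x, hxz, hxs⟩ : ∃ x ∈ nb G z A1, s - 1 ≤ degS G x B2 := by
    by_contra! hcon
    have h1 : (nb G z A1).card * 1 + eAB G A1 B2 ≤ A1.card * (s - 1) := by
      have : eAB G A1 B2 = ∑ x ∈ A1 \ nb G z A1, degS G x B2 + ∑ x ∈ nb G z A1, degS G x B2 :=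
        (sum_sdiff nb_subset).symm
      have h2 : ∑ x ∈ A1 \ nb G z A1, degS G x B2 ≤ (A1 \ nb G z A1).card * (s - 1) :=
        sum_le_card_nsmul _ _ _ fun x hx => dA x (mem_sdiff.1 hx).1
      have h3 : ∑ x ∈ nb G z A1, (degS G x B2 + 1) ≤ (nb G z A1).card * (s - 1) :=
        sum_le_card_nsmul _ _ _ fun x hx => hcon x hx
      rw [sum_add_distrib, sum_const, smul_eq_mul] at h3
      rw [← card_sdiff_add_card_eq_card (nb_subset : nb G z A1 ⊆ A1), add_mul]
      omega
    have h2 : R ≤ (nb G z A1).card := by rw [card_nb]; exact h.typ.b01 z hz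
    omega
  have hxA : x ∈ A1 := nb_subset hxz
  have hL' : nb G x B2 ⊆ B2 := nb_subset
  have nA2 : ∀ y ∈ nb G x B2, A2.card ≤ degS G y A2 + ((s - 1) * (2 * t + 1) + 1) := by
    intro y hy
    have hy := hL' hy
    have h1 : degS G y A1 + (B2.erase y).card * (s - 1) ≤ eAB G A1 B2 := by
      rw [eAB_comm]
      unfold eAB
      rw [← add_sum_erase B2 _ hy]
      gcongr
      exact mul_le_eAB fun z hz => dB z (mem_of_mem_erase hz)
    have h2 : B2.card * (s - 1) = (B2.erase y).card * (s - 1) + (s - 1) := by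
      rw [← Nat.succ_mul, Nat.succ_eq_add_one, card_erase_add_one hy]
    have h3 := h.flip.deg12 (x := y) (by simp [hy])
    have h4 := degS_le_card (G := G) (v := y) (Y := A0)
    rw [mul_add, mul_one]
    omega
  obtain ⟨M, hM, hMc⟩ : ∃ M ⊆ cnb G (nb G x B2) A2 ∩ nb G z A2, M.card = s - 1 := by
    refine exists_subset_card_eq ?_
    have h1 := card_le_card_cnb nA2
    have h2 := card_union_add_card_inter (cnb G (nb G x B2) A2) (nb G z A2)
    have h3 := card_le_card (union_subset (cnb_subset : cnb G (nb G x B2) A2 ⊆ A2)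
      (nb_subset : nb G z A2 ⊆ A2))
    have h4 : R ≤ (nb G z A2).card := by rw [card_nb]; exact h.typ.b02 z hz
    have h5 : (nb G x B2).card * ((s - 1) * (2 * t + 1) + 1) ≤
      (s - 1) * ((s - 1) * (2 * t + 1) + 1) :=
        Nat.mul_le_mul_right _ (by rw [card_nb]; exact dA x hxA)
    omega
  have hM' : M ⊆ A2 := hM.trans (inter_subset_left.trans cnb_subset)
  have hxM : x ∉ M := fun hxM => disjoint_left.1 h.parts.a12 hxA (hM' hxM)
  have hzL : z ∉ nb G x B2 := fun hzL => disjoint_left.1 h.parts.b20 (hL' hzL) hz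
  have hP : insert x M ⊆ A1 ∪ A2 ∪ A0 := insert_subset (by simp [hxA])
    (hM'.trans (subset_union_right.trans subset_union_left))
  have hQ : insert z (nb G x B2) ⊆ B1 ∪ B2 ∪ B0 := insert_subset (by simp [hz])
    (hL'.trans (subset_union_right.trans subset_union_left))
  have hK : IsKst G s s (insert x M) (insert z (nb G x B2)) := by
    refine ⟨h.disj hP hQ, ?_, ?_, ?_⟩
    · rw [card_insert_of_notMem hxM]; omega
    · rw [card_insert_of_notMem hzL, card_nb]
      have := dA x hxA
      omega
    · intro u hu v hv
      have hm := fun hu : u ∈ M => mem_inter.1 (hM hu)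
      rcases mem_insert.1 hu with rfl | hu <;> rcases mem_insert.1 hv with rfl | hv
      · exact (mem_nb.1 hxz).2.symm
      · exact (mem_nb.1 hv).2
      · exact (mem_nb.1 (hm hu).2).2.symm
      · exact ((mem_cnb.1 (hm hu).1).2 v hv).symm
  have e3 : (A1 \ insert x M).card = k * s := by
    rw [card_sdiff_insert hxA (h.parts.a12.mono_right hM'), e1, Nat.add_sub_cancel]
  have e5 : (B0 \ insert z (nb G x B2)).card = B0.card - 1 :=
    card_sdiff_insert hz (h.parts.b20.symm.mono_right hL')
  have e6 : (B1 \ insert z (nb G x B2)).card = B1.card := by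
    rw [sdiff_eq_self_of_disjoint]
    exact disjoint_insert_right.2 ⟨disjoint_right.1 h.parts.b10 hz, h.parts.b12.mono_right hL'⟩
  refine h.til_of_isKst (T := k * s) (by omega) hK hP hQ hdn (Dvd.intro_left _ rfl) (by omega)
    (by omega) ?_ ?_
  · rw [e3, e5, e6, Nat.sub_self, show k * s - B1.card - (B0.card - 1) = 0 by omega]
    exact .zero
  · rw [e3, e6, Nat.sub_self, Nat.zero_sub, Nat.sub_eq_zero_of_le l1]
    exact .zero

theorem Config.til_odd (h : Config G s n S D R t D0 A1 A2 A0 B1 B2 B0) (hs : 2 ≤ s)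
    (hn : n = 2 * (k * s) + s) (hD : D0 = k * s + 2 * s - 2) :
    Til G s (A1 ∪ A2 ∪ A0) (B1 ∪ B2 ∪ B0) := by
  have cA := h.cardA
  have cB := h.cardB
  have hdn : s ∣ n := by rw [hn]; exact ⟨2 * k + 1, by ring⟩
  have low : Stars G s A1 B2 (A1.card - k * s) (B2.card - (k * s + s)) →
      Stars G s A2 B1 (A2.card - (k * s + s)) (B1.card - k * s) →
      Til G s (A1 ∪ A2 ∪ A0) (B1 ∪ B2 ∪ B0) := fun h1 h2 => by
    refine h.til_of_stars (T := k * s) (by omega) hdn (Dvd.intro_left _ rfl) (by omega)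
      (by omega) ?_ ?_
    · rwa [show k * s - B1.card - B0.card = B2.card - (k * s + s) by omega]
    · rwa [show k * s - A1.card - A0.card = A2.card - (k * s + s) by omega]
  have high : Stars G s A1 B2 (A1.card - (k * s + s)) (B2.card - k * s) →
      Stars G s A2 B1 (A2.card - k * s) (B1.card - (k * s + s)) →
      Til G s (A1 ∪ A2 ∪ A0) (B1 ∪ B2 ∪ B0) := fun h1 h2 => by
    refine h.til_of_stars (T := k * s + s) (by omega) hdn ⟨k + 1, by ring⟩ (by omega)
      (by omega) ?_ ?_
    · rwa [show k * s + s - B1.card - B0.card = B2.card - k * s by omega]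
    · rwa [show k * s + s - A1.card - A0.card = A2.card - k * s by omega]
  have h21 : (Stars G s A2 B1 (A2.card - k * s) (B1.card - (k * s + s)) ∧
      Stars G s A2 B1 (A2.card - (k * s + s)) (B1.card - k * s)) ∨
      (A2.card ≤ k * s ∧ B1.card = k * s + 1 ∧
        Stars G s A2 B1 (A2.card - k * s) (B1.card - (k * s + s))) ∨
      (B1.card ≤ k * s ∧ A2.card = k * s + 1 ∧
        Stars G s A2 B1 (A2.card - (k * s + s)) (B1.card - k * s)) ∨
      Til G s (A1 ∪ A2 ∪ A0) (B1 ∪ B2 ∪ B0) := by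
    rcases h.sp' with h' | h'
    · refine ((h.swap h').stars_odd hs hn hD).imp_right (Or.imp_right (Or.imp_right ?_))
      rintro ⟨e1, e2, d1, d2⟩
      rw [union_comm A1, union_comm B1]
      exact (h.swap h').til_no_star hs hn hD e1 e2 d1 d2
    · left
      rw [show A2.card - k * s = 0 by omega, show B1.card - (k * s + s) = 0 by omega,
        show A2.card - (k * s + s) = 0 by omega, show B1.card - k * s = 0 by omega]
      exact ⟨.zero, .zero⟩
  rcases h.stars_odd hs hn hD with ⟨a1, a2⟩ | ⟨l1, e1, a1⟩ | ⟨l1, e1, a2⟩ | ⟨e1, e2, d1, d2⟩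
  · rcases h21 with ⟨b1, b2⟩ | ⟨-, -, b1⟩ | ⟨-, -, b2⟩ | b
    exacts [low a1 b2, high a2 b1, low a1 b2, b]
  · rcases h21 with ⟨b1, b2⟩ | ⟨l2, e2, -⟩ | ⟨-, -, b2⟩ | b
    · exact low a1 b2
    · have := h.flip.til_mixed hs hn hD e1 e2 l2 l1
      rw [union_comm A1, union_comm B1]
      exact this.symm
    · exact low a1 b2
    · exact b
  · rcases h21 with ⟨b1, b2⟩ | ⟨-, -, b1⟩ | ⟨l2, e2, -⟩ | b
    · exact high a2 b1
    · exact high a2 b1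
    · exact h.til_mixed hs hn hD e1 e2 l2 l1
    · exact b
  · exact h.til_no_star hs hn hD e1 e2 d1 d2

end OddCase

section ConfigExists

variable {G : SimpleGraph V} {s n D R t u v r D0 : ℕ} {A B P Q X Y A0 : Finset V}

/-- Vertices of `A` with few neighbours in `Y`. -/
noncomputable def lowDeg (G : SimpleGraph V) (r : ℕ) (A Y : Finset V) : Finset V :=
  A.filter fun x => degS G x Y < r

/-- Vertices of `A` with many neighbours in `Y`. -/
noncomputable def highDeg (G : SimpleGraph V) (r : ℕ) (A Y : Finset V) : Finset V :=
  A.filter fun x => r ≤ degS G x Y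

/-- Vertices of `A` with many non-neighbours in `Y`. -/
noncomputable def highNonDeg (G : SimpleGraph V) (r : ℕ) (A Y : Finset V) : Finset V :=
  A.filter fun x => degS G x Y + r ≤ Y.card

theorem card_highDeg_mul_le : (highDeg G r A Y).card * r ≤ eAB G A Y :=
  (mul_le_eAB fun _ hx => (mem_filter.1 hx).2).trans (eAB_mono (filter_subset _ _) subset_rfl)

theorem eAB_le_highDeg : eAB G A Y ≤ (highDeg G r A Y).card * Y.card + A.card * r := by
  have h : eAB G A Y = ∑ x ∈ A \ highDeg G r A Y, degS G x Y + ∑ x ∈ highDeg G r A Y, degS G x Y :=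
    (sum_sdiff (filter_subset _ _)).symm
  have h1 : ∑ x ∈ highDeg G r A Y, degS G x Y ≤ (highDeg G r A Y).card * Y.card :=
    sum_le_card_nsmul _ _ _ fun x _ => degS_le_card
  have h2 : ∑ x ∈ A \ highDeg G r A Y, degS G x Y ≤ (A \ highDeg G r A Y).card * r :=
    sum_le_card_nsmul _ _ _ fun x hx => by
      by_contra! hc
      exact (mem_sdiff.1 hx).2 (mem_filter.2 ⟨(mem_sdiff.1 hx).1, hc.le⟩)
  have h3 := Nat.mul_le_mul_right r (card_le_card (sdiff_subset : A \ highDeg G r A Y ⊆ A))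
  omega

theorem card_sdiff_lowDeg_mul_le (hX : X ⊆ A) : (X \ lowDeg G r A Y).card * r ≤ eAB G X Y := by
  refine (mul_le_eAB fun x hx => ?_).trans (eAB_mono sdiff_subset subset_rfl)
  rw [mem_sdiff, lowDeg, mem_filter] at hx
  by_contra! hc
  exact hx.2 ⟨hX hx.1, hc⟩

theorem card_lowDeg_sdiff_le (hA : A.card = n) (hX : X ⊆ A) (hY : Y.card ≤ n)
    (hdeg : ∀ y ∈ Y, D0 ≤ degS G y A) (hD : n ≤ 2 * D0) (hXl : n ≤ 2 * X.card + 2 * u)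
    (hYl : n ≤ 2 * Y.card + 2 * u) (he : eAB G X Y ≤ u * n) (hr : 8 * r ≤ n) (hu : 8 * u ≤ n)
    (hn : 0 < n) : (lowDeg G r A Y \ X).card ≤ 8 * u := by
  set J := lowDeg G r A Y \ X with hJ
  have hJA : J ⊆ A \ X := sdiff_subset_sdiff (filter_subset _ _) subset_rfl
  have e1 : eAB G (A \ X) Y + eAB G X Y = eAB G A Y := by
    rw [← eAB_union_left sdiff_disjoint, sdiff_union_of_subset hX]
  have e2 : eAB G ((A \ X) \ J) Y + eAB G J Y = eAB G (A \ X) Y := by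
    rw [← eAB_union_left sdiff_disjoint, sdiff_union_of_subset hJA]
  have e3 : Y.card * D0 ≤ eAB G A Y := by rw [eAB_comm]; exact mul_le_eAB hdeg
  have e4 : eAB G J Y ≤ J.card * r := eAB_le_mul fun x hx =>
    (mem_filter.1 (mem_sdiff.1 hx).1).2.le
  have e5 : eAB G ((A \ X) \ J) Y ≤ ((A \ X) \ J).card * Y.card := eAB_le_card_mul
  have c1 := card_sdiff_add_card_eq_card hX
  have c2 := card_sdiff_add_card_eq_card hJA
  have c3 : 2 * (((A \ X) \ J).card + J.card) ≤ n + 2 * u := by omega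
  have c4 : 4 * r + n ≤ 4 * Y.card := by omega
  have e6 : Y.card * D0 ≤ u * n + J.card * r + ((A \ X) \ J).card * Y.card := by omega
  generalize hj : J.card = j at *
  generalize hw : ((A \ X) \ J).card = w at *
  generalize hy : Y.card = y at *
  clear e1 e2 e3 e4 e5 c1 c2
  have h1 : n * y ≤ 2 * (u * n) + 2 * (j * r) + 2 * (w * y) := by nlinarith
  have h2 : 2 * (w * y) + 2 * (j * y) ≤ n * y + 2 * (u * y) := by nlinarith
  have h3 : u * y ≤ u * n := Nat.mul_le_mul_left _ hY
  have h4 : 4 * (j * r) + j * n ≤ 4 * (j * y) := by nlinarith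
  have h5 : j * n ≤ (8 * u) * n := by nlinarith
  exact Nat.le_of_mul_le_mul_right h5 hn

theorem eAB_le_add_sdiff (hP : P.card ≤ n) (hQ : Q.card ≤ n) :
    eAB G P Q ≤ eAB G X Y + (P \ X).card * n + (Q \ Y).card * n := by
  have h1 : eAB G P Q = eAB G (P \ X) Q + eAB G (P ∩ X) Q := by
    rw [← eAB_union_left (disjoint_sdiff_inter P X), sdiff_union_inter]
  have h2 : eAB G (P ∩ X) Q = eAB G (P ∩ X) (Q \ Y) + eAB G (P ∩ X) (Q ∩ Y) := by
    rw [← eAB_union_right (disjoint_sdiff_inter Q Y), sdiff_union_inter]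
  have h3 : eAB G (P ∩ X) (Q ∩ Y) ≤ eAB G X Y := eAB_mono inter_subset_right inter_subset_right
  have h4 : eAB G (P \ X) Q ≤ (P \ X).card * n :=
    eAB_le_card_mul.trans (Nat.mul_le_mul_left _ hQ)
  have h5 : eAB G (P ∩ X) (Q \ Y) ≤ n * (Q \ Y).card :=
    eAB_le_card_mul.trans (Nat.mul_le_mul_right _ ((card_le_card inter_subset_left).trans hP))
  rw [mul_comm n] at h5
  omega

theorem card_highNonDeg_mul_le (hA : A.card = n) (hP : P ⊆ A) (hQ : Q.card ≤ n)
    (hdeg : ∀ y ∈ Q, D0 ≤ degS G y A) (hD : n ≤ 2 * D0) (hPl : n ≤ 2 * P.card + 2 * v) :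
    (highNonDeg G r (A \ P) Q).card * r ≤ v * n + eAB G P Q := by
  have e1 : eAB G (A \ P) Q + eAB G P Q = eAB G A Q := by
    rw [← eAB_union_left sdiff_disjoint, sdiff_union_of_subset hP]
  have e2 : Q.card * D0 ≤ eAB G A Q := by rw [eAB_comm]; exact mul_le_eAB hdeg
  have e3 : (highNonDeg G r (A \ P) Q).card * r + eAB G (A \ P) Q ≤ (A \ P).card * Q.card := by
    have h1 : (highNonDeg G r (A \ P) Q).card * r ≤ ∑ x ∈ A \ P, (Q.card - degS G x Q) :=
      calc _ ≤ ∑ x ∈ highNonDeg G r (A \ P) Q, (Q.card - degS G x Q) := by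
            rw [← smul_eq_mul]
            refine card_nsmul_le_sum _ _ _ fun x hx => ?_
            have := (mem_filter.1 hx).2
            omega
        _ ≤ _ := sum_le_sum_of_subset (filter_subset _ _)
    have h2 : ∑ x ∈ A \ P, (Q.card - degS G x Q) + eAB G (A \ P) Q = (A \ P).card * Q.card := by
      unfold eAB
      rw [← sum_add_distrib, ← smul_eq_mul, ← sum_const]
      exact sum_congr rfl fun x _ => Nat.sub_add_cancel degS_le_card
    omega
  have c1 := card_sdiff_add_card_eq_card hP
  have c2 : 2 * (A \ P).card ≤ n + 2 * v := by omega
  have h1 : 2 * ((A \ P).card * Q.card) ≤ n * Q.card + 2 * (v * Q.card) := by nlinarith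
  have h2 : n * Q.card ≤ 2 * (Q.card * D0) := by nlinarith
  have h3 : v * Q.card ≤ v * n := Nat.mul_le_mul_left _ hQ
  omega

set_option maxHeartbeats 1000000 in
/-- The partition of the vertices determined by the exceptional sets is a configuration. -/
theorem exists_config (num : ConfigNum s n (2 * r) (3 * r) R t) (hAB : Disjoint A B)
    (hA : A.card = n) (hB : B.card = n) (hdA : ∀ x ∈ A, D0 ≤ degS G x B)
    (hdB : ∀ x ∈ B, D0 ≤ degS G x A) (hD : n ≤ 2 * D0) (hR : 2 * R ≤ r)
    (hr : 8 * r ≤ n) (htr : 4 * t ≤ r) (hst : 4 * s ≤ t) (huv : 40 * (u * n) ≤ v * r)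
    (hvt : 40 * (v * n) ≤ t * r) (hn : 0 < n) (hr0 : 0 < r) (hX : X ⊆ A) (hY : Y ⊆ B)
    (hXl : n ≤ 2 * X.card + 2 * u) (hXu : 2 * X.card ≤ n + 2 * u)
    (hYl : n ≤ 2 * Y.card + 2 * u) (hYu : 2 * Y.card ≤ n + 2 * u) (he : eAB G X Y ≤ u * n)
    (hc : 20 * eAB G (A \ X) (B \ Y) ≤ t * r ∨ 3 * (r * n) ≤ eAB G (A \ X) (B \ Y)) :
    ∃ A1 A2 A0 B1 B2 B0, Config G s n (2 * r) (3 * r) R t D0 A1 A2 A0 B1 B2 B0 ∧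
      A1 ∪ A2 ∪ A0 = A ∧ B1 ∪ B2 ∪ B0 = B := by
  have huv' : 40 * u ≤ v := by
    have : (40 * u) * n ≤ v * n := by
      have := Nat.mul_le_mul_left v (show r ≤ n by omega)
      linarith
    exact Nat.le_of_mul_le_mul_right this hn
  have hvt' : 40 * v ≤ t := by
    have : (40 * v) * n ≤ t * n := by
      have := Nat.mul_le_mul_left t (show r ≤ n by omega)
      linarith
    exact Nat.le_of_mul_le_mul_right this hn
  set P := lowDeg G r A Y with hPdef
  set Q := lowDeg G r B X with hQdef
  have hP : P ⊆ A := filter_subset _ _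
  have hQ : Q ⊆ B := filter_subset _ _
  have he' : eAB G Y X ≤ u * n := by rwa [eAB_comm]
  have hXn : X.card ≤ n := hA ▸ card_le_card hX
  have hYn : Y.card ≤ n := hB ▸ card_le_card hY
  have hPn : P.card ≤ n := hA ▸ card_le_card hP
  have hQn : Q.card ≤ n := hB ▸ card_le_card hQ
  have p1 : (P \ X).card ≤ 8 * u := card_lowDeg_sdiff_le hA hX hYn (fun y hy => hdB y (hY hy)) hD
    hXl hYl he hr (by omega) hn
  have q1 : (Q \ Y).card ≤ 8 * u := card_lowDeg_sdiff_le hB hY hXn (fun y hy => hdA y (hX hy)) hD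
    hYl hXl he' hr (by omega) hn
  have p2 : 40 * (X \ P).card ≤ v := by
    have := card_sdiff_lowDeg_mul_le (G := G) (r := r) (Y := Y) hX
    exact Nat.le_of_mul_le_mul_right (show (40 * (X \ P).card) * r ≤ v * r by linarith) hr0
  have q2 : 40 * (Y \ Q).card ≤ v := by
    have := card_sdiff_lowDeg_mul_le (G := G) (r := r) (Y := X) hY
    exact Nat.le_of_mul_le_mul_right (show (40 * (Y \ Q).card) * r ≤ v * r by linarith) hr0
  have cP := card_sdiff_add_card_inter P X
  have cX := card_sdiff_add_card_inter X P
  rw [inter_comm] at cX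
  have cQ := card_sdiff_add_card_inter Q Y
  have cY := card_sdiff_add_card_inter Y Q
  rw [inter_comm] at cY
  have hPl : n ≤ 2 * P.card + 2 * v := by omega
  have hPu : 2 * P.card ≤ n + 2 * v := by omega
  have hQl : n ≤ 2 * Q.card + 2 * v := by omega
  have hQu : 2 * Q.card ≤ n + 2 * v := by omega
  clear cP cX cQ cY
  have ePQ : eAB G P Q ≤ v * n := by
    have := eAB_le_add_sdiff (G := G) (X := X) (Y := Y) hPn hQn
    have h1 := Nat.mul_le_mul_right n p1
    have h2 := Nat.mul_le_mul_right n q1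
    have h3 := Nat.mul_le_mul_right n huv'
    linarith
  have nA : 20 * (highNonDeg G r (A \ P) Q).card ≤ t := by
    have := card_highNonDeg_mul_le (r := r) hA hP hQn (fun y hy => hdB y (hQ hy)) hD hPl
    exact Nat.le_of_mul_le_mul_right (c := r) (by linarith) hr0
  have nB : 20 * (highNonDeg G r (B \ Q) P).card ≤ t := by
    have := card_highNonDeg_mul_le (r := r) hB hQ hPn (fun y hy => hdA y (hP hy)) hD hQl
    rw [eAB_comm] at this
    exact Nat.le_of_mul_le_mul_right (c := r) (by linarith) hr0
  have cAP := card_sdiff_add_card_eq_card hP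
  have cBQ := card_sdiff_add_card_eq_card hQ
  -- the exceptional sets
  obtain ⟨A0, B0, hA0, hB0, nA0, nB0, hA0', hB0', cA0, cB0, hsp⟩ : ∃ A0 B0, A0 ⊆ A \ P ∧
      B0 ⊆ B \ Q ∧ highNonDeg G r (A \ P) Q ⊆ A0 ∧ highNonDeg G r (B \ Q) P ⊆ B0 ∧
      A0 ⊆ highNonDeg G r (A \ P) Q ∪ highDeg G r (A \ P) (B \ Q) ∧
      B0 ⊆ highNonDeg G r (B \ Q) P ∪ highDeg G r (B \ Q) (A \ P) ∧ 2 * A0.card ≤ t ∧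
      2 * B0.card ≤ t ∧ ((highDeg G r (A \ P) (B \ Q) ⊆ A0 ∧ highDeg G r (B \ Q) (A \ P) ⊆ B0) ∨
        (v + s ≤ A0.card ∧ v + s ≤ B0.card)) := by
    have eBA : eAB G (B \ Q) (A \ P) = eAB G (A \ P) (B \ Q) := eAB_comm
    rcases hc with hc | hc
    · have e : 10 * eAB G (A \ P) (B \ Q) ≤ t * r := by
        have := eAB_le_add_sdiff (G := G) (X := A \ X) (Y := B \ Y) (n := n)
          (show (A \ P).card ≤ n by omega) (show (B \ Q).card ≤ n by omega)
        have s1 : ((A \ P) \ (A \ X)).card ≤ (X \ P).card := card_le_card fun x hx => by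
          simp only [mem_sdiff] at hx ⊢
          tauto
        have s2 : ((B \ Q) \ (B \ Y)).card ≤ (Y \ Q).card := card_le_card fun x hx => by
          simp only [mem_sdiff] at hx ⊢
          tauto
        have h1 := Nat.mul_le_mul_right n (s1.trans (show (X \ P).card ≤ v by omega))
        have h2 := Nat.mul_le_mul_right n (s2.trans (show (Y \ Q).card ≤ v by omega))
        linarith
      have gA : 10 * (highDeg G r (A \ P) (B \ Q)).card ≤ t := by
        have := card_highDeg_mul_le (G := G) (r := r) (A := A \ P) (Y := B \ Q)
        exact Nat.le_of_mul_le_mul_right (c := r) (by linarith) hr0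
      have gB : 10 * (highDeg G r (B \ Q) (A \ P)).card ≤ t := by
        have := card_highDeg_mul_le (G := G) (r := r) (A := B \ Q) (Y := A \ P)
        exact Nat.le_of_mul_le_mul_right (c := r) (by linarith) hr0
      have uA := card_union_le (highNonDeg G r (A \ P) Q) (highDeg G r (A \ P) (B \ Q))
      have uB := card_union_le (highNonDeg G r (B \ Q) P) (highDeg G r (B \ Q) (A \ P))
      exact ⟨highNonDeg G r (A \ P) Q ∪ highDeg G r (A \ P) (B \ Q),
        highNonDeg G r (B \ Q) P ∪ highDeg G r (B \ Q) (A \ P),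
        union_subset (filter_subset _ _) (filter_subset _ _),
        union_subset (filter_subset _ _) (filter_subset _ _), subset_union_left,
        subset_union_left, subset_rfl, subset_rfl, by omega, by omega,
        .inl ⟨subset_union_right, subset_union_right⟩⟩
    · have e : 2 * (r * n) ≤ eAB G (A \ P) (B \ Q) := by
        have := eAB_le_add_sdiff (G := G) (P := A \ X) (Q := B \ Y) (X := A \ P) (Y := B \ Q)
          ((card_le_card sdiff_subset).trans hA.le) ((card_le_card sdiff_subset).trans hB.le)
        have s1 : ((A \ X) \ (A \ P)).card ≤ (P \ X).card := card_le_card fun x hx => by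
          simp only [mem_sdiff] at hx ⊢
          tauto
        have s2 : ((B \ Y) \ (B \ Q)).card ≤ (Q \ Y).card := card_le_card fun x hx => by
          simp only [mem_sdiff] at hx ⊢
          tauto
        have h1 := Nat.mul_le_mul_right n (s1.trans p1)
        have h2 := Nat.mul_le_mul_right n (s2.trans q1)
        have h3 := Nat.mul_le_mul_right n (show 16 * u ≤ r by omega)
        linarith
      have gA : v + s ≤ (highDeg G r (A \ P) (B \ Q)).card := by
        have := eAB_le_highDeg (G := G) (r := r) (A := A \ P) (Y := B \ Q)
        have h1 := Nat.mul_le_mul_right r (show (A \ P).card ≤ n by omega)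
        have h2 := Nat.mul_le_mul_left (highDeg G r (A \ P) (B \ Q)).card
          (show (B \ Q).card ≤ n by omega)
        have h3 := Nat.le_of_mul_le_mul_right (c := n) (a := r)
          (b := (highDeg G r (A \ P) (B \ Q)).card) (by linarith) hn
        omega
      have gB : v + s ≤ (highDeg G r (B \ Q) (A \ P)).card := by
        have := eAB_le_highDeg (G := G) (r := r) (A := B \ Q) (Y := A \ P)
        have h1 := Nat.mul_le_mul_right r (show (B \ Q).card ≤ n by omega)
        have h2 := Nat.mul_le_mul_left (highDeg G r (B \ Q) (A \ P)).card
          (show (A \ P).card ≤ n by omega)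
        have h3 := Nat.le_of_mul_le_mul_right (c := n) (a := r)
          (b := (highDeg G r (B \ Q) (A \ P)).card) (by linarith) hn
        omega
      obtain ⟨EA, hEA, cEA⟩ := exists_subset_card_eq gA
      obtain ⟨EB, hEB, cEB⟩ := exists_subset_card_eq gB
      have uA := card_union_le (highNonDeg G r (A \ P) Q) EA
      have uB := card_union_le (highNonDeg G r (B \ Q) P) EB
      have uA' := card_le_card (subset_union_right (s₁ := highNonDeg G r (A \ P) Q) (s₂ := EA))
      have uB' := card_le_card (subset_union_right (s₁ := highNonDeg G r (B \ Q) P) (s₂ := EB))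
      exact ⟨highNonDeg G r (A \ P) Q ∪ EA, highNonDeg G r (B \ Q) P ∪ EB,
        union_subset (filter_subset _ _) (hEA.trans (filter_subset _ _)),
        union_subset (filter_subset _ _) (hEB.trans (filter_subset _ _)), subset_union_left,
        subset_union_left, union_subset_union subset_rfl hEA, union_subset_union subset_rfl hEB,
        by omega, by omega, .inr ⟨by omega, by omega⟩⟩
  clear hc
  have cA2 := card_sdiff_add_card_eq_card hA0
  have cB2 := card_sdiff_add_card_eq_card hB0
  have uA : P ∪ (A \ P) \ A0 ∪ A0 = A := by
    rw [union_assoc, sdiff_union_of_subset hA0, union_sdiff_of_subset hP]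
  have uB : (B \ Q) \ B0 ∪ Q ∪ B0 = B := by
    rw [union_right_comm, sdiff_union_of_subset hB0, sdiff_union_of_subset hQ]
  have dA : ∀ x ∈ A, degS G x B = degS G x ((B \ Q) \ B0) + degS G x B0 + degS G x Q := by
    intro x _
    rw [← degS_sdiff hQ, ← degS_sdiff hB0]
  have dB : ∀ x ∈ B, degS G x A = degS G x ((A \ P) \ A0) + degS G x A0 + degS G x P := by
    intro x _
    rw [← degS_sdiff hP, ← degS_sdiff hA0]
  have spA : ∀ x ∈ P, degS G x Q ≤ 2 * r := fun x hx => by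
    have h1 := (mem_filter.1 hx).2
    have h2 := degS_le_sdiff (G := G) (v := x) (X := Q \ Y) (Y := Q)
    have h3 : degS G x (Q \ (Q \ Y)) ≤ degS G x Y := degS_mono fun x => by
      simp only [mem_sdiff]; tauto
    omega
  have spB : ∀ x ∈ Q, degS G x P ≤ 2 * r := fun x hx => by
    have h1 := (mem_filter.1 hx).2
    have h2 := degS_le_sdiff (G := G) (v := x) (X := P \ X) (Y := P)
    have h3 : degS G x (P \ (P \ X)) ≤ degS G x X := degS_mono fun x => by
      simp only [mem_sdiff]; tauto
    omega
  have hiA : ∀ x ∈ A \ P, r ≤ degS G x Q + v := fun x hx => by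
    have h1 : r ≤ degS G x Y := by
      by_contra! hc
      exact (mem_sdiff.1 hx).2 (mem_filter.2 ⟨(mem_sdiff.1 hx).1, hc⟩)
    have h2 := degS_le_sdiff (G := G) (v := x) (X := Y \ Q) (Y := Y)
    have h3 : degS G x (Y \ (Y \ Q)) ≤ degS G x Q := degS_mono fun x => by
      simp only [mem_sdiff]; tauto
    omega
  have hiB : ∀ x ∈ B \ Q, r ≤ degS G x P + v := fun x hx => by
    have h1 : r ≤ degS G x X := by
      by_contra! hc
      exact (mem_sdiff.1 hx).2 (mem_filter.2 ⟨(mem_sdiff.1 hx).1, hc⟩)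
    have h2 := degS_le_sdiff (G := G) (v := x) (X := X \ P) (Y := X)
    have h3 : degS G x (X \ (X \ P)) ≤ degS G x P := degS_mono fun x => by
      simp only [mem_sdiff]; tauto
    omega
  refine ⟨P, (A \ P) \ A0, A0, (B \ Q) \ B0, Q, B0, ⟨num, ?_, ?_, by omega, by omega, by omega,
    by omega, by omega, by omega, by omega, by omega, by omega, by omega, ?_, ?_, ⟨spA, spB⟩, ?_⟩,
    uA, uB⟩
  · refine ⟨?_, ?_, sdiff_disjoint, ?_, sdiff_disjoint, ?_, by rwa [uA, uB]⟩
    · exact disjoint_sdiff.mono_right sdiff_subset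
    · exact disjoint_sdiff.mono_right hA0
    · exact sdiff_disjoint.mono_left sdiff_subset
    · exact disjoint_sdiff.mono_right hB0
  · have b0c : ∀ x, degS G x B0 ≤ B0.card := fun x => degS_le_card
    have a0c : ∀ x, degS G x A0 ≤ A0.card := fun x => degS_le_card
    have qc : ∀ x, degS G x Q ≤ Q.card := fun x => degS_le_card
    have pc : ∀ x, degS G x P ≤ P.card := fun x => degS_le_card
    refine ⟨fun x hx => ?_, fun x hx => ?_, fun x hx => ?_, fun x hx => ?_, fun x hx => ?_,
      fun x hx => ?_, fun x hx => ?_, fun x hx => ?_⟩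
    · have h1 := hdA x (hP hx)
      rw [dA x (hP hx)] at h1
      have := spA x hx
      have := b0c x
      omega
    · by_contra! hc
      exact (mem_sdiff.1 hx).2 (nA0 (mem_filter.2 ⟨(mem_sdiff.1 hx).1, by omega⟩))
    · by_contra! hc
      exact (mem_sdiff.1 hx).2 (nB0 (mem_filter.2 ⟨(mem_sdiff.1 hx).1, by omega⟩))
    · have h1 := hdB x (hQ hx)
      rw [dB x (hQ hx)] at h1
      have := spB x hx
      have := a0c x
      omega
    · have hxA := (mem_sdiff.1 (hA0 hx)).1
      have h1 := hdA x hxA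
      have h2 := dA x hxA
      have h3 := b0c x
      rcases mem_union.1 (hA0' hx) with h | h
      · have := (mem_filter.1 h).2
        omega
      · have := (mem_filter.1 h).2
        rw [← degS_sdiff hB0] at this
        omega
    · have := hiA x (hA0 hx)
      omega
    · have := hiB x (hB0 hx)
      omega
    · have hxB := (mem_sdiff.1 (hB0 hx)).1
      have h1 := hdB x hxB
      have h2 := dB x hxB
      have h3 := a0c x
      rcases mem_union.1 (hB0' hx) with h | h
      · have := (mem_filter.1 h).2
        omega
      · have := (mem_filter.1 h).2
        rw [← degS_sdiff hA0] at this
        omega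
  · rw [uA, uB]; exact hdA
  · rw [uA, uB]; exact hdB
  · rcases hsp with ⟨h1, h2⟩ | ⟨h1, h2⟩
    · left
      refine ⟨fun x hx => ?_, fun x hx => ?_⟩
      · by_contra! hc
        refine (mem_sdiff.1 hx).2 (h1 (mem_filter.2 ⟨(mem_sdiff.1 hx).1, ?_⟩))
        have := degS_mono (G := G) (v := x) (sdiff_subset : (B \ Q) \ B0 ⊆ B \ Q)
        omega
      · by_contra! hc
        refine (mem_sdiff.1 hx).2 (h2 (mem_filter.2 ⟨(mem_sdiff.1 hx).1, ?_⟩))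
        have := degS_mono (G := G) (v := x) (sdiff_subset : (A \ P) \ A0 ⊆ A \ P)
        omega
    · right
      constructor <;> omega

end ConfigExists

section ExtremalCase

theorem configNum_of {s n r t : ℕ} (hs : 2 ≤ s) (hst : 4 * s ≤ t) (ht : 52 * s ^ 2 * t ≤ r)
    (hr : 100 * s ^ 2 * r < n) : ConfigNum s n (2 * r) (3 * r) (r / 2) t := by
  obtain ⟨p, rfl⟩ : ∃ p, s = p + 1 := ⟨s - 1, by omega⟩
  have sq : p + 1 ≤ (p + 1) ^ 2 := Nat.le_self_pow two_ne_zero _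
  have h1 : t ≤ r := (Nat.le_mul_of_pos_left t (by positivity)).trans ht
  have h2 : (p + 1) * t ≤ (p + 1) ^ 2 * t := Nat.mul_le_mul_right _ sq
  have h3 : (p + 1) * r ≤ (p + 1) ^ 2 * r := Nat.mul_le_mul_right _ sq
  have h4 : t ≤ (p + 1) * t := Nat.le_mul_of_pos_left t p.succ_pos
  have h5 : r ≤ (p + 1) * r := Nat.le_mul_of_pos_left r p.succ_pos
  have h6 : (p + 1) * t ≤ (p + 1) * r := Nat.mul_le_mul_left _ h1
  have h7 : 4 * ((p + 1) * (p + 1)) ≤ (p + 1) * t := by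
    linarith [Nat.mul_le_mul_left (p + 1) hst]
  have h8 : 4 * ((p + 1) * (p + 1) * (p + 1)) ≤ (p + 1) ^ 2 * t := by
    linarith [Nat.mul_le_mul_left ((p + 1) ^ 2) hst]
  constructor
  · rw [Nat.add_sub_cancel]
    nlinarith
  · nlinarith
  · rw [Nat.le_div_iff_mul_le two_pos]
    nlinarith
  · rw [Nat.le_div_iff_mul_le two_pos, Nat.add_sub_cancel]
    nlinarith

/-- Suitable parameters for configurations of density about `1 / a`. -/
theorem exists_params {s a : ℕ} (hs : 2 ≤ s) (ha : 100 * s ^ 2 < a) :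
    ∃ K n0 : ℕ, 0 < K ∧ ∀ n, n0 ≤ n → ∃ r t v u : ℕ, ConfigNum s n (2 * r) (3 * r) (r / 2) t ∧
      a * r ≤ n ∧ n * n ≤ 8 * a ^ 2 * (52 * s ^ 2) * (t * r) ∧ n ≤ K * u ∧ 8 * r ≤ n ∧ 4 * t ≤ r ∧
      4 * s ≤ t ∧ 40 * (u * n) ≤ v * r ∧ 40 * (v * n) ≤ t * r ∧ 0 < r := by
  have key : ∀ b m : ℕ, 0 < b → b ≤ m → b * (m / b) ≤ m ∧ m ≤ 2 * b * (m / b) := fun b m hb hm => by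
    have h1 := Nat.div_add_mod m b
    have h2 := Nat.mod_lt m hb
    have h3 : b * 1 ≤ b * (m / b) := Nat.mul_le_mul_left _ ((Nat.one_le_div_iff hb).2 hm)
    rw [mul_assoc]
    omega
  have ha0 : 0 < a := by omega
  set c := 52 * s ^ 2 with hc
  have hs2 : 4 ≤ s ^ 2 := by nlinarith
  have hc0 : 0 < c := by positivity
  set b := 80 * a with hb
  have hb0 : 0 < b := by positivity
  refine ⟨2 * a * (2 * c * (2 * b * (2 * b))), a * (c * (4 * s * (b * b))), by positivity,
    fun n hn => ?_⟩
  have k1 : ∀ {x y z : ℕ}, 0 < x → x * y ≤ z → y ≤ z / x := fun hx h =>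
    (Nat.le_div_iff_mul_le hx).2 (by rwa [mul_comm])
  have le : ∀ x y : ℕ, 0 < y → x ≤ x * y := fun x y hy => Nat.le_mul_of_pos_right x hy
  have r1 := k1 ha0 hn
  have t1 := k1 hc0 r1
  have bb : 0 < b * b := by positivity
  have s0 : 0 < s := by omega
  have v0 : b * (4 * s * b) ≤ n / a / c :=
    le_trans (by rw [← mul_assoc, mul_comm b, mul_assoc, mul_comm b, mul_assoc, mul_assoc]) t1
  have v1 := k1 hb0 v0
  obtain ⟨r2, r3⟩ := key a n ha0 ((le _ _ (by positivity)).trans hn)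
  obtain ⟨t2, t3⟩ := key c (n / a) hc0 ((le _ _ (by positivity)).trans r1)
  obtain ⟨v2, v3⟩ := key b (n / a / c) hb0 ((le _ _ (by positivity)).trans v0)
  obtain ⟨u2, u3⟩ := key b (n / a / c / b) hb0
    ((le b (4 * s) (by positivity)).trans ((mul_comm _ _).le.trans v1))
  have ts : 4 * s ≤ n / a / c := (le _ _ bb).trans t1
  generalize n / a = r at *
  generalize r / c = t at *
  generalize t / b = v at *
  generalize v / b = u at *
  have r0 : 0 < r := by
    by_contra! h
    have : r = 0 := by omega
    subst this
    have : 0 < c * (4 * s * (b * b)) := by positivity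
    omega
  clear r1 t1 v1 v0 hn k1 key le
  refine ⟨r, t, v, u, configNum_of hs ts t2 ?_, r2, ?_, ?_, ?_, ?_, ts, ?_, ?_, r0⟩
  · exact lt_of_lt_of_le (Nat.mul_lt_mul_of_pos_right ha r0) r2
  · calc n * n ≤ (2 * a * r) * (2 * a * (2 * c * t)) :=
        Nat.mul_le_mul r3 (r3.trans (Nat.mul_le_mul_left _ t3))
      _ = _ := by ring
  · calc n ≤ 2 * a * (2 * c * (2 * b * (2 * b * u))) :=
        r3.trans (Nat.mul_le_mul_left _ (t3.trans (Nat.mul_le_mul_left _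
          (v3.trans (Nat.mul_le_mul_left _ u3)))))
      _ = _ := by ring
  · nlinarith
  · nlinarith
  · calc 40 * (u * n) ≤ 40 * (u * (2 * a * r)) := by gcongr
      _ = (b * u) * r := by rw [hb]; ring
      _ ≤ _ := Nat.mul_le_mul_right _ u2
  · calc 40 * (v * n) ≤ 40 * (v * (2 * a * r)) := by gcongr
      _ = (b * v) * r := by rw [hb]; ring
      _ ≤ _ := Nat.mul_le_mul_right _ v2

/-- The extremal case: there is a sparse pair of sets of size about `n / 2`. -/
theorem til_of_sparse_pair (s : ℕ) (hs : 2 ≤ s) : ∃ L n0 : ℕ, 0 < L ∧ ∀ n, n0 ≤ n →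
    ∀ (V : Type*) [DecidableEq V] (G : SimpleGraph V) (A B X Y : Finset V) (D0 k : ℕ),
      Disjoint A B → A.card = n → B.card = n → (∀ x ∈ A, D0 ≤ degS G x B) →
      (∀ x ∈ B, D0 ≤ degS G x A) →
      (n = 2 * (k * s) ∧ D0 = k * s + s - 1 ∨ n = 2 * (k * s) + s ∧ D0 = k * s + 2 * s - 2) →
      X ⊆ A → Y ⊆ B → L * n ≤ 2 * L * X.card + n → L * n ≤ 2 * L * Y.card + n →
      2 * X.card ≤ n → 2 * Y.card ≤ n → L * eAB G X Y ≤ n * n → Til G s A B := by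
  have hs2 : 4 ≤ s ^ 2 := by nlinarith
  set a2 := 100 * s ^ 2 + 1 with ha2
  obtain ⟨K2, m2, hK2, h2⟩ := exists_params (a := a2) hs (by omega)
  set a1 := 60 * (8 * a2 ^ 2 * (52 * s ^ 2)) with ha1
  have : 100 * s ^ 2 < a1 := by
    rw [ha1]
    nlinarith [Nat.zero_le (s ^ 2), Nat.zero_le (a2 ^ 2), Nat.one_le_pow 2 a2 (by omega)]
  obtain ⟨K1, m1, hK1, h1⟩ := exists_params (a := a1) hs this
  refine ⟨K1 + K2, max 1 (max m1 m2), by omega, fun n hn V _ G A B X Y D0 k hAB hA hB hdA hdB hk hX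
    hY hXl hYl hXu hYu he => ?_⟩
  have hD : n ≤ 2 * D0 := by omega
  have fin : ∀ {S D R t A1 A2 A0 B1 B2 B0}, Config G s n S D R t D0 A1 A2 A0 B1 B2 B0 →
      A1 ∪ A2 ∪ A0 = A → B1 ∪ B2 ∪ B0 = B → Til G s A B := by
    rintro S D R t A1 A2 A0 B1 B2 B0 h rfl rfl
    rcases hk with ⟨e1, e2⟩ | ⟨e1, e2⟩
    · exact h.til_even hs e1 e2
    · exact h.til_odd hs e1 e2
  have mono : ∀ {K u x : ℕ}, 0 < K → K ≤ K1 + K2 → n ≤ K * u →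
      (K1 + K2) * n ≤ 2 * (K1 + K2) * x + n → n ≤ 2 * x + 2 * u := by
    intro K u x hK hKK hu hx
    have : (K1 + K2) * n ≤ (K1 + K2) * (2 * x + 2 * u) := by nlinarith
    exact Nat.le_of_mul_le_mul_left this (by omega)
  have mono' : ∀ {K u : ℕ}, 0 < K → K ≤ K1 + K2 → n ≤ K * u → eAB G X Y ≤ u * n := by
    intro K u hK hKK hu
    have : (K1 + K2) * eAB G X Y ≤ (K1 + K2) * (u * n) := by
      have h1 : n * n ≤ K * u * n := Nat.mul_le_mul_right _ hu
      have h2 : K * (u * n) ≤ (K1 + K2) * (u * n) := Nat.mul_le_mul_right _ hKK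
      nlinarith
    exact Nat.le_of_mul_le_mul_left this (by omega)
  obtain ⟨r, t, v, u, num, ra, rt, hu, p1, p2, p3, p4, p5, p6⟩ := h2 n (by omega)
  by_cases hc : 20 * eAB G (A \ X) (B \ Y) ≤ t * r
  · obtain ⟨A1, A2, A0, B1, B2, B0, h, hA', hB'⟩ := exists_config num hAB hA hB hdA hdB hD
      (Nat.mul_div_le r 2) p1 p2 p3 p4 p5 (by omega) p6 hX hY (mono hK2 (by omega) hu hXl)
      (by omega) (mono hK2 (by omega) hu hYl) (by omega) (mono' hK2 (by omega) hu) (.inl hc)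
    exact fin h hA' hB'
  · obtain ⟨r', t', v', u', num', ra', -, hu', q1, q2, q3, q4, q5, q6⟩ := h1 n (by omega)
    have key : 3 * (r' * n) ≤ eAB G (A \ X) (B \ Y) := by
      push Not at hc
      set E := 8 * a2 ^ 2 * (52 * s ^ 2) with hE
      have hE0 : 0 < E := by positivity
      have e1 : 60 * E * (r' * n) ≤ 20 * E * eAB G (A \ X) (B \ Y) :=
        calc 60 * E * (r' * n) = a1 * r' * n := by rw [ha1]; ring
          _ ≤ n * n := Nat.mul_le_mul_right _ ra'
          _ ≤ E * (t * r) := rt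
          _ ≤ E * (20 * eAB G (A \ X) (B \ Y)) := Nat.mul_le_mul_left _ hc.le
          _ = _ := by ring
      refine le_of_mul_le_mul_left (a := 20 * E) (le_trans (le_of_eq ?_) e1) (by positivity)
      ring
    obtain ⟨A1, A2, A0, B1, B2, B0, h, hA', hB'⟩ := exists_config num' hAB hA hB hdA hdB hD
      (Nat.mul_div_le r' 2) q1 q2 q3 q4 q5 (by omega) q6 hX hY (mono hK1 (by omega) hu' hXl)
      (by omega) (mono hK1 (by omega) hu' hYl) (by omega) (mono' hK1 (by omega) hu') (.inr key)
    exact fin h hA' hB'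

end ExtremalCase

section Probability

open BigOperators

variable {α β ι : Type*} [Fintype α] [Fintype β] [Fintype ι]

/-- The probability of an event under the uniform measure on a finite type. -/
noncomputable def pr (P : α → Prop) : ℝ := 𝔼 x, if P x then (1 : ℝ) else 0

theorem pr_eq_card (P : α → Prop) : pr P = (univ.filter P).card / Fintype.card α := by
  rw [pr, Fintype.expect_eq_sum_div_card, sum_boole]

theorem pr_nonneg (P : α → Prop) : 0 ≤ pr P := by
  rw [pr_eq_card]
  positivity

theorem pr_mono {P Q : α → Prop} (h : ∀ x, P x → Q x) : pr P ≤ pr Q := by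
  rw [pr_eq_card, pr_eq_card]
  gcongr with x
  exact h x

theorem pr_equiv (e : α ≃ β) (P : β → Prop) : pr (fun a => P (e a)) = pr P :=
  Fintype.expect_equiv e _ _ fun _ => rfl

theorem pr_prod (R : α → β → Prop) : pr (fun z : α × β => R z.1 z.2) = 𝔼 a, pr (R a) := by
  unfold pr
  rw [← expect_product', univ_product_univ]

theorem pr_prod' (R : α → β → Prop) :
    pr (fun z : α × β => R z.1 z.2) = 𝔼 b, pr (fun a => R a b) := by
  rw [pr_prod]
  unfold pr
  rw [expect_comm]

theorem pr_pi [DecidableEq ι] (P : ι → α → Prop) :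
    pr (fun f : ι → α => ∀ i, P i (f i)) = ∏ i, pr (P i) := by
  unfold pr
  simp only [Fintype.expect_eq_sum_div_card, prod_div_distrib]
  rw [Finset.prod_univ_sum, Fintype.piFinset_univ]
  simp only [Fintype.card_pi, prod_const, card_univ, Nat.cast_pow]
  congr 1
  exact sum_congr rfl fun f _ => by rw [Fintype.prod_boole]; congr

theorem mul_le_pr_and {P : α → Prop} {Q : α → β → Prop} {a b : ℝ} (hP : a ≤ pr P) (hb : 0 ≤ b)
    (hQ : ∀ x, P x → b ≤ pr (Q x)) : a * b ≤ pr (fun z : α × β => P z.1 ∧ Q z.1 z.2) := by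
  rw [pr_prod (fun x y => P x ∧ Q x y)]
  refine (mul_le_mul_of_nonneg_right hP hb).trans ?_
  rw [pr, expect_mul]
  refine expect_le_expect fun x _ => ?_
  by_cases h : P x
  · simpa [h] using hQ x h
  · simp [h, pr_nonneg]

theorem pr_exists_le (P : ι → α → Prop) : pr (fun x => ∃ i, P i x) ≤ ∑ i, pr (P i) := by
  unfold pr
  rw [← expect_sum_comm]
  refine expect_le_expect fun x _ => ?_
  split_ifs with h
  · obtain ⟨i, hi⟩ := h
    exact (le_of_eq (by simp [hi])).trans
      (single_le_sum (f := fun i => if P i x then (1 : ℝ) else 0)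
        (fun j _ => by positivity) (mem_univ i))
  · exact sum_nonneg fun j _ => by positivity

theorem pr_and_not_ge (P Q : α → Prop) : pr P - pr Q ≤ pr (fun x => P x ∧ ¬ Q x) := by
  unfold pr
  rw [← expect_sub_distrib]
  refine expect_le_expect fun x _ => ?_
  by_cases h : P x <;> by_cases h' : Q x <;> simp [h, h']

theorem expect_pow_le [Nonempty α] (f : α → ℝ) (hf : ∀ x, 0 ≤ f x) (q : ℕ) :
    (𝔼 x, f x) ^ q ≤ 𝔼 x, f x ^ q := by
  cases q with
  | zero => simp
  | succ q =>
    have h := pow_sum_div_card_le_sum_pow (s := univ) (fun x _ => hf x) q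
    have h0 : (0 : ℝ) < Fintype.card α := by exact_mod_cast Fintype.card_pos
    rw [Fintype.expect_eq_sum_div_card, Fintype.expect_eq_sum_div_card, div_pow,
      le_div_iff₀ h0]
    refine le_trans (le_of_eq ?_) h
    rw [card_univ]
    field_simp
    ring

variable {κ κ₁ κ₂ : Type*} [Fintype κ] [Fintype κ₁] [Fintype κ₂] [DecidableEq κ] [DecidableEq κ₁]
  [DecidableEq κ₂]

theorem mul_le_pr_sum {P : (κ₁ → α) → Prop} {Q : (κ₁ → α) → (κ₂ → α) → Prop} {a b : ℝ}
    (hP : a ≤ pr P) (hb : 0 ≤ b) (hQ : ∀ x, P x → b ≤ pr (Q x)) :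
    a * b ≤ pr (fun φ : κ₁ ⊕ κ₂ → α => P (φ ∘ Sum.inl) ∧ Q (φ ∘ Sum.inl) (φ ∘ Sum.inr)) :=
  (mul_le_pr_and hP hb hQ).trans_eq
    (pr_equiv (Equiv.sumArrowEquivProdArrow κ₁ κ₂ α) (fun z => P z.1 ∧ Q z.1 z.2)).symm

theorem pow_le_pr_prod [DecidableEq ι] {P : ι → (κ → α) → Prop} {a : ℝ} (ha : 0 ≤ a)
    (hP : ∀ i, a ≤ pr (P i)) :
    a ^ Fintype.card ι ≤ pr (fun φ : ι × κ → α => ∀ i, P i fun j => φ (i, j)) := by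
  refine le_of_le_of_eq ?_ (pr_equiv (Equiv.curry ι κ α) (fun f => ∀ i, P i (f i))).symm
  rw [pr_pi, ← card_univ, ← prod_const]
  exact prod_le_prod (fun _ _ => ha) fun i _ => hP i

/-- Complete bipartite graphs are at least as frequent as in a random graph of the same
density. -/
theorem pow_le_pr_complete [Nonempty α] (E : α → α → Prop) :
    pr (fun z : α × α => E z.1 z.2) ^ (Fintype.card κ₁ * Fintype.card κ₂) ≤
      pr (fun φ : κ₁ ⊕ κ₂ → α => ∀ i j, E (φ (.inl i)) (φ (.inr j))) := by
  have h1 : pr (fun φ : κ₁ ⊕ κ₂ → α => ∀ i j, E (φ (.inl i)) (φ (.inr j))) =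
      𝔼 f : κ₁ → α, pr (fun y => ∀ i, E (f i) y) ^ Fintype.card κ₂ := by
    refine (pr_equiv (Equiv.sumArrowEquivProdArrow κ₁ κ₂ α)
      (fun z : (κ₁ → α) × (κ₂ → α) => ∀ i j, E (z.1 i) (z.2 j))).trans ?_
    rw [pr_prod (fun (f : κ₁ → α) (g : κ₂ → α) => ∀ i j, E (f i) (g j))]
    refine expect_congr rfl fun f _ => ?_
    have := pr_pi (ι := κ₂) (fun _ y => ∀ i, E (f i) y)
    rw [prod_const, card_univ] at this
    rw [← this]
    congr! 3
    exact forall_comm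
  have h2 : 𝔼 f : κ₁ → α, pr (fun y => ∀ i, E (f i) y) =
      𝔼 y, pr (fun x => E x y) ^ Fintype.card κ₁ := by
    rw [← pr_prod (fun (f : κ₁ → α) y => ∀ i, E (f i) y),
      pr_prod' (fun (f : κ₁ → α) y => ∀ i, E (f i) y)]
    refine expect_congr rfl fun y _ => ?_
    rw [pr_pi (ι := κ₁) (fun _ x => E x y), prod_const, card_univ]
  rw [h1, pow_mul]
  refine le_trans (pow_le_pow_left₀ (pow_nonneg (pr_nonneg _) _) ?_ _)
    (expect_pow_le _ (fun _ => pr_nonneg _) _)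
  rw [h2, pr_prod' E]
  exact expect_pow_le _ (fun _ => pr_nonneg _) _

theorem pr_split (i : κ) (R : α → ({j // j ≠ i} → α) → Prop) {b : ℝ} (hb : 0 ≤ b)
    (h : ∀ g, pr (fun x => R x g) ≤ b) : pr (fun φ : κ → α => R (φ i) fun j => φ j) ≤ b := by
  refine (pr_equiv (Equiv.funSplitAt i α) (fun z => R z.1 z.2)).trans_le ?_
  rw [pr_prod', Fintype.expect_eq_sum_div_card]
  refine div_le_of_le_mul₀ (by positivity) hb ?_
  exact (sum_le_card_nsmul _ _ _ fun g _ => h g).trans (by rw [nsmul_eq_mul, card_univ, mul_comm])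

theorem pr_mem (W : Finset α) : pr (fun x => x ∈ W) = W.card / Fintype.card α := by
  rw [pr_eq_card]
  simp

theorem pr_range_meets_le (W : Finset α) :
    pr (fun φ : κ → α => ∃ i, φ i ∈ W) ≤ Fintype.card κ * (W.card / Fintype.card α) := by
  refine (pr_exists_le _).trans ((sum_le_card_nsmul _ _ _ fun i _ => ?_).trans
    (by rw [nsmul_eq_mul, card_univ]))
  exact pr_split i (fun x _ => x ∈ W) (by positivity) fun _ => (pr_mem W).le

theorem pr_not_injective_le :
    pr (fun φ : κ → α => ¬ Function.Injective φ) ≤ (Fintype.card κ) ^ 2 / Fintype.card α := by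
  have h1 : ∀ z : κ × κ, pr (fun φ : κ → α => z.1 ≠ z.2 ∧ φ z.1 = φ z.2) ≤ 1 / Fintype.card α := by
    rintro ⟨i, j⟩
    by_cases hij : i = j
    · rw [pr_eq_card]
      simp [hij]
    · refine (pr_mono fun φ h => h.2).trans
        (pr_split i (fun x g => x = g ⟨j, Ne.symm hij⟩) (by positivity) fun g => ?_)
      rw [pr_eq_card]
      gcongr
      rw [Nat.cast_le_one, card_le_one]
      exact fun a ha b hb => (mem_filter.1 ha).2.trans (mem_filter.1 hb).2.symm
  refine (pr_mono (Q := fun φ : κ → α => ∃ z : κ × κ, z.1 ≠ z.2 ∧ φ z.1 = φ z.2)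
    fun φ h => ?_).trans ((pr_exists_le _).trans
      ((sum_le_card_nsmul _ _ _ fun z _ => h1 z).trans ?_))
  · simp only [Function.Injective, not_forall] at h
    obtain ⟨i, j, h, h'⟩ := h
    exact ⟨(i, j), h', h⟩
  · rw [nsmul_eq_mul, card_univ, Fintype.card_prod]
    push_cast
    apply le_of_eq
    ring

end Probability

section AbsorbingFamily

open BigOperators

variable [Fintype V] {G : SimpleGraph V} {X Y : Finset V}

theorem pr_adj : pr (fun z : V × V => z.1 ∈ X ∧ z.2 ∈ Y ∧ G.Adj z.1 z.2) =
    eAB G X Y / (Fintype.card V) ^ 2 := by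
  rw [pr_eq_card, Fintype.card_prod]
  congr 1
  · norm_cast
    unfold eAB degS
    rw [← card_sigma]
    refine card_nbij' (fun z => ⟨z.1, z.2⟩) (fun z => (z.1, z.2)) ?_ ?_ ?_ ?_ <;>
      simp +contextual [Set.MapsTo, Set.LeftInvOn]
  · push_cast
    ring

theorem exists_isKst (s : ℕ) {d : ℝ} (hd : 0 < d) : ∃ n0 : ℕ, ∀ (V : Type*) [Fintype V]
    [DecidableEq V] (G : SimpleGraph V) (X Y : Finset V), n0 ≤ Fintype.card V → Disjoint X Y →
      d * (Fintype.card V) ^ 2 ≤ eAB G X Y → ∃ S ⊆ X, ∃ T ⊆ Y, IsKst G s s S T := by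
  obtain ⟨n0, hn0⟩ := exists_nat_gt (((s + s : ℕ) : ℝ) ^ 2 / d ^ (s * s))
  refine ⟨n0 + 1, fun V _ _ G X Y hN hXY he => ?_⟩
  have hN0 : 0 < (Fintype.card V : ℝ) := by exact_mod_cast (by omega : 0 < Fintype.card V)
  have : Nonempty V := Fintype.card_pos_iff.1 (by omega)
  have h1 := pow_le_pr_complete (κ₁ := Fin s) (κ₂ := Fin s)
    (fun x y : V => x ∈ X ∧ y ∈ Y ∧ G.Adj x y)
  rw [pr_adj, Fintype.card_fin] at h1
  have h2 : d ^ (s * s) ≤ (eAB G X Y / (Fintype.card V : ℝ) ^ 2) ^ (s * s) := by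
    gcongr
    rwa [le_div_iff₀ (by positivity)]
  have h3 := pr_not_injective_le (α := V) (κ := Fin s ⊕ Fin s)
  rw [Fintype.card_sum, Fintype.card_fin] at h3
  have h4 : (((s + s : ℕ) : ℝ)) ^ 2 / Fintype.card V < d ^ (s * s) := by
    rw [div_lt_iff₀ (by positivity)] at hn0 ⊢
    refine hn0.trans_le ?_
    rw [mul_comm]
    gcongr
    exact_mod_cast (by omega : n0 ≤ Fintype.card V)
  obtain ⟨φ, hφ, hi⟩ : ∃ φ : Fin s ⊕ Fin s → V,
      (∀ i j, φ (.inl i) ∈ X ∧ φ (.inr j) ∈ Y ∧ G.Adj (φ (.inl i)) (φ (.inr j))) ∧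
      Function.Injective φ := by
    by_contra! hcon
    have := pr_mono (Q := fun φ : Fin s ⊕ Fin s → V => ¬ Function.Injective φ) hcon
    linarith
  rcases s.eq_zero_or_pos with rfl | hs
  · exact ⟨∅, by simp, ∅, by simp, by simp [IsKst]⟩
  refine ⟨univ.image (φ ∘ Sum.inl), ?_, univ.image (φ ∘ Sum.inr), ?_, ?_, ?_, ?_, ?_⟩
  · exact image_subset_iff.2 fun i _ => (hφ i ⟨0, hs⟩).1
  · exact image_subset_iff.2 fun i _ => (hφ ⟨0, hs⟩ i).2.1
  · refine hXY.mono ?_ ?_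
    · exact image_subset_iff.2 fun i _ => (hφ i ⟨0, hs⟩).1
    · exact image_subset_iff.2 fun i _ => (hφ ⟨0, hs⟩ i).2.1
  · rw [card_image_of_injective _ (hi.comp Sum.inl_injective), card_univ, Fintype.card_fin]
  · rw [card_image_of_injective _ (hi.comp Sum.inr_injective), card_univ, Fintype.card_fin]
  · simp only [mem_image, mem_univ, true_and, Function.comp]
    rintro _ ⟨i, rfl⟩ _ ⟨j, rfl⟩
    exact (hφ i j).2.2

variable {κ Z : Type*} [Fintype κ] [DecidableEq κ] [Nonempty κ] [Fintype Z]

/-- A family of pairwise disjoint injections. -/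
def DisjFam (F : Finset (κ → V)) : Prop :=
  (∀ φ ∈ F, Function.Injective φ) ∧ ∀ φ ∈ F, ∀ ψ ∈ F, φ ≠ ψ → ∀ i j, φ i ≠ ψ j

theorem exists_disjFam_step {R : Z → (κ → V) → Prop} {c : ℝ} (hc : 0 < c) [Nonempty Z]
    (hR : ∀ z, c ≤ pr (R z)) (m : ℕ)
    (hm : (Fintype.card κ : ℝ) ^ 2 * (m + 1) ≤ c / 2 * Fintype.card V) :
    ∃ F : Finset (κ → V), DisjFam F ∧ F.card = m ∧ (∀ φ ∈ F, ∃ z, R z φ) ∧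
      ∑ z, ((1 : ℝ) / 2) ^ (F.filter (R z)).card ≤ Fintype.card Z * (1 - c / 4) ^ m := by
  induction m with
  | zero => exact ⟨∅, ⟨by simp, by simp⟩, rfl, by simp, by simp⟩
  | succ m ih =>
    push_cast at hm
    have hk0 : (0 : ℝ) < Fintype.card κ := by exact_mod_cast Fintype.card_pos
    obtain ⟨F, hF, hFm, hFR, hΦ⟩ := ih (by nlinarith)
    have hN : (0 : ℝ) < Fintype.card V := by
      by_contra! h
      have : 0 < (Fintype.card κ : ℝ) ^ 2 * (m + 1 + 1) := by positivity
      nlinarith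
    set W : Finset V := F.biUnion fun φ => univ.image φ with hW
    have hWc : (W.card : ℝ) ≤ m * Fintype.card κ := by
      have : W.card ≤ F.card * Fintype.card κ :=
        card_biUnion_le_card_mul _ _ _ fun φ _ => card_image_le
      rw [hFm] at this
      exact_mod_cast this
    have memW : ∀ {φ : κ → V} {i}, φ ∈ F → φ i ∈ W := fun hφ =>
      mem_biUnion.2 ⟨_, hφ, mem_image_of_mem _ (mem_univ _)⟩
    set w : Z → ℝ := fun z => ((1 : ℝ) / 2) ^ (F.filter (R z)).card with hw
    have hw0 : ∀ z, 0 < w z := fun z => by positivity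
    set bad : (κ → V) → Prop := fun φ => (∃ i, φ i ∈ W) ∨ ¬ Function.Injective φ with hbad
    have hpb : pr bad ≤ c / 2 := by
      have h1 := pr_range_meets_le (κ := κ) W
      have h2 := pr_not_injective_le (α := V) (κ := κ)
      have h3 : pr bad ≤ pr (fun φ : κ → V => ∃ i, φ i ∈ W) +
          pr (fun φ : κ → V => ¬ Function.Injective φ) := by
        unfold pr
        rw [← expect_add_distrib]
        refine expect_le_expect fun φ _ => ?_
        by_cases h : ∃ i, φ i ∈ W <;> by_cases h' : Function.Injective φ <;> simp [hbad, h, h']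
      have h4 : (Fintype.card κ : ℝ) * (W.card / Fintype.card V) +
          (Fintype.card κ) ^ 2 / Fintype.card V ≤ c / 2 := by
        rw [← mul_div_assoc, ← add_div, div_le_iff₀ hN]
        nlinarith
      linarith
    have hgood : ∀ z, c / 2 ≤ pr fun φ => R z φ ∧ ¬ bad φ := fun z => by
      linarith [hR z, pr_and_not_ge (R z) bad]
    have hsum : (∑ z, w z) * (c / 2) ≤ 𝔼 φ : κ → V, ∑ z, if R z φ ∧ ¬ bad φ then w z else 0 := by
      rw [expect_sum_comm, sum_mul]
      refine sum_le_sum fun z _ => (mul_le_mul_of_nonneg_left (hgood z) (hw0 z).le).trans_eq ?_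
      rw [pr, mul_expect]
      exact expect_congr rfl fun φ _ => by split_ifs <;> simp
    have : Nonempty (κ → V) := by
      have := Fintype.card_pos_iff.1 (Nat.cast_pos.1 hN)
      infer_instance
    obtain ⟨φ, -, hφ⟩ := exists_le_of_le_expect univ_nonempty hsum
    have hΦ0 : 0 < ∑ z, w z := sum_pos (fun z _ => hw0 z) univ_nonempty
    obtain ⟨z0, hz0, hb⟩ : ∃ z, R z φ ∧ ¬ bad φ := by
      by_contra! hcon
      rw [sum_eq_zero fun z _ => if_neg fun h => h.2 (hcon z h.1)] at hφ
      nlinarith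
    simp only [hbad, not_or, not_exists, not_not] at hb
    have hφF : φ ∉ F := fun h => hb.1 (Classical.arbitrary κ) (memW h)
    refine ⟨insert φ F, ⟨?_, ?_⟩, by rw [card_insert_of_notMem hφF, hFm], ?_, ?_⟩
    · exact forall_mem_insert _ _ _ |>.2 ⟨hb.2, hF.1⟩
    · intro ψ hψ χ hχ hne i j
      rcases mem_insert.1 hψ with rfl | hψ' <;> rcases mem_insert.1 hχ with rfl | hχ'
      · exact absurd rfl hne
      · exact fun h => hb.1 i (h ▸ memW hχ')
      · exact fun h => hb.1 j (h ▸ memW hψ')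
      · exact hF.2 ψ hψ' χ hχ' hne i j
    · exact forall_mem_insert _ _ _ |>.2 ⟨⟨z0, hz0⟩, hFR⟩
    · have key : ∀ z, ((1 : ℝ) / 2) ^ ((insert φ F).filter (R z)).card =
          w z - 1 / 2 * if R z φ ∧ ¬ bad φ then w z else 0 := fun z => by
        have hnb : ¬ bad φ := by simpa [hbad] using hb
        rw [filter_insert]
        by_cases h : R z φ
        · rw [if_pos h, if_pos ⟨h, hnb⟩, card_insert_of_notMem fun h => hφF (mem_filter.1 h).1,
            pow_succ]
          simp only [hw]
          ring
        · rw [if_neg h, if_neg fun h' => h h'.1]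
          simp [hw]
      rw [sum_congr rfl fun z _ => key z, sum_sub_distrib, ← mul_sum, pow_succ, ← mul_assoc]
      have hc4 : 0 ≤ 1 - c / 4 := by
        have : pr (R z0) ≤ 1 := by
          rw [pr_eq_card]
          exact div_le_one_of_le₀ (by exact_mod_cast card_le_univ _) (by positivity)
        linarith [hR z0]
      calc _ ≤ (∑ z, w z) * (1 - c / 4) := by linarith
        _ ≤ _ := mul_le_mul_of_nonneg_right hΦ hc4

theorem exists_absorbing_family (κ : Type*) [Fintype κ] [DecidableEq κ] [Nonempty κ] (q : ℕ)
    {c β : ℝ} (hc : 0 < c) (hβ : 0 < β) (hcβ : (Fintype.card κ : ℝ) ^ 2 * β ≤ c / 4) :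
    ∃ γ : ℝ, 0 < γ ∧ ∃ n0 : ℕ, ∀ (V Z : Type*) [Fintype V] [Fintype Z] [DecidableEq V],
      n0 ≤ Fintype.card V → Fintype.card Z ≤ Fintype.card V ^ q → ∀ R : Z → (κ → V) → Prop,
      (∀ z, c ≤ pr (R z)) → ∃ F : Finset (κ → V), DisjFam F ∧
        (F.card : ℝ) ≤ β * Fintype.card V ∧ (∀ φ ∈ F, ∃ z, R z φ) ∧
        ∀ z, γ * Fintype.card V ≤ (F.filter (R z)).card := by
  have hlog : ∀ᶠ x : ℝ in Filter.atTop, q * Real.log x + c / 4 ≤ c * β / 8 * x ∧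
      (Fintype.card κ : ℝ) ^ 2 ≤ c / 4 * x ∧ 1 ≤ x := by
    have h1 : ∀ᶠ x : ℝ in Filter.atTop, q * Real.log x ≤ c * β / 16 * x := by
      have := (Real.isLittleO_log_id_atTop.const_mul_left (q : ℝ)).bound
        (show (0 : ℝ) < c * β / 16 by positivity)
      filter_upwards [this, Filter.eventually_ge_atTop 0] with x hx h0
      simp only [id, Real.norm_eq_abs, abs_of_nonneg h0] at hx
      exact (le_abs_self _).trans hx
    filter_upwards [h1, Filter.eventually_ge_atTop (4 / β), Filter.eventually_ge_atTop 1,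
      Filter.eventually_ge_atTop ((Fintype.card κ : ℝ) ^ 2 / (c / 4))] with x hx h2 h3 h4
    rw [div_le_iff₀ hβ] at h2
    rw [div_le_iff₀ (by positivity)] at h4
    refine ⟨?_, by linarith, h3⟩
    nlinarith
  obtain ⟨x0, hx0⟩ := Filter.eventually_atTop.1 hlog
  refine ⟨c * β / 8, by positivity, ⌈x0⌉₊, fun V Z _ _ _ hN hZ R hR => ?_⟩
  obtain ⟨hlog, hk, hN1⟩ := hx0 (Fintype.card V) ((Nat.le_ceil _).trans (by exact_mod_cast hN))
  rcases isEmpty_or_nonempty Z with hZe | hZe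
  · exact ⟨∅, ⟨by simp, by simp⟩, by simp; positivity, by simp, fun z => hZe.elim z⟩
  have hfl : (⌊β * Fintype.card V⌋₊ : ℝ) ≤ β * Fintype.card V := Nat.floor_le (by positivity)
  obtain ⟨F, hF, hFm, hFR, hΦ⟩ := exists_disjFam_step hc hR ⌊β * Fintype.card V⌋₊ (by
    have := mul_le_mul_of_nonneg_left hfl (sq_nonneg (Fintype.card κ : ℝ))
    nlinarith)
  refine ⟨F, hF, by rw [hFm]; exact hfl, hFR, fun z => ?_⟩
  set h := (F.filter (R z)).card
  set m := ⌊β * Fintype.card V⌋₊ with hm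
  have hc4 : 0 ≤ 1 - c / 4 := by
    have : pr (R z) ≤ 1 := by
      rw [pr_eq_card]
      exact div_le_one_of_le₀ (by exact_mod_cast card_le_univ _) (by positivity)
    linarith [hR z]
  have hN0 : (0 : ℝ) < Fintype.card V := by linarith
  have h1 : Real.exp (-h) ≤ Real.exp (q * Real.log (Fintype.card V) - c / 4 * m) :=
    calc Real.exp (-h) ≤ ((1 : ℝ) / 2) ^ h := by
          have : Real.exp (-1) ≤ 1 / 2 := by
            rw [Real.exp_neg, one_div]
            exact inv_anti₀ two_pos (by linarith [Real.add_one_le_exp (1 : ℝ)])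
          rw [show (-(h : ℝ)) = h * (-1) by ring, Real.exp_nat_mul]
          exact pow_le_pow_left₀ (Real.exp_pos _).le this _
      _ ≤ ∑ z, ((1 : ℝ) / 2) ^ (F.filter (R z)).card :=
          single_le_sum (f := fun z => ((1 : ℝ) / 2) ^ (F.filter (R z)).card)
            (fun _ _ => by positivity) (mem_univ z)
      _ ≤ (Fintype.card V : ℝ) ^ q * Real.exp (- (c / 4)) ^ m := by
          refine hΦ.trans ?_
          gcongr
          · exact_mod_cast hZ
          · linarith [Real.add_one_le_exp (-(c / 4))]
      _ = _ := by
          rw [sub_eq_add_neg, Real.exp_add, Real.exp_nat_mul, Real.exp_log hN0, ← Real.exp_nat_mul]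
          congr 2
          ring
  have h2 := Real.exp_le_exp.1 h1
  have h3 := Nat.lt_floor_add_one (β * (Fintype.card V : ℝ))
  rw [← hm] at h3
  nlinarith

end AbsorbingFamily

section Absorbers

open BigOperators

/-- A balanced bipartite graph of minimum degree at least `n / 2` in which any two sets of size
about `n / 2` span many edges. -/
structure Robust (G : SimpleGraph V) (n : ℕ) (α : ℝ) (A B : Finset V) : Prop where
  disj : Disjoint A B
  cardA : A.card = n
  cardB : B.card = n
  degA : ∀ x ∈ A, n ≤ 2 * degS G x B
  degB : ∀ x ∈ B, n ≤ 2 * degS G x A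
  dense : ∀ X ⊆ A, ∀ Y ⊆ B, (1 / 2 - α) * n ≤ X.card → (1 / 2 - α) * n ≤ Y.card →
    α * n ^ 2 ≤ eAB G X Y

theorem Robust.symm {G : SimpleGraph V} {n : ℕ} {α : ℝ} {A B : Finset V} (h : Robust G n α A B) :
    Robust G n α B A :=
  ⟨h.disj.symm, h.cardB, h.cardA, h.degB, h.degA, fun X hX Y hY h1 h2 => by
    rw [eAB_comm]
    exact h.dense Y hY X hX h2 h1⟩

/-- The vertices of `A` having at least `m` common neighbours with `z` in `B`. -/
noncomputable def close (G : SimpleGraph V) (A B : Finset V) (m : ℝ) (z : V) : Finset V :=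
  A.filter fun w => m ≤ (nb G z B ∩ nb G w B).card

theorem Robust.card_close {G : SimpleGraph V} {n : ℕ} {α : ℝ} {A B : Finset V}
    (h : Robust G n α A B) (hα : 0 < α) (hn : 0 < n) {z : V} (hz : z ∈ A) :
    (1 / 2 + α) * n ≤ (close G A B (α / 2 * n) z).card := by
  by_contra! hcon
  have hn' : (0 : ℝ) < n := by exact_mod_cast hn
  set X := A \ close G A B (α / 2 * n) z with hX
  have hXc : (X.card : ℝ) + (close G A B (α / 2 * n) z).card = n := by
    have := card_sdiff_add_card_eq_card (s := close G A B (α / 2 * n) z) (t := A)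
      (filter_subset _ _)
    rw [h.cardA] at this
    exact_mod_cast this
  have hnb : (n : ℝ) ≤ 2 * (nb G z B).card := by exact_mod_cast h.degA z hz
  have h1 := h.dense X sdiff_subset (nb G z B) nb_subset (by linarith) (by nlinarith)
  have h2 : (eAB G X (nb G z B) : ℝ) ≤ X.card * (α / 2 * n) := by
    unfold eAB
    push_cast
    rw [← nsmul_eq_mul]
    refine sum_le_card_nsmul _ _ _ fun w hw => ?_
    rw [hX, mem_sdiff, close, mem_filter, not_and, not_le] at hw
    refine le_trans ?_ (hw.2 hw.1).le
    norm_cast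
    refine card_le_card fun y hy => ?_
    rw [mem_filter] at hy
    exact mem_inter.2 ⟨hy.1, mem_nb.2 ⟨nb_subset hy.1, hy.2⟩⟩
  have h3 : (X.card : ℝ) ≤ n := by
    linarith [Nat.cast_nonneg (α := ℝ) (close G A B (α / 2 * n) z).card]
  nlinarith [mul_le_mul_of_nonneg_right h3 (show 0 ≤ α / 2 * n by positivity),
    mul_pos hα (pow_pos hn' 2)]

theorem Robust.card_close_inter {G : SimpleGraph V} {n : ℕ} {α : ℝ} {A B : Finset V}
    (h : Robust G n α A B) (hα : 0 < α) (hn : 0 < n) {z p : V} (hz : z ∈ A) (hp : p ∈ A) :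
    2 * α * n ≤ (close G A B (α / 2 * n) z ∩ close G A B (α / 2 * n) p).card := by
  have h1 := h.card_close hα hn hz
  have h2 := h.card_close hα hn hp
  have h3 : ((close G A B (α / 2 * n) z ∪ close G A B (α / 2 * n) p).card : ℝ) ≤ n := by
    rw [← h.cardA]
    exact_mod_cast card_le_card (union_subset (filter_subset _ _) (filter_subset _ _))
  have h4 : ((close G A B (α / 2 * n) z ∪ close G A B (α / 2 * n) p).card : ℝ) +
      (close G A B (α / 2 * n) z ∩ close G A B (α / 2 * n) p).card =
      (close G A B (α / 2 * n) z).card + (close G A B (α / 2 * n) p).card := by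
    exact_mod_cast card_union_add_card_inter _ _
  linarith

/-- Index type for a copy of `K_{s - 1, s}`. -/
abbrev HalfIdx (s : ℕ) := Fin (s - 1) ⊕ Fin s

/-- Index type for the middle vertex and the two copies of `K_{s - 1, s}` of a gadget. -/
abbrev GadIdx (s : ℕ) := Unit ⊕ (HalfIdx s ⊕ HalfIdx s)

/-- Index type for an absorber. -/
abbrev AbsIdx (s : ℕ) := (Fin s ⊕ Fin s) ⊕ ((Fin s ⊕ Fin s) × GadIdx s)

/-- `θ` is a copy of `K_{s - 1, s}` between `A` and `M`. -/
def Half (G : SimpleGraph V) (s : ℕ) (A M : Finset V) (θ : HalfIdx s → V) : Prop :=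
  ∀ i j, θ (.inl i) ∈ A ∧ θ (.inr j) ∈ M ∧ G.Adj (θ (.inl i)) (θ (.inr j))

/-- `θ` is a gadget in which `p` can be exchanged for `z`. -/
def Gad (G : SimpleGraph V) (s : ℕ) (A B : Finset V) (z p : V) (θ : GadIdx s → V) : Prop :=
  θ (.inl ()) ∈ A ∧ Half G s A (nb G z B ∩ nb G (θ (.inl ())) B) (fun k => θ (.inr (.inl k))) ∧
    Half G s A (nb G p B ∩ nb G (θ (.inl ())) B) (fun k => θ (.inr (.inr k)))

/-- `φ` absorbs the balanced set `z`. -/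
def Absorbs (G : SimpleGraph V) (s : ℕ) (A B : Finset V) (z : Fin s ⊕ Fin s → V)
    (φ : AbsIdx s → V) : Prop :=
  (∀ i j, φ (.inl (.inl i)) ∈ A ∧ φ (.inl (.inr j)) ∈ B ∧
    G.Adj (φ (.inl (.inl i))) (φ (.inl (.inr j)))) ∧
  (∀ i, Gad G s A B (z (.inl i)) (φ (.inl (.inl i))) fun k => φ (.inr (.inl i, k))) ∧
  ∀ j, Gad G s B A (z (.inr j)) (φ (.inl (.inr j))) fun k => φ (.inr (.inr j, k))

section Count

variable [Fintype V] {G : SimpleGraph V} {s n : ℕ} {α : ℝ} {A B M : Finset V} {z p : V}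

theorem Robust.pr_half (h : Robust G n α A B) (hN : Fintype.card V = 2 * n) (hn : 0 < n)
    (hα : 0 < α) (hM : M ⊆ B) (hMc : α / 2 * n ≤ M.card) :
    (α / 16) ^ ((s - 1) * s) ≤ pr (Half G s A M) := by
  have : Nonempty V := Fintype.card_pos_iff.1 (by omega)
  have h1 := pow_le_pr_complete (κ₁ := Fin (s - 1)) (κ₂ := Fin s)
    (fun x y : V => x ∈ A ∧ y ∈ M ∧ G.Adj x y)
  rw [pr_adj, Fintype.card_fin, Fintype.card_fin] at h1
  refine le_trans (pow_le_pow_left₀ (by positivity) ?_ _) h1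
  have hn' : (0 : ℝ) < n := by exact_mod_cast hn
  have h2 : (M.card * n : ℝ) ≤ 2 * eAB G A M := by
    rw [eAB_comm]
    unfold eAB
    have : M.card * n ≤ ∑ v ∈ M, 2 * degS G v A := by
      rw [← smul_eq_mul]
      exact card_nsmul_le_sum _ _ _ fun x hx => h.degB x (hM hx)
    rw [← mul_sum] at this
    exact_mod_cast this
  rw [hN, le_div_iff₀ (by positivity)]
  push_cast
  nlinarith [mul_le_mul_of_nonneg_right hMc hn'.le]

theorem Robust.pr_gad (h : Robust G n α A B) (hN : Fintype.card V = 2 * n) (hn : 0 < n)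
    (hα : 0 < α) (hz : z ∈ A) (hp : p ∈ A) :
    α * ((α / 16) ^ ((s - 1) * s) * (α / 16) ^ ((s - 1) * s)) ≤ pr (Gad G s A B z p) := by
  have hn' : (0 : ℝ) < n := by exact_mod_cast hn
  set M := close G A B (α / 2 * n) z ∩ close G A B (α / 2 * n) p with hM
  have h1 : α ≤ pr (fun x : Unit → V => x () ∈ M) := by
    refine le_of_le_of_eq ?_ (pr_equiv (Equiv.funUnique Unit V) (fun x => x ∈ M)).symm
    rw [pr_mem, hN, le_div_iff₀ (by positivity)]
    push_cast
    linarith [h.card_close_inter hα hn hz hp]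
  refine (mul_le_pr_sum h1 (by positivity)
    (Q := fun w φ => Half G s A (nb G z B ∩ nb G (w ()) B) (φ ∘ Sum.inl) ∧
      Half G s A (nb G p B ∩ nb G (w ()) B) (φ ∘ Sum.inr)) fun w hw => ?_).trans
    (pr_mono fun φ hφ => ⟨?_, hφ.2.1, hφ.2.2⟩)
  · rw [hM, mem_inter, close, close, mem_filter, mem_filter] at hw
    exact mul_le_pr_sum (Q := fun _ => Half G s A (nb G p B ∩ nb G (w ()) B))
      (h.pr_half hN hn hα (inter_subset_left.trans nb_subset) hw.1.2) (by positivity)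
      fun _ _ => h.pr_half hN hn hα (inter_subset_left.trans nb_subset) hw.2.2
  · exact filter_subset _ _ (mem_inter.1 hφ.1).1

theorem Robust.pr_absorbs (hs : 0 < s) (h : Robust G n α A B) (hN : Fintype.card V = 2 * n)
    (hn : 0 < n)
    (hα : 0 < α) {z : Fin s ⊕ Fin s → V} (hA : ∀ i, z (.inl i) ∈ A) (hB : ∀ i, z (.inr i) ∈ B) :
    (1 / 8) ^ (s * s) * (α * ((α / 16) ^ ((s - 1) * s) * (α / 16) ^ ((s - 1) * s))) ^ (s + s) ≤
      pr (Absorbs G s A B z) := by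
  have : Nonempty V := Fintype.card_pos_iff.1 (by omega)
  have hn' : (0 : ℝ) < n := by exact_mod_cast hn
  have h1 : (1 / 8 : ℝ) ^ (s * s) ≤ pr (fun φ : Fin s ⊕ Fin s → V =>
      ∀ i j, φ (.inl i) ∈ A ∧ φ (.inr j) ∈ B ∧ G.Adj (φ (.inl i)) (φ (.inr j))) := by
    have h1 := pow_le_pr_complete (κ₁ := Fin s) (κ₂ := Fin s)
      (fun x y : V => x ∈ A ∧ y ∈ B ∧ G.Adj x y)
    rw [pr_adj, Fintype.card_fin] at h1
    refine le_trans (pow_le_pow_left₀ (by positivity) ?_ _) h1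
    have h2 : (n * n : ℝ) ≤ 2 * eAB G A B := by
      unfold eAB
      have : A.card * n ≤ ∑ v ∈ A, 2 * degS G v B := by
        rw [← smul_eq_mul]
        exact card_nsmul_le_sum _ _ _ fun x hx => h.degA x hx
      rw [← mul_sum, h.cardA] at this
      exact_mod_cast this
    rw [hN, le_div_iff₀ (by positivity)]
    push_cast
    nlinarith
  refine (mul_le_pr_sum h1 (by positivity)
    (Q := fun (p : Fin s ⊕ Fin s → V) (θ : (Fin s ⊕ Fin s) × GadIdx s → V) => ∀ τ : Fin s ⊕ Fin s,
    τ.elim (fun i => Gad G s A B (z (.inl i)) (p (.inl i)) fun k => θ (.inl i, k))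
      fun i => Gad G s B A (z (.inr i)) (p (.inr i)) fun k => θ (.inr i, k)) fun p hp => ?_).trans
    (pr_mono fun φ hφ => ⟨hφ.1, fun i => hφ.2 (.inl i), fun i => hφ.2 (.inr i)⟩)
  have := pow_le_pr_prod (ι := Fin s ⊕ Fin s) (κ := GadIdx s) (α := V)
    (P := fun τ => τ.elim (fun i => Gad G s A B (z (.inl i)) (p (.inl i)))
      fun i => Gad G s B A (z (.inr i)) (p (.inr i)))
    (a := α * ((α / 16) ^ ((s - 1) * s) * (α / 16) ^ ((s - 1) * s))) (by positivity) ?_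
  · rw [Fintype.card_sum, Fintype.card_fin] at this
    refine this.trans (pr_mono ?_)
    rintro φ hφ (i | i)
    · exact hφ (.inl i)
    · exact hφ (.inr i)
  · rintro (i | i)
    · exact h.pr_gad hN hn hα (hA i) (hp i ⟨0, hs⟩).1
    · exact h.symm.pr_gad hN hn hα (hB i) (hp ⟨0, hs⟩ i).2.1

end Count

end Absorbers

section AbsorberTilings

theorem card_image_univ {ι : Type*} [Fintype ι] {f : ι → V} (hf : Function.Injective f) :
    (univ.image f).card = Fintype.card ι :=
  (card_image_of_injective _ hf).trans card_univ

variable {G : SimpleGraph V} {s n : ℕ} {A B M M₁ M₂ : Finset V} {a b x z p : V}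

theorem Til.inter_parts {X Y S : Finset V} (h : Til G s X Y) (hAB : Disjoint A B) (hX : X ⊆ A)
    (hY : Y ⊆ B) (hS : X ∪ Y = S) : Til G s (S ∩ A) (S ∩ B) := by
  have h1 : S ∩ A = X := by
    rw [← hS, union_inter_distrib_right, inter_eq_left.2 hX,
      disjoint_iff_inter_eq_empty.1 (hAB.symm.mono_left hY), union_empty]
  have h2 : S ∩ B = Y := by
    rw [← hS, union_inter_distrib_right, inter_eq_left.2 hY,
      disjoint_iff_inter_eq_empty.1 (hAB.mono_left hX), empty_union]
  rwa [h1, h2]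

theorem Half.isKst (hs : 2 ≤ s) {θ : HalfIdx s → V} (h : Half G s A M θ) (hAB : Disjoint A B)
    (hinj : Function.Injective θ) (ha : a ∈ A) (haθ : ∀ k, a ≠ θ k) (hM : M ⊆ nb G a B) :
    IsKst G s s (insert a (univ.image fun i => θ (.inl i))) (univ.image fun j => θ (.inr j)) ∧
      insert a (univ.image fun i => θ (.inl i)) ⊆ A ∧ (univ.image fun j => θ (.inr j)) ⊆ B := by
  have h1 : insert a (univ.image fun i => θ (.inl i)) ⊆ A :=
    insert_subset ha (image_subset_iff.2 fun i _ => (h i ⟨0, by omega⟩).1)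
  have h2 : (univ.image fun j => θ (.inr j)) ⊆ nb G a B :=
    image_subset_iff.2 fun j _ => hM (h ⟨0, by omega⟩ j).2.1
  refine ⟨⟨hAB.mono h1 (h2.trans nb_subset), ?_, ?_, ?_⟩, h1, h2.trans nb_subset⟩
  · rw [card_insert_of_notMem, card_image_univ fun i j h => by simpa using hinj h,
      Fintype.card_fin]
    · omega
    · simp only [mem_image, mem_univ, true_and, not_exists]
      exact fun i => (haθ _).symm
  · rw [card_image_univ fun i j h => by simpa using hinj h, Fintype.card_fin]
  · intro u hu v hv
    rcases mem_insert.1 hu with rfl | hu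
    · exact (mem_nb.1 (h2 hv)).2
    · simp only [mem_image, mem_univ, true_and] at hu hv
      obtain ⟨i, rfl⟩ := hu
      obtain ⟨j, rfl⟩ := hv
      exact (h i j).2.2

theorem til_gadget (hs : 2 ≤ s) (hAB : Disjoint A B) {θ : GadIdx s → V}
    (hinj : Function.Injective θ) (hx : x ∈ A) (hw : θ (.inl ()) ∈ A) (hxθ : ∀ k, x ≠ θ k)
    (h1 : Half G s A M₁ fun k => θ (.inr (.inl k))) (h2 : Half G s A M₂ fun k => θ (.inr (.inr k)))
    (hab : a = x ∧ b = θ (.inl ()) ∨ a = θ (.inl ()) ∧ b = x)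
    (hM₁ : M₁ ⊆ nb G a B) (hM₂ : M₂ ⊆ nb G b B) :
    Til G s (insert x (univ.image θ) ∩ A) (insert x (univ.image θ) ∩ B) := by
  have haA : a ∈ A := by rcases hab with ⟨rfl, -⟩ | ⟨rfl, -⟩ <;> assumption
  have hbA : b ∈ A := by rcases hab with ⟨-, rfl⟩ | ⟨-, rfl⟩ <;> assumption
  have haθ : ∀ k, a ≠ θ (.inr k) := fun k => by
    rcases hab with ⟨rfl, -⟩ | ⟨rfl, -⟩
    · exact hxθ _
    · exact fun h => by simpa using hinj h
  have hbθ : ∀ k, b ≠ θ (.inr k) := fun k => by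
    rcases hab with ⟨-, rfl⟩ | ⟨-, rfl⟩
    · exact fun h => by simpa using hinj h
    · exact hxθ _
  have hne : a ≠ b := by
    rcases hab with ⟨rfl, rfl⟩ | ⟨rfl, rfl⟩
    · exact hxθ _
    · exact (hxθ _).symm
  obtain ⟨k1, a1, b1⟩ := h1.isKst hs hAB (hinj.comp (Sum.inr_injective.comp Sum.inl_injective)) haA
    (fun k => haθ _) hM₁
  obtain ⟨k2, a2, b2⟩ := h2.isKst hs hAB (hinj.comp (Sum.inr_injective.comp Sum.inr_injective)) hbA
    (fun k => hbθ _) hM₂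
  refine ((Til.of_isKst k1).union (Til.of_isKst k2) ?_ ?_).inter_parts hAB (union_subset a1 a2)
    (union_subset b1 b2) ?_
  · rw [disjoint_insert_left, disjoint_insert_right]
    refine ⟨?_, ?_, ?_⟩
    · simp only [mem_insert, mem_image, mem_univ, true_and, not_or, not_exists]
      exact ⟨hne, fun i => (haθ _).symm⟩
    · simp only [mem_image, mem_univ, true_and, not_exists]
      exact fun i => (hbθ _).symm
    · rw [disjoint_left]
      simp only [mem_image, mem_univ, true_and, not_exists]
      rintro _ ⟨i, rfl⟩ j h
      simpa using hinj h
  · rw [disjoint_left]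
    simp only [mem_image, mem_univ, true_and, not_exists]
    rintro _ ⟨i, rfl⟩ j h
    simpa using hinj h
  · have : ∀ y, (y = a ∨ y = b) ↔ (y = x ∨ y = θ (.inl ())) := fun y => by
      rcases hab with ⟨rfl, rfl⟩ | ⟨rfl, rfl⟩
      · rfl
      · exact or_comm
    ext y
    have hy := this y
    simp only [mem_union, mem_insert, mem_image, mem_univ, true_and]
    constructor
    · rintro (((h | ⟨i, rfl⟩) | (h | ⟨i, rfl⟩)) | (⟨i, rfl⟩ | ⟨i, rfl⟩))
      · exact (hy.1 (.inl h)).imp_right fun h => ⟨_, h.symm⟩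
      · exact .inr ⟨_, rfl⟩
      · exact (hy.1 (.inr h)).imp_right fun h => ⟨_, h.symm⟩
      all_goals exact .inr ⟨_, rfl⟩
    · rintro (h | ⟨⟨⟩ | (i | i) | (i | i), rfl⟩)
      · exact .inl ((hy.2 (.inl h)).imp .inl .inl)
      · exact .inl (((this _).2 (.inr rfl)).imp .inl .inl)
      · exact .inl (.inl (.inr ⟨_, rfl⟩))
      · exact .inr (.inl ⟨_, rfl⟩)
      · exact .inl (.inr (.inr ⟨_, rfl⟩))
      · exact .inr (.inr ⟨_, rfl⟩)

/-- The gadgets of `χ` together with the vertices `χ (.inl τ)` can be tiled. -/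
theorem til_gadgets {χ : AbsIdx s → V} (hinj : Function.Injective χ)
    (h : ∀ τ, Til G s (insert (χ (.inl τ)) (univ.image fun k => χ (.inr (τ, k))) ∩ A)
      (insert (χ (.inl τ)) (univ.image fun k => χ (.inr (τ, k))) ∩ B)) :
    Til G s (univ.image χ ∩ A) (univ.image χ ∩ B) := by
  have hU : univ.image χ = univ.biUnion fun τ => insert (χ (.inl τ))
      (univ.image fun k => χ (.inr (τ, k))) := by
    ext y
    simp only [mem_image, mem_univ, true_and, mem_biUnion, mem_insert]
    constructor
    · rintro ⟨τ | ⟨τ, k⟩, rfl⟩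
      · exact ⟨τ, .inl rfl⟩
      · exact ⟨τ, .inr ⟨k, rfl⟩⟩
    · rintro ⟨τ, rfl | ⟨k, rfl⟩⟩
      · exact ⟨_, rfl⟩
      · exact ⟨_, rfl⟩
  have hd : ∀ τ τ', τ ≠ τ' → Disjoint (insert (χ (.inl τ)) (univ.image fun k => χ (.inr (τ, k))))
      (insert (χ (.inl τ')) (univ.image fun k => χ (.inr (τ', k)))) := by
    intro τ τ' hne
    rw [disjoint_left]
    simp only [mem_image, mem_univ, true_and, mem_insert, not_or, not_exists]
    rintro _ (rfl | ⟨k, rfl⟩)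
    · exact ⟨fun h => hne (by simpa using hinj h), fun k h => by simpa using hinj h⟩
    · refine ⟨fun h => by simpa using hinj h, fun k h => hne ?_⟩
      have := hinj h
      simp only [Sum.inr.injEq, Prod.mk.injEq] at this
      exact this.1.symm
  rw [hU, biUnion_inter, biUnion_inter]
  exact Til.biUnion _ _ _ (fun τ _ => h τ)
    (fun τ _ τ' _ hne => (hd τ τ' hne).mono inter_subset_left inter_subset_left)
    (fun τ _ τ' _ hne => (hd τ τ' hne).mono inter_subset_left inter_subset_left)

variable {z : Fin s ⊕ Fin s → V} {φ : AbsIdx s → V}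

theorem Absorbs.til_idle (hs : 2 ≤ s) (hAB : Disjoint A B) (h : Absorbs G s A B z φ)
    (hinj : Function.Injective φ) : Til G s (univ.image φ ∩ A) (univ.image φ ∩ B) := by
  refine til_gadgets hinj ?_
  have hi : ∀ τ, Function.Injective fun k => φ (.inr (τ, k)) := fun τ =>
    hinj.comp (Sum.inr_injective.comp (Prod.mk_right_injective τ))
  rintro (i | i)
  · obtain ⟨h1, h2, h3⟩ := h.2.1 i
    exact til_gadget hs hAB (hi _) (h.1 i ⟨0, by omega⟩).1 h1
      (fun k h => by simpa using hinj h) h2 h3 (.inr ⟨rfl, rfl⟩) inter_subset_right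
      inter_subset_left
  · obtain ⟨h1, h2, h3⟩ := h.2.2 i
    exact (til_gadget hs hAB.symm (hi _) (h.1 ⟨0, by omega⟩ i).2.1 h1
      (fun k h => by simpa using hinj h) h2 h3 (.inr ⟨rfl, rfl⟩) inter_subset_right
      inter_subset_left).symm

theorem Absorbs.til_active (hs : 2 ≤ s) (hAB : Disjoint A B) (h : Absorbs G s A B z φ)
    (hinj : Function.Injective φ) (hz : Function.Injective z) (hzφ : ∀ i k, z i ≠ φ k)
    (hA : ∀ i, z (.inl i) ∈ A) (hB : ∀ i, z (.inr i) ∈ B) :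
    Til G s ((univ.image φ ∪ univ.image z) ∩ A) ((univ.image φ ∪ univ.image z) ∩ B) := by
  set χ : AbsIdx s → V := Sum.elim z fun k => φ (.inr k) with hχ
  have hχi : Function.Injective χ :=
    hz.sumElim (hinj.comp Sum.inr_injective) fun i k => hzφ i _
  have hi : ∀ τ, Function.Injective fun k => φ (.inr (τ, k)) := fun τ =>
    hinj.comp (Sum.inr_injective.comp (Prod.mk_right_injective τ))
  have t1 : Til G s (univ.image χ ∩ A) (univ.image χ ∩ B) := by
    refine til_gadgets hχi ?_
    rintro (i | i)
    · obtain ⟨h1, h2, h3⟩ := h.2.1 i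
      exact til_gadget hs hAB (hi _) (hA i) h1 (fun k => hzφ _ _) h2 h3 (.inl ⟨rfl, rfl⟩)
        inter_subset_left inter_subset_right
    · obtain ⟨h1, h2, h3⟩ := h.2.2 i
      exact (til_gadget hs hAB.symm (hi _) (hB i) h1 (fun k => hzφ _ _) h2 h3 (.inl ⟨rfl, rfl⟩)
        inter_subset_left inter_subset_right).symm
  have hPA : (univ.image fun i => φ (.inl (.inl i))) ⊆ A :=
    image_subset_iff.2 fun i _ => (h.1 i ⟨0, by omega⟩).1
  have hPB : (univ.image fun i => φ (.inl (.inr i))) ⊆ B :=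
    image_subset_iff.2 fun i _ => (h.1 ⟨0, by omega⟩ i).2.1
  have t2 : Til G s (univ.image fun i => φ (.inl (.inl i)))
      (univ.image fun i => φ (.inl (.inr i))) := by
    refine Til.of_isKst ⟨hAB.mono hPA hPB, ?_, ?_, ?_⟩
    · rw [card_image_univ fun i j h => by simpa using hinj h, Fintype.card_fin]
    · rw [card_image_univ fun i j h => by simpa using hinj h, Fintype.card_fin]
    · simp only [mem_image, mem_univ, true_and]
      rintro _ ⟨i, rfl⟩ _ ⟨j, rfl⟩
      exact (h.1 i j).2.2
  have key : ∀ τ k, φ (.inl τ) ≠ χ k := by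
    rintro τ (k | k)
    · exact (hzφ _ _).symm
    · exact fun h => by simpa using hinj h
  refine (t2.union t1 ?_ ?_).inter_parts hAB (union_subset hPA inter_subset_right)
    (union_subset hPB inter_subset_right) ?_
  · refine disjoint_left.2 fun y hy hy' => ?_
    simp only [mem_inter, mem_image, mem_univ, true_and] at hy hy'
    obtain ⟨i, rfl⟩ := hy
    obtain ⟨⟨k, hk⟩, -⟩ := hy'
    exact key _ _ hk.symm
  · refine disjoint_left.2 fun y hy hy' => ?_
    simp only [mem_inter, mem_image, mem_univ, true_and] at hy hy'
    obtain ⟨i, rfl⟩ := hy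
    obtain ⟨⟨k, hk⟩, -⟩ := hy'
    exact key _ _ hk.symm
  · have hχAB : univ.image χ ⊆ A ∪ B := by
      refine image_subset_iff.2 ?_
      rintro ((i | i) | ⟨(i | i), (k | (k | k) | (k | k))⟩) -
      all_goals rw [mem_union]
      · exact .inl (hA i)
      · exact .inr (hB i)
      · exact .inl (h.2.1 i).1
      · exact .inl ((h.2.1 i).2.1 k ⟨0, by omega⟩).1
      · exact .inr (nb_subset (mem_inter.1 ((h.2.1 i).2.1 ⟨0, by omega⟩ k).2.1).1)
      · exact .inl ((h.2.1 i).2.2 k ⟨0, by omega⟩).1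
      · exact .inr (nb_subset (mem_inter.1 ((h.2.1 i).2.2 ⟨0, by omega⟩ k).2.1).1)
      · exact .inr (h.2.2 i).1
      · exact .inr ((h.2.2 i).2.1 k ⟨0, by omega⟩).1
      · exact .inl (nb_subset (mem_inter.1 ((h.2.2 i).2.1 ⟨0, by omega⟩ k).2.1).1)
      · exact .inr ((h.2.2 i).2.2 k ⟨0, by omega⟩).1
      · exact .inl (nb_subset (mem_inter.1 ((h.2.2 i).2.2 ⟨0, by omega⟩ k).2.1).1)
    rw [union_union_union_comm, ← inter_union_distrib_left, inter_eq_left.2 hχAB]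
    ext y
    simp only [mem_union, mem_image, mem_univ, true_and]
    constructor
    · rintro ((⟨i, rfl⟩ | ⟨i, rfl⟩) | ⟨τ | k, rfl⟩)
      · exact .inl ⟨_, rfl⟩
      · exact .inl ⟨_, rfl⟩
      · exact .inr ⟨τ, rfl⟩
      · exact .inl ⟨_, rfl⟩
    · rintro (⟨(i | i) | k, rfl⟩ | ⟨i, rfl⟩)
      · exact .inl (.inl ⟨i, rfl⟩)
      · exact .inl (.inr ⟨i, rfl⟩)
      · exact .inr ⟨.inr k, rfl⟩
      · exact .inr ⟨.inl i, rfl⟩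

end AbsorberTilings

section AlmostTiling

open BigOperators

variable {G : SimpleGraph V} {s n : ℕ} {α : ℝ} {A B X Y : Finset V}

/-- The deficiency version of Hall's theorem. -/
theorem exists_deficient_matching {ι κ : Type*} [DecidableEq ι] [DecidableEq κ] (𝒳 : Finset ι)
    (𝒴 : Finset κ) (R : ι → κ → Prop) (D : ℕ)
    (h : ∀ 𝒮 ⊆ 𝒳, 𝒮.card ≤ (𝒴.filter fun Y => ∃ X ∈ 𝒮, R X Y).card + D) :
    ∃ ℳ ⊆ 𝒳 ×ˢ 𝒴, (∀ p ∈ ℳ, R p.1 p.2) ∧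
      (∀ p ∈ ℳ, ∀ q ∈ ℳ, p ≠ q → p.1 ≠ q.1 ∧ p.2 ≠ q.2) ∧ 𝒳.card ≤ ℳ.card + D := by
  let t : 𝒳 → Finset (κ ⊕ Fin D) := fun X => (𝒴.filter (R X)).disjSum univ
  obtain ⟨f, f1, f2⟩ := (Finset.all_card_le_biUnion_card_iff_exists_injective t).1 fun 𝒮 => by
    rcases 𝒮.eq_empty_or_nonempty with rfl | ⟨X0, hX0⟩
    · simp
    have h1 := h (𝒮.map (Function.Embedding.subtype _)) fun X hX => by
      obtain ⟨Y, -, rfl⟩ := mem_map.1 hX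
      exact Y.2
    rw [card_map] at h1
    refine h1.trans (le_trans ?_ (card_le_card (?_ : (𝒴.filter fun Y =>
      ∃ X ∈ 𝒮.map (Function.Embedding.subtype _), R X Y).disjSum univ ⊆ 𝒮.biUnion t)))
    · simp [card_disjSum]
    · intro y hy
      rw [mem_biUnion]
      rcases y with y | y
      · rw [inl_mem_disjSum, mem_filter] at hy
        obtain ⟨hy, X, hX, hR⟩ := hy
        obtain ⟨X, hX', rfl⟩ := mem_map.1 hX
        exact ⟨X, hX', inl_mem_disjSum.2 (mem_filter.2 ⟨hy, hR⟩)⟩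
      · exact ⟨X0, hX0, inr_mem_disjSum.2 (mem_univ _)⟩
  let ℳ := (𝒳 ×ˢ 𝒴).filter fun p => ∃ h : p.1 ∈ 𝒳, f ⟨p.1, h⟩ = .inl p.2
  refine ⟨ℳ, filter_subset _ _, ?_, ?_, ?_⟩
  · intro p hp
    obtain ⟨-, hX, hf⟩ := mem_filter.1 hp
    have := f2 ⟨p.1, hX⟩
    rw [hf, inl_mem_disjSum, mem_filter] at this
    exact this.2
  · intro p hp q hq hne
    obtain ⟨-, hX, hf⟩ := mem_filter.1 hp
    obtain ⟨-, hX', hf'⟩ := mem_filter.1 hq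
    rw [Ne, Prod.ext_iff, not_and] at hne
    have e1 : p.1 ≠ q.1 := fun he => by
      simp only [he, hf', Sum.inl.injEq] at hf
      exact hne he hf.symm
    refine ⟨e1, fun he => e1 ?_⟩
    have := f1 (hf.trans (he ▸ hf'.symm))
    simpa using this
  · have h1 : univ.image f ⊆ (ℳ.image Prod.snd).disjSum univ := by
      refine image_subset_iff.2 fun X _ => ?_
      have h2 := f2 X
      rcases hf : f X with Y | y
      · rw [hf, inl_mem_disjSum, mem_filter] at h2
        exact inl_mem_disjSum.2 (mem_image.2
          ⟨(X, Y), mem_filter.2 ⟨mem_product.2 ⟨X.2, h2.1⟩, X.2, hf⟩, rfl⟩)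
      · exact inr_mem_disjSum.2 (mem_univ _)
    have h2 := card_le_card h1
    rw [card_image_of_injective _ f1, card_univ, Fintype.card_coe, card_disjSum, card_univ,
      Fintype.card_fin] at h2
    exact h2.trans (Nat.add_le_add_right card_image_le _)

/-- Two sets that are slightly smaller than the parts of a robust graph span many edges. -/
theorem Robust.le_eAB (h : Robust G n α A B) (hα : 0 < α) {τ : ℝ} (hτ1 : τ ≤ 1)
    (hX : X ⊆ A) (hY : Y ⊆ B) (hXτ : τ * n ≤ X.card) (hYτ : τ * n ≤ Y.card)
    (hXY : (1 - α / 2) * n ≤ X.card + Y.card) : τ * α / 2 * n ^ 2 ≤ eAB G X Y := by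
  have small : ∀ {A B X Y : Finset V}, Robust G n α A B → X ⊆ A → Y ⊆ B → τ * n ≤ X.card →
      (1 - α / 2) * n ≤ X.card + Y.card → X.card < (1 / 2 - α) * n →
      τ * α / 2 * n ^ 2 ≤ eAB G X Y := by
    intro A B X Y h hX hY hXτ hXY hlt
    have h1 : ∀ x ∈ X, α / 2 * n ≤ degS G x Y := fun x hx => by
      have e1 : (n : ℝ) ≤ 2 * degS G x B := by exact_mod_cast h.degA x (hX hx)
      have e2 : (degS G x B : ℝ) ≤ degS G x Y + (B \ Y).card := by
        rw [← degS_sdiff hY, add_comm]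
        exact_mod_cast Nat.add_le_add_left degS_le_card _
      have e3 : ((B \ Y).card : ℝ) + Y.card = n := by
        rw [← h.cardB]
        exact_mod_cast card_sdiff_add_card_eq_card hY
      linarith
    have h2 : X.card * (α / 2 * n) ≤ (eAB G X Y : ℝ) := by
      unfold eAB
      push_cast
      rw [← nsmul_eq_mul]
      exact card_nsmul_le_sum _ _ _ h1
    nlinarith [mul_le_mul_of_nonneg_right hXτ (show 0 ≤ α / 2 * n by positivity)]
  by_cases h1 : X.card < (1 / 2 - α) * n
  · exact small h hX hY hXτ hXY h1
  by_cases h2 : Y.card < (1 / 2 - α) * n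
  · rw [eAB_comm]
    exact small h.symm hY hX hYτ (by linarith) h2
  · refine le_trans ?_ (h.dense X hX Y hY (not_lt.1 h1) (not_lt.1 h2))
    nlinarith [mul_nonneg (sub_nonneg.2 hτ1) (mul_nonneg hα.le (sq_nonneg (n : ℝ))),
      mul_nonneg hα.le (sq_nonneg (n : ℝ))]

/-- If all large balanced subpairs of `(X, Y)` contain `K_{s,s}`, then `(X, Y)` can be almost
tiled. -/
theorem exists_til_of_forall_exists_isKst (s : ℕ) (hs : 0 < s) (X Y : Finset V) (t : ℝ)
    (hXY : X.card = Y.card) (h : ∀ X' ⊆ X, ∀ Y' ⊆ Y, X'.card = Y'.card → t ≤ X'.card →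
      ∃ S ⊆ X', ∃ T ⊆ Y', IsKst G s s S T) :
    ∃ X' ⊆ X, ∃ Y' ⊆ Y, Til G s X' Y' ∧ X.card ≤ X'.card + t := by
  induction hc : X.card using Nat.strong_induction_on generalizing X Y with
  | _ c ih =>
    by_cases ht : t ≤ X.card
    · obtain ⟨S, hS, T, hT, hk⟩ := h X subset_rfl Y subset_rfl hXY ht
      have c1 := card_sdiff_add_card_eq_card hS
      have c2 := card_sdiff_add_card_eq_card hT
      have c3 := hk.2.1
      have c4 := hk.2.2.1
      obtain ⟨X', hX', Y', hY', h1, h2⟩ := ih (X \ S).card (by omega) (X \ S) (Y \ T) (by omega)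
        (fun X' hX' Y' hY' => h X' (hX'.trans sdiff_subset) Y' (hY'.trans sdiff_subset)) rfl
      have d1 : Disjoint S X' := (disjoint_sdiff).mono_right hX'
      have d2 : Disjoint T Y' := (disjoint_sdiff).mono_right hY'
      refine ⟨S ∪ X', union_subset hS (hX'.trans sdiff_subset), T ∪ Y',
        union_subset hT (hY'.trans sdiff_subset), .add hk d1 d2 h1, ?_⟩
      rw [card_union_of_disjoint d1, ← hc, ← c1]
      push_cast
      linarith
    · refine ⟨∅, empty_subset _, ∅, empty_subset _, .empty, ?_⟩
      rw [← hc]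
      simpa using (not_le.1 ht).le

end AlmostTiling

section Chunks

open BigOperators

/-- `𝒳` is a family of disjoint `l`-subsets of `A` that covers all but `ρ` vertices. -/
structure IsChunks (A : Finset V) (l : ℕ) (ρ : ℝ) (𝒳 : Finset (Finset V)) : Prop where
  subset : ∀ X ∈ 𝒳, X ⊆ A
  card : ∀ X ∈ 𝒳, X.card = l
  disj : ∀ X ∈ 𝒳, ∀ Y ∈ 𝒳, X ≠ Y → Disjoint X Y
  cover : A.card ≤ l * 𝒳.card + ρ

theorem IsChunks.mono {A : Finset V} {l : ℕ} {ρ ρ' : ℝ} {𝒳 : Finset (Finset V)}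
    (h : IsChunks A l ρ 𝒳) (hρ : ρ ≤ ρ') : IsChunks A l ρ' 𝒳 :=
  ⟨h.1, h.2, h.3, h.4.trans (by linarith)⟩

theorem IsChunks.card_biUnion {A : Finset V} {l : ℕ} {ρ : ℝ} {𝒳 𝒮 : Finset (Finset V)}
    (h : IsChunks A l ρ 𝒳) (h𝒮 : 𝒮 ⊆ 𝒳) : (𝒮.biUnion id).card = l * 𝒮.card := by
  refine (Finset.card_biUnion fun X hX Y hY => h.disj X (h𝒮 hX) Y (h𝒮 hY)).trans ?_
  rw [sum_congr rfl fun X hX => h.card X (h𝒮 hX), sum_const, smul_eq_mul,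
    mul_comm]

theorem exists_isChunks [Fintype V] (P : Finpartition (univ : Finset V)) (A : Finset V) {l : ℕ}
    (hl : 0 < l) : ∃ 𝒳, IsChunks A l (l * P.parts.card) 𝒳 ∧ ∀ X ∈ 𝒳, ∃ U ∈ P.parts, X ⊆ U := by
  have hb := fun U : Finset V =>
    exists_blocks (U ∩ A) l ((U ∩ A).card / l) (Nat.div_mul_le_self _ _)
  choose f f1 f2 using hb
  let I : Finset (Σ _ : Finset V, ℕ) := P.parts.sigma fun U => range ((U ∩ A).card / l)
  have hI : ∀ p ∈ I, p.1 ∈ P.parts ∧ f p.1 p.2 ⊆ p.1 ∩ A ∧ (f p.1 p.2).card = l := by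
    intro p hp
    rw [mem_sigma, mem_range] at hp
    exact ⟨hp.1, f1 p.1 p.2 hp.2⟩
  have hd : ∀ p ∈ I, ∀ q ∈ I, p ≠ q → Disjoint (f p.1 p.2) (f q.1 q.2) := by
    rintro ⟨U, i⟩ hp ⟨U', j⟩ hq hne
    by_cases hU : U = U'
    · subst hU
      rw [mem_sigma, mem_range] at hp hq
      exact f2 U i hp.2 j hq.2 fun h => hne (by rw [h])
    · have := P.disjoint (hI _ hp).1 (hI _ hq).1 hU
      exact this.mono ((hI _ hp).2.1.trans inter_subset_left)
        ((hI _ hq).2.1.trans inter_subset_left)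
  have hinj : Set.InjOn (fun p : Σ _ : Finset V, ℕ => f p.1 p.2) I := by
    intro p hp q hq he
    by_contra hne
    have := hd p hp q hq hne
    simp only at he
    rw [← he, disjoint_self, bot_eq_empty] at this
    have h1 := (hI p hp).2.2
    rw [this, card_empty] at h1
    omega
  refine ⟨I.image fun p => f p.1 p.2, ⟨?_, ?_, ?_, ?_⟩, ?_⟩
  · intro X hX
    obtain ⟨p, hp, rfl⟩ := mem_image.1 hX
    exact (hI p hp).2.1.trans inter_subset_right
  · intro X hX
    obtain ⟨p, hp, rfl⟩ := mem_image.1 hX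
    exact (hI p hp).2.2
  · intro X hX Y hY hne
    obtain ⟨p, hp, rfl⟩ := mem_image.1 hX
    obtain ⟨q, hq, rfl⟩ := mem_image.1 hY
    exact hd p hp q hq (by rintro rfl; exact hne rfl)
  · rw [card_image_of_injOn hinj, card_sigma]
    have h1 : A.card ≤ ∑ U ∈ P.parts, (U ∩ A).card := by
      refine (card_le_card fun x hx => ?_).trans card_biUnion_le
      obtain ⟨U, hU, hxU⟩ := P.exists_mem (mem_univ x)
      exact mem_biUnion.2 ⟨U, hU, mem_inter.2 ⟨hxU, hx⟩⟩
    have h2 : ∑ U ∈ P.parts, (U ∩ A).card ≤ ∑ U ∈ P.parts, (l * ((U ∩ A).card / l) + l) :=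
      sum_le_sum fun U _ => by
        have := Nat.div_add_mod (U ∩ A).card l
        have := Nat.mod_lt (U ∩ A).card hl
        omega
    rw [sum_add_distrib, ← mul_sum, sum_const, smul_eq_mul] at h2
    simp only [card_range]
    have h3 := h1.trans h2
    rw [mul_comm P.parts.card] at h3
    exact_mod_cast h3
  · intro X hX
    obtain ⟨p, hp, rfl⟩ := mem_image.1 hX
    exact ⟨p.1, (hI p hp).1, (hI p hp).2.1.trans inter_subset_left⟩

theorem eAB_eq_card_interedges (G : SimpleGraph V) (X Y : Finset V) :
    eAB G X Y = (G.interedges X Y).card := by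
  unfold eAB degS
  rw [SimpleGraph.interedges_def, card_filter, sum_product]
  exact sum_congr rfl fun x _ => card_filter _ _

/-- The pairs of sets that lie in distinct parts of `P` which form a regular pair that is not
sparse. -/
def GoodPair (G : SimpleGraph V) [Fintype V] (P : Finpartition (univ : Finset V)) (ε : ℝ)
    (X Y : Finset V) : Prop :=
  ∃ U ∈ P.parts, ∃ W ∈ P.parts, X ⊆ U ∧ Y ⊆ W ∧ U ≠ W ∧ G.IsUniform (ε / 8) U W ∧
    ε / 4 ≤ G.edgeDensity U W

theorem GoodPair.le_eAB {G : SimpleGraph V} [Fintype V] {P : Finpartition (univ : Finset V)}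
    {ε : ℝ} {X Y X' Y' : Finset V} (h : GoodPair G P ε X Y) (hX : X' ⊆ X) (hY : Y' ⊆ Y)
    (hP : ∀ U ∈ P.parts, U.card * (ε / 8) ≤ X'.card ∧ U.card * (ε / 8) ≤ Y'.card) :
    ε / 8 * (X'.card * Y'.card) ≤ eAB G X' Y' := by
  obtain ⟨U, hU, W, hW, h1, h2, -, h3, h4⟩ := h
  have h5 := abs_lt.1 (h3 (hX.trans h1) (hY.trans h2) (hP U hU).1 (hP W hW).2)
  have h6 : ε / 8 ≤ G.edgeDensity X' Y' := by linarith
  rw [SimpleGraph.edgeDensity_def] at h6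
  push_cast at h6
  rw [eAB_eq_card_interedges]
  rcases (show (0 : ℝ) ≤ X'.card * Y'.card by positivity).eq_or_lt with h0 | h0
  · rw [← h0, mul_zero]
    positivity
  · rwa [le_div_iff₀ h0] at h6

theorem eAB_biUnion_le {G : SimpleGraph V} [Fintype V] [Nonempty V]
    {P : Finpartition (univ : Finset V)} {ε : ℝ} (hε : 0 < ε) (hP : P.IsEquipartition)
    (hu : P.IsUniform G (ε / 8)) (hc : 4 / ε ≤ P.parts.card) {𝒮 𝒯 : Finset (Finset V)}
    (hd : Disjoint (𝒮.biUnion id) (𝒯.biUnion id))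
    (h𝒮 : ∀ X ∈ 𝒮, ∃ U ∈ P.parts, X ⊆ U) (h𝒯 : ∀ Y ∈ 𝒯, ∃ U ∈ P.parts, Y ⊆ U)
    (h : ∀ X ∈ 𝒮, ∀ Y ∈ 𝒯, ¬ GoodPair G P ε X Y) :
    eAB G (𝒮.biUnion id) (𝒯.biUnion id) ≤ ε * (Fintype.card V) ^ 2 := by
  have h1 := SimpleGraph.regularityReduced_edges_card_aux (G := G) hε hP hu hc
  set G' := G.regularityReduced P (ε / 8) (ε / 4) with hG'
  have h2 : G'.edgeFinset ⊆ G.edgeFinset :=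
    SimpleGraph.edgeFinset_mono SimpleGraph.regularityReduced_le
  have h3 : eAB G (𝒮.biUnion id) (𝒯.biUnion id) ≤ (G.edgeFinset \ G'.edgeFinset).card := by
    rw [eAB_eq_card_interedges]
    refine card_le_card_of_injOn (fun p => s(p.1, p.2)) ?_ ?_
    · intro p hp
      obtain ⟨p1, p2, p3⟩ := (SimpleGraph.mem_interedges_iff G).1 hp
      simp only [coe_sdiff, Set.mem_sdiff, mem_coe, SimpleGraph.mem_edgeFinset,
        SimpleGraph.mem_edgeSet]
      refine ⟨p3, ?_⟩
      rintro ⟨-, U, hU, W, hW, hpU, hpW, e1, e2, e3⟩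
      obtain ⟨X, hX, hpX⟩ := mem_biUnion.1 p1
      obtain ⟨Y, hY, hpY⟩ := mem_biUnion.1 p2
      obtain ⟨U', hU', hXU⟩ := h𝒮 X hX
      obtain ⟨W', hW', hYW⟩ := h𝒯 Y hY
      obtain rfl := P.disjoint.elim_finset hU hU' _ hpU (hXU hpX)
      obtain rfl := P.disjoint.elim_finset hW hW' _ hpW (hYW hpY)
      exact h X hX Y hY ⟨U, hU, W, hW, hXU, hYW, e1, e2, e3⟩
    · intro p hp q hq he
      obtain ⟨p1, p2, p3⟩ := (SimpleGraph.mem_interedges_iff G).1 hp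
      obtain ⟨q1, q2, q3⟩ := (SimpleGraph.mem_interedges_iff G).1 hq
      simp only [Sym2.eq_iff] at he
      rcases he with ⟨h, h'⟩ | ⟨h, h'⟩
      · exact Prod.ext h h'
      · exact (disjoint_left.1 hd p1 (h ▸ q2)).elim
  have h4 : ((G.edgeFinset \ G'.edgeFinset).card : ℝ) = G.edgeFinset.card - G'.edgeFinset.card := by
    rw [cast_card_sdiff h2]
  have h5 : (eAB G (𝒮.biUnion id) (𝒯.biUnion id) : ℝ) ≤ (G.edgeFinset \ G'.edgeFinset).card := by
    exact_mod_cast h3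
  rw [h4] at h5
  push_cast at h1
  have h6 : (eAB G (𝒮.biUnion id) (𝒯.biUnion id) : ℝ) ≤ ε * (Fintype.card V) ^ 2 := by linarith
  exact h6

/-- A consequence of the regularity lemma. -/
theorem exists_chunks {σ : ℝ} (hσ : 0 < σ) (hσ1 : σ ≤ 1) : ∃ c > (0 : ℝ), ∃ δ > (0 : ℝ), ∃ n0 : ℕ,
    ∀ (V : Type*) [Fintype V] [DecidableEq V] (G : SimpleGraph V) (A B : Finset V),
      n0 ≤ Fintype.card V → Disjoint A B →
      ∃ (l : ℕ) (𝒳 𝒴 : Finset (Finset V)) (R : Finset V → Finset V → Prop),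
        c * Fintype.card V ≤ l ∧ l ≤ σ * Fintype.card V ∧
        IsChunks A l (σ * Fintype.card V) 𝒳 ∧ IsChunks B l (σ * Fintype.card V) 𝒴 ∧
        (∀ X Y, R X Y → ∀ X' ⊆ X, ∀ Y' ⊆ Y, σ * l ≤ X'.card → σ * l ≤ Y'.card →
          δ * (X'.card * Y'.card) ≤ eAB G X' Y') ∧
        ∀ 𝒮 ⊆ 𝒳, ∀ 𝒯 ⊆ 𝒴, (∀ X ∈ 𝒮, ∀ Y ∈ 𝒯, ¬ R X Y) →
          eAB G (𝒮.biUnion id) (𝒯.biUnion id) ≤ σ * (Fintype.card V) ^ 2 := by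
  have hε : 0 < σ ^ 2 := by positivity
  set M := SzemerediRegularity.bound (σ ^ 2 / 8) ⌈4 / σ ^ 2⌉₊ with hM
  have hM0 : (0 : ℝ) < M := by exact_mod_cast SzemerediRegularity.bound_pos _ _
  refine ⟨σ / (2 * M), by positivity, σ ^ 2 / 8, by positivity, max ⌈4 / σ ^ 2⌉₊ (max 1 ⌈M / σ⌉₊),
    fun V _ _ G A B hN hAB => ?_⟩
  have hN1 : ⌈4 / σ ^ 2⌉₊ ≤ Fintype.card V := (le_max_left _ _).trans hN
  have hN2 : 1 ≤ Fintype.card V := (le_max_left _ _).trans ((le_max_right _ _).trans hN)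
  have hN3 : M / σ ≤ Fintype.card V :=
    Nat.ceil_le.1 ((le_max_right _ _).trans ((le_max_right _ _).trans hN))
  have : Nonempty V := Fintype.card_pos_iff.1 hN2
  obtain ⟨P, hP1, hP2, hP3, hP4⟩ := szemeredi_regularity G (by positivity : 0 < σ ^ 2 / 8) hN1
  rw [← hM] at hP3
  set N : ℝ := (Fintype.card V : ℝ) with hNdef
  have hN0 : 0 < N := by rw [hNdef]; exact_mod_cast hN2
  set r := P.parts.card with hr
  have hr0 : 0 < r := P.parts_nonempty univ_nonempty.ne_empty |>.card_pos
  have hr0' : (0 : ℝ) < r := by exact_mod_cast hr0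
  have hrM : (r : ℝ) ≤ M := by exact_mod_cast hP3
  have hr4 : 4 / σ ^ 2 ≤ r := (Nat.le_ceil _).trans (by exact_mod_cast hP2)
  have hx1 : 1 ≤ σ * N / r := by
    rw [div_le_iff₀ hσ] at hN3
    rw [le_div_iff₀ hr0']
    linarith
  set l := ⌊σ * N / r⌋₊ with hl
  have hl1 : 0 < l := Nat.floor_pos.2 hx1
  have hl1' : (1 : ℝ) ≤ l := by exact_mod_cast hl1
  have hl2 : (l : ℝ) ≤ σ * N / r := Nat.floor_le (by positivity)
  have hl3 : σ * N / r < l + 1 := Nat.lt_floor_add_one _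
  have hlr : (l : ℝ) * r ≤ σ * N := (le_div_iff₀ hr0').1 hl2
  have hl4 : σ * N ≤ 2 * l * r := by
    rw [div_lt_iff₀ hr0'] at hl3
    nlinarith
  obtain ⟨𝒳, hX1, hX2⟩ := exists_isChunks P A hl1
  obtain ⟨𝒴, hY1, hY2⟩ := exists_isChunks P B hl1
  have hpart : ∀ U ∈ P.parts, (U.card : ℝ) * (σ ^ 2 / 8) ≤ σ * l := by
    intro U hU
    have h1 := hP1.card_part_le_average_add_one hU
    have h2 : U.card * r ≤ 2 * Fintype.card V := by
      have h3 := Nat.div_mul_le_self (Fintype.card V) r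
      have h4 : r ≤ Fintype.card V := P.card_parts_le_card
      have h5 := Nat.mul_le_mul_right r h1
      rw [card_univ, ← hr, add_mul, one_mul] at h5
      omega
    have h3 : (U.card : ℝ) * r ≤ 2 * N := by rw [hNdef]; exact_mod_cast h2
    refine le_of_mul_le_mul_right ?_ hr0'
    nlinarith [mul_le_mul_of_nonneg_left h3 hε.le, mul_le_mul_of_nonneg_left hl4 hσ.le,
      mul_pos hε hN0]
  refine ⟨l, 𝒳, 𝒴, GoodPair G P (σ ^ 2), ?_, ?_, hX1.mono hlr, hY1.mono hlr, ?_, ?_⟩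
  · rw [div_mul_eq_mul_div, div_le_iff₀ (by positivity)]
    nlinarith
  · have : (1 : ℝ) ≤ r := by exact_mod_cast hr0
    nlinarith
  · intro X Y hR X' hX' Y' hY' h1 h2
    exact hR.le_eAB hX' hY' fun U hU => ⟨(hpart U hU).trans h1, (hpart U hU).trans h2⟩
  · intro 𝒮 h𝒮 𝒯 h𝒯 h
    refine (eAB_biUnion_le hε hP1 hP4 hr4 ?_ (fun X hX => hX2 X (h𝒮 hX))
      (fun X hX => hY2 X (h𝒯 hX)) h).trans ?_
    · exact hAB.mono (biUnion_subset.2 fun X hX => hX1.subset X (h𝒮 hX))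
        (biUnion_subset.2 fun X hX => hY1.subset X (h𝒯 hX))
    · have : σ ^ 2 ≤ σ := by nlinarith
      exact mul_le_mul_of_nonneg_right this (by positivity)

end Chunks

section AlmostTilingRobust

open BigOperators

theorem Robust.exists_matching {G : SimpleGraph V} {n l D : ℕ} {α σ κ : ℝ} {A B A' B' : Finset V}
    (h : Robust G n α A B) (hn : 0 < n) (hα : 0 < α) (hσ : 0 < σ) (hσ1 : σ ≤ 1)
    (hα1 : α ≤ 1) (hκ : κ = σ * α / 128) (hA : A' ⊆ A) (hB : B' ⊆ B) (hAB : A'.card = B'.card)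
    (hAc : (1 - α / 8) * n ≤ A'.card) {𝒳 𝒴 : Finset (Finset V)} {R : Finset V → Finset V → Prop}
    (hX : IsChunks A' l (2 * κ * n) 𝒳) (hY : IsChunks B' l (2 * κ * n) 𝒴)
    (hR : ∀ 𝒮 ⊆ 𝒳, ∀ 𝒯 ⊆ 𝒴, (∀ X ∈ 𝒮, ∀ Y ∈ 𝒯, ¬ R X Y) →
      eAB G (𝒮.biUnion id) (𝒯.biUnion id) ≤ 4 * κ * n ^ 2) (hD : σ / 4 * n ≤ l * D) :
    ∃ ℳ ⊆ 𝒳 ×ˢ 𝒴, (∀ p ∈ ℳ, R p.1 p.2) ∧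
      (∀ p ∈ ℳ, ∀ q ∈ ℳ, p ≠ q → p.1 ≠ q.1 ∧ p.2 ≠ q.2) ∧ 𝒳.card ≤ ℳ.card + D := by
  refine exists_deficient_matching 𝒳 𝒴 R D fun 𝒮 h𝒮 => ?_
  by_contra! hcon
  have hn' : (0 : ℝ) < n := by exact_mod_cast hn
  have hσα : 0 < σ * α := by positivity
  have hκσ : 128 * κ ≤ σ := by nlinarith
  have hκα : 128 * κ ≤ α := by nlinarith
  set 𝒩 := 𝒴.filter fun Y => ∃ X ∈ 𝒮, R X Y with h𝒩
  have h1 := hR 𝒮 h𝒮 (𝒴 \ 𝒩) sdiff_subset fun X hX Y hY hR => by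
    rw [mem_sdiff, h𝒩, mem_filter, not_and] at hY
    exact hY.2 hY.1 ⟨X, hX, hR⟩
  have cS : ((𝒮.biUnion id).card : ℝ) = l * 𝒮.card := by exact_mod_cast hX.card_biUnion h𝒮
  have cX : (l : ℝ) * 𝒳.card ≤ A'.card := by
    rw [← Nat.cast_mul, ← hX.card_biUnion subset_rfl]
    exact_mod_cast card_le_card (biUnion_subset.2 fun X h => hX.subset X h)
  have cSX : (l : ℝ) * 𝒮.card ≤ l * 𝒳.card := by
    exact_mod_cast Nat.mul_le_mul_left l (card_le_card h𝒮)
  have cT : (((𝒴 \ 𝒩).biUnion id).card : ℝ) + l * 𝒩.card = l * 𝒴.card := by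
    have := card_sdiff_add_card_eq_card (filter_subset _ _ : 𝒩 ⊆ 𝒴)
    rw [hY.card_biUnion sdiff_subset, ← this]
    push_cast
    ring
  have hc : (l : ℝ) * 𝒩.card + l * D ≤ l * 𝒮.card := by
    exact_mod_cast (by rw [← mul_add]; exact Nat.mul_le_mul_left l hcon.le :
      l * 𝒩.card + l * D ≤ l * 𝒮.card)
  have hYc := hY.cover
  have hAB' : (A'.card : ℝ) = B'.card := by exact_mod_cast hAB
  have e1 : κ * n * 128 ≤ σ * n := by nlinarith
  have e2 : κ * n * 128 ≤ α * n := by nlinarith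
  have e0 : 0 < κ * n := by rw [hκ]; positivity
  have h2 := h.le_eAB hα (τ := σ / 8) (by linarith)
    ((biUnion_subset.2 fun X h => hX.subset X (h𝒮 h) : 𝒮.biUnion id ⊆ A').trans hA)
    ((biUnion_subset.2 fun Y h => hY.subset Y (sdiff_subset h) : (𝒴 \ 𝒩).biUnion id ⊆ B').trans hB)
    (by
      rw [cS]
      linarith [mul_nonneg (Nat.cast_nonneg (α := ℝ) l) (Nat.cast_nonneg (α := ℝ) 𝒩.card)])
    (by linarith)
    (by linarith)
  have h3 := h2.trans h1
  rw [hκ] at h3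
  nlinarith [mul_pos hσα (pow_pos hn' 2)]

theorem Robust.exists_almost_til {s : ℕ} (hs : 0 < s) {α σ : ℝ} (hα : 0 < α) (hα1 : α ≤ 1)
    (hσ : 0 < σ) (hσ1 : σ ≤ 1) : ∃ n0 : ℕ, ∀ (V : Type*) [Fintype V] [DecidableEq V]
      (G : SimpleGraph V) (A B A' B' : Finset V) (n : ℕ), n0 ≤ n → Fintype.card V = 2 * n →
      Robust G n α A B → A' ⊆ A → B' ⊆ B → A'.card = B'.card → (1 - α / 8) * n ≤ A'.card →
      ∃ X ⊆ A', ∃ Y ⊆ B', Til G s X Y ∧ A'.card ≤ X.card + σ * n := by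
  set κ := σ * α / 128 with hκ
  have hσα : 0 < σ * α := by positivity
  have hκ0 : 0 < κ := by positivity
  have hκσ : 128 * κ ≤ σ := by nlinarith
  obtain ⟨c, hc, δ, hδ, n1, H1⟩ := exists_chunks hκ0 (by linarith)
  obtain ⟨n2, H2⟩ := exists_isKst s (show 0 < δ * (κ * c) ^ 2 by positivity)
  refine ⟨max 1 (max n1 n2), fun V _ _ G A B A' B' n hn hV h hA hB hAB hAc => ?_⟩
  have hn0 : 1 ≤ n := (le_max_left _ _).trans hn
  have hn1 : n1 ≤ n := (le_max_left _ _).trans ((le_max_right _ _).trans hn)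
  have hn2 : n2 ≤ n := (le_max_right _ _).trans ((le_max_right _ _).trans hn)
  have hn' : (0 : ℝ) < n := by exact_mod_cast hn0
  have hABd : Disjoint A' B' := h.disj.mono hA hB
  obtain ⟨l, 𝒳, 𝒴, R, hl1, hl2, hX, hY, hR1, hR2⟩ := H1 V G A' B' (by omega) hABd
  have hV' : (Fintype.card V : ℝ) = 2 * n := by exact_mod_cast hV
  have hl0 : (0 : ℝ) < l := lt_of_lt_of_le (by rw [hV']; positivity) hl1
  rw [hV'] at hl2 hX hY hR2
  set D := ⌈σ * n / (4 * l)⌉₊ with hD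
  have hD1 : σ / 4 * n ≤ l * D := by
    have := Nat.le_ceil (σ * n / (4 * l))
    rw [← hD, div_le_iff₀ (by positivity)] at this
    linarith
  have hD2 : l * D ≤ σ / 4 * n + l := by
    have := (Nat.ceil_lt_add_one (show 0 ≤ σ * n / (4 * l) by positivity)).le
    rw [← hD] at this
    have h2 := mul_le_mul_of_nonneg_left this hl0.le
    have h3 : l * (σ * n / (4 * l) + 1) = σ / 4 * n + l := by
      field_simp
    linarith
  have hρ : κ * (2 * n) = 2 * κ * n := by ring
  rw [hρ] at hX hY
  obtain ⟨ℳ, m1, m2, m3, m4⟩ := h.exists_matching hn0 hα hσ hσ1 hα1 hκ hA hB hAB hAc hX hY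
    (fun 𝒮 h1 𝒯 h2 h3 => (hR2 𝒮 h1 𝒯 h2 h3).trans (le_of_eq (by ring))) hD1
  have hm : ∀ p ∈ ℳ, p.1 ∈ 𝒳 ∧ p.2 ∈ 𝒴 := fun p hp => mem_product.1 (m1 hp)
  have key : ∀ p : Finset V × Finset V, ∃ X' Y' : Finset V, p ∈ ℳ →
      X' ⊆ p.1 ∧ Y' ⊆ p.2 ∧ Til G s X' Y' ∧ (l : ℝ) ≤ X'.card + κ * l := by
    intro p
    by_cases hp : p ∈ ℳ
    · obtain ⟨p1, p2⟩ := hm p hp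
      obtain ⟨X', hX', Y', hY', t1, t2⟩ := exists_til_of_forall_exists_isKst (G := G) s hs p.1 p.2
        (κ * l) ((hX.card _ p1).trans (hY.card _ p2).symm) fun X' hX' Y' hY' hc' ht => by
          have hc'' : (X'.card : ℝ) = Y'.card := by exact_mod_cast hc'
          refine H2 V G X' Y' (by omega) (hABd.mono (hX'.trans (hX.subset _ p1))
            (hY'.trans (hY.subset _ p2))) (le_trans ?_ (hR1 _ _ (m2 p hp) X' hX' Y' hY' ht
              (hc'' ▸ ht)))
          rw [← hc'', mul_assoc]
          have h1 : κ * c * Fintype.card V ≤ X'.card := by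
            refine le_trans ?_ ht
            rw [mul_assoc]
            exact mul_le_mul_of_nonneg_left hl1 hκ0.le
          have h2 := mul_self_le_mul_self (by positivity) h1
          refine mul_le_mul_of_nonneg_left (le_trans (le_of_eq ?_) h2) hδ.le
          ring
      rw [hX.card _ p1] at t2
      exact ⟨X', Y', fun _ => ⟨hX', hY', t1, t2⟩⟩
    · exact ⟨∅, ∅, fun h => (hp h).elim⟩
  choose f g hfg using key
  have hfd : ∀ p ∈ ℳ, ∀ q ∈ ℳ, p ≠ q → Disjoint (f p) (f q) := fun p hp q hq hne =>
    (hX.disj _ (hm p hp).1 _ (hm q hq).1 (m3 p hp q hq hne).1).mono (hfg p hp).1 (hfg q hq).1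
  have hgd : ∀ p ∈ ℳ, ∀ q ∈ ℳ, p ≠ q → Disjoint (g p) (g q) := fun p hp q hq hne =>
    (hY.disj _ (hm p hp).2 _ (hm q hq).2 (m3 p hp q hq hne).2).mono (hfg p hp).2.1 (hfg q hq).2.1
  refine ⟨ℳ.biUnion f, biUnion_subset.2 fun p hp => (hfg p hp).1.trans (hX.subset _ (hm p hp).1),
    ℳ.biUnion g, biUnion_subset.2 fun p hp => (hfg p hp).2.1.trans (hY.subset _ (hm p hp).2),
    Til.biUnion ℳ f g (fun p hp => (hfg p hp).2.2.1) hfd hgd, ?_⟩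
  have e1 : (ℳ.card : ℝ) * l ≤ (ℳ.biUnion f).card + ℳ.card * (κ * l) := by
    rw [Finset.card_biUnion hfd]
    push_cast
    have := sum_le_sum fun p hp => (hfg p hp).2.2.2
    simpa [sum_add_distrib] using this
  have e2 : (ℳ.card : ℝ) * l ≤ n := by
    have h1 : ℳ.card ≤ 𝒳.card := by
      refine card_le_card_of_injOn Prod.fst (fun p hp => (hm p hp).1) fun p hp q hq he => ?_
      by_contra hne
      exact (m3 p hp q hq hne).1 he
    have h2 : l * 𝒳.card ≤ n := by
      rw [← hX.card_biUnion subset_rfl, ← h.cardA]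
      exact card_le_card ((biUnion_subset.2 fun X h => hX.subset X h).trans hA)
    have h3 := (Nat.mul_le_mul_left l h1).trans h2
    rw [mul_comm]
    exact_mod_cast h3
  have e3 : (l : ℝ) * 𝒳.card ≤ l * ℳ.card + l * D := by
    rw [← mul_add]
    exact mul_le_mul_of_nonneg_left (by exact_mod_cast m4) hl0.le
  have e4 := hX.cover
  have e5 := mul_le_mul_of_nonneg_left e2 hκ0.le
  nlinarith

end AlmostTilingRobust

section NonExtremal

theorem DisjFam.til {κ : Type*} [Fintype κ] {G : SimpleGraph V} {s q : ℕ} {A B : Finset V}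
    {F : Finset (κ → V)} (hF : DisjFam F)
    (hidle : ∀ φ ∈ F, Til G s (univ.image φ ∩ A) (univ.image φ ∩ B)) {p : Fin q → κ → V}
    (hp : Function.Injective p) (hpF : ∀ j, p j ∈ F) {u : Fin q → Finset V}
    (hu : ∀ i j, i ≠ j → Disjoint (u i) (u j))
    (huF : ∀ j, Disjoint (F.biUnion fun φ => univ.image φ) (u j))
    (hact : ∀ j, Til G s ((univ.image (p j) ∪ u j) ∩ A) ((univ.image (p j) ∪ u j) ∩ B)) :
    Til G s (((F.biUnion fun φ => univ.image φ) ∪ univ.biUnion u) ∩ A)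
      (((F.biUnion fun φ => univ.image φ) ∪ univ.biUnion u) ∩ B) := by
  let e : (κ → V) → Finset V := fun φ => (univ.filter fun j => p j = φ).biUnion u
  have he : ∀ φ v, v ∈ e φ ↔ ∃ j, p j = φ ∧ v ∈ u j := fun φ v => by simp [e]
  have hun : ((F.biUnion fun φ => univ.image φ) ∪ univ.biUnion u) =
      F.biUnion fun φ => univ.image φ ∪ e φ := by
    ext v
    simp only [mem_union, mem_biUnion, he, mem_univ, true_and]
    constructor
    · rintro (⟨φ, h, h'⟩ | ⟨j, h⟩)
      · exact ⟨φ, h, .inl h'⟩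
      · exact ⟨p j, hpF j, .inr ⟨j, rfl, h⟩⟩
    · rintro ⟨φ, h, h' | ⟨j, -, h'⟩⟩
      · exact .inl ⟨φ, h, h'⟩
      · exact .inr ⟨j, h'⟩
  have hdis : ∀ φ ∈ F, ∀ ψ ∈ F, φ ≠ ψ → Disjoint (univ.image φ ∪ e φ) (univ.image ψ ∪ e ψ) := by
    intro φ hφ ψ hψ hne
    have hW : ∀ χ ∈ F, ∀ v ∈ univ.image χ, ∀ j, v ∉ u j := fun χ hχ v hv j hj =>
      disjoint_left.1 (huF j) (mem_biUnion.2 ⟨χ, hχ, hv⟩) hj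
    rw [disjoint_left]
    intro v hv hv'
    rw [mem_union, he] at hv hv'
    rcases hv with hv | ⟨i, rfl, hi⟩ <;> rcases hv' with hv' | ⟨j, rfl, hj⟩
    · simp only [mem_image, mem_univ, true_and] at hv hv'
      obtain ⟨a, rfl⟩ := hv
      obtain ⟨b, hb⟩ := hv'
      exact hF.2 φ hφ ψ hψ hne a b hb.symm
    · exact hW φ hφ v hv j hj
    · exact hW ψ hψ v hv' i hi
    · exact disjoint_left.1 (hu i j fun h => hne (by rw [h])) hi hj
  rw [hun, biUnion_inter, biUnion_inter]
  refine Til.biUnion _ _ _ (fun φ hφ => ?_)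
    (fun φ hφ ψ hψ hne => (hdis φ hφ ψ hψ hne).mono inter_subset_left inter_subset_left)
    (fun φ hφ ψ hψ hne => (hdis φ hφ ψ hψ hne).mono inter_subset_left inter_subset_left)
  by_cases h : ∃ j, p j = φ
  · obtain ⟨j, rfl⟩ := h
    have : e (p j) = u j := by
      ext v
      rw [he]
      exact ⟨fun ⟨i, h, hv⟩ => hp h ▸ hv, fun hv => ⟨j, rfl, hv⟩⟩
    rw [this]
    exact hact j
  · have : e φ = ∅ := by
      ext v
      rw [he]
      simpa using fun i hi => (h ⟨i, hi⟩).elim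
    rw [this, union_empty]
    exact hidle φ hφ

/-- A balanced set with parts of size `s` can be listed injectively. -/
theorem exists_listing {s : ℕ} {f g : Finset V} (hf : f.card = s) (hg : g.card = s)
    (hd : Disjoint f g) : ∃ z : Fin s ⊕ Fin s → V, Function.Injective z ∧
      (∀ i, z (.inl i) ∈ f) ∧ (∀ i, z (.inr i) ∈ g) ∧ univ.image z = f ∪ g := by
  let ef := f.equivFinOfCardEq hf
  let eg := g.equivFinOfCardEq hg
  have hinj :
      Function.Injective (Sum.elim (fun i => (ef.symm i : V)) fun i => (eg.symm i : V)) := by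
    refine Function.Injective.sumElim (Subtype.val_injective.comp ef.symm.injective)
      (Subtype.val_injective.comp eg.symm.injective) fun i j h => ?_
    exact disjoint_left.1 hd (ef.symm i).2 (by rw [h]; exact (eg.symm j).2)
  refine ⟨_, hinj, fun i => (ef.symm i).2, fun i => (eg.symm i).2, eq_of_subset_of_card_le ?_ ?_⟩
  · rw [image_subset_iff]
    rintro (i | i) -
    · exact mem_union_left _ (ef.symm i).2
    · exact mem_union_right _ (eg.symm i).2
  · rw [card_union_of_disjoint hd, card_image_univ hinj, Fintype.card_sum, Fintype.card_fin, hf, hg]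

theorem sdiff_eq_union_inter {A B W X Q : Finset V} (hX : X ⊆ A \ W) (hQ : Q ⊆ B)
    (hd : Disjoint A B) : A \ X = (W ∪ (((A \ W) \ X) ∪ Q)) ∩ A := by
  ext v
  have h1 := @hX v
  have h2 : v ∈ Q → v ∉ A := fun h => disjoint_right.1 hd (hQ h)
  simp only [mem_sdiff, mem_inter, mem_union] at h1 ⊢
  tauto

theorem Robust.til {s : ℕ} (hs : 2 ≤ s) {α : ℝ} (hα : 0 < α) (hα1 : α ≤ 1) :
    ∃ n0 : ℕ, ∀ (V : Type*) [Fintype V] [DecidableEq V] (G : SimpleGraph V) (A B : Finset V)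
      (n : ℕ), n0 ≤ n → Fintype.card V = 2 * n → s ∣ n → Robust G n α A B → Til G s A B := by
  have hs0 : 0 < s := by omega
  have : Nonempty (AbsIdx s) := ⟨.inl (.inl ⟨0, hs0⟩)⟩
  set K : ℝ := (Fintype.card (AbsIdx s) : ℝ) with hK
  have hK0 : 0 < K := by
    rw [hK]
    exact_mod_cast Fintype.card_pos
  obtain ⟨c, hc, hcR⟩ : ∃ c > (0 : ℝ), c =
      (1 / 8) ^ (s * s) * (α * ((α / 16) ^ ((s - 1) * s) * (α / 16) ^ ((s - 1) * s))) ^ (s + s) :=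
    ⟨_, by positivity, rfl⟩
  obtain ⟨β, hβ, hβc, hβα⟩ : ∃ β > (0 : ℝ), K ^ 2 * β ≤ c / 4 ∧ 2 * K * β ≤ α / 8 := by
    refine ⟨min (c / (4 * K ^ 2)) (α / (16 * K)), by positivity, ?_, ?_⟩
    · calc K ^ 2 * min (c / (4 * K ^ 2)) (α / (16 * K)) ≤ K ^ 2 * (c / (4 * K ^ 2)) := by
            gcongr
            exact min_le_left _ _
        _ = c / 4 := by field_simp
    · calc 2 * K * min (c / (4 * K ^ 2)) (α / (16 * K)) ≤ 2 * K * (α / (16 * K)) := by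
            gcongr
            exact min_le_right _ _
        _ = α / 8 := by field_simp; norm_num
  obtain ⟨γ, hγ, n1, H1⟩ := exists_absorbing_family (AbsIdx s) (s + s) hc hβ hβc
  obtain ⟨n2, H2⟩ := Robust.exists_almost_til hs0 hα hα1 (show 0 < min γ 1 by positivity)
    (min_le_right _ _)
  refine ⟨max 1 (max n1 n2), fun V _ _ G A B n hn hV hsn h => ?_⟩
  have hn0 : 1 ≤ n := (le_max_left _ _).trans hn
  have hn1 : n1 ≤ n := (le_max_left _ _).trans ((le_max_right _ _).trans hn)
  have hn2 : n2 ≤ n := (le_max_right _ _).trans ((le_max_right _ _).trans hn)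
  have hV' : (Fintype.card V : ℝ) = 2 * n := by exact_mod_cast hV
  obtain ⟨F, hF, hFc, hFR, hFγ⟩ := H1 V
    {z : Fin s ⊕ Fin s → V // (∀ i, z (.inl i) ∈ A) ∧ ∀ i, z (.inr i) ∈ B} (by omega)
    ((Fintype.card_subtype_le _).trans (by simp)) (fun z => Absorbs G s A B z.1)
    (fun z => hcR ▸ h.pr_absorbs hs0 hV hn0 hα z.2.1 z.2.2)
  have hidle : ∀ φ ∈ F, Til G s (univ.image φ ∩ A) (univ.image φ ∩ B) := fun φ hφ => by
    obtain ⟨z, hz⟩ := hFR φ hφ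
    exact hz.til_idle hs h.disj (hF.1 φ hφ)
  set W := F.biUnion fun φ => univ.image φ with hW
  have hWT : Til G s (W ∩ A) (W ∩ B) := by
    rw [hW, biUnion_inter, biUnion_inter]
    have hd : ∀ φ ∈ F, ∀ ψ ∈ F, φ ≠ ψ → Disjoint (univ.image φ) (univ.image ψ) := by
      intro φ hφ ψ hψ hne
      rw [disjoint_left]
      simp only [mem_image, mem_univ, true_and, not_exists]
      rintro _ ⟨a, rfl⟩ b hb
      exact hF.2 φ hφ ψ hψ hne a b hb.symm
    exact Til.biUnion _ _ _ hidle
      (fun φ hφ ψ hψ hne => (hd φ hφ ψ hψ hne).mono inter_subset_left inter_subset_left)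
      (fun φ hφ ψ hψ hne => (hd φ hφ ψ hψ hne).mono inter_subset_left inter_subset_left)
  have hWc : ((W ∩ A).card : ℝ) ≤ α / 8 * n := by
    have h1 : W.card ≤ F.card * Fintype.card (AbsIdx s) :=
      card_biUnion_le_card_mul _ _ _ fun φ hφ => (card_image_univ (hF.1 φ hφ)).le
    calc ((W ∩ A).card : ℝ) ≤ W.card := by exact_mod_cast card_le_card inter_subset_left
      _ ≤ F.card * K := by
          rw [hK]
          exact_mod_cast h1
      _ ≤ β * (2 * n) * K := by
          gcongr
          exact hV' ▸ hFc
      _ = 2 * K * β * n := by ring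
      _ ≤ α / 8 * n := by gcongr
  have eA : (A \ W).card + (W ∩ A).card = n := by
    rw [inter_comm, card_sdiff_add_card_inter, h.cardA]
  have eB : (B \ W).card + (W ∩ B).card = n := by
    rw [inter_comm, card_sdiff_add_card_inter, h.cardB]
  have eAB' := hWT.card_eq
  obtain ⟨X, hX, Y, hY, hXY, hXc⟩ := H2 V G A B (A \ W) (B \ W) n hn2 hV h sdiff_subset
    sdiff_subset (by omega) (by
      have : ((A \ W).card : ℝ) + (W ∩ A).card = n := by exact_mod_cast eA
      linarith)
  have eX := card_sdiff_add_card_eq_card hX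
  have eY := card_sdiff_add_card_eq_card hY
  have eXY := hXY.card_eq
  obtain ⟨q, hq⟩ : s ∣ ((A \ W) \ X).card := by
    have h1 : s ∣ (A \ W).card :=
      (Nat.dvd_add_left hWT.dvd_card).1 (eA ▸ hsn)
    exact (Nat.dvd_add_left hXY.dvd_card).1 (eX ▸ h1)
  obtain ⟨f, hf, hfd, hfU⟩ := exists_partition_blocks ((A \ W) \ X) s q (by rw [hq, mul_comm])
  obtain ⟨g, hg, hgd, hgU⟩ := exists_partition_blocks ((B \ W) \ Y) s q (by
    rw [mul_comm, ← hq]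
    omega)
  have hfA : ∀ j, f j ⊆ A := fun j => (hf j).1.trans (sdiff_subset.trans sdiff_subset)
  have hgB : ∀ j, g j ⊆ B := fun j => (hg j).1.trans (sdiff_subset.trans sdiff_subset)
  choose z hzi hzf hzg hzU using fun j =>
    exists_listing (hf j).2 (hg j).2 (h.disj.mono (hfA j) (hgB j))
  have hzA : ∀ j i, z j (.inl i) ∈ A := fun j i => hfA j (hzf j i)
  have hzB : ∀ j i, z j (.inr i) ∈ B := fun j i => hgB j (hzg j i)
  have hqn : (q : ℝ) ≤ γ * n := by
    have h1 : (((A \ W) \ X).card : ℝ) + X.card = (A \ W).card := by exact_mod_cast eX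
    have h2 : q ≤ ((A \ W) \ X).card := hq ▸ Nat.le_mul_of_pos_left q hs0
    have h3 : (q : ℝ) ≤ ((A \ W) \ X).card := by exact_mod_cast h2
    have h4 : min γ 1 * n ≤ γ * n := by
      gcongr
      exact min_le_left _ _
    linarith
  obtain ⟨p, hp, hpF⟩ := (all_card_le_biUnion_card_iff_exists_injective
    fun j => F.filter (Absorbs G s A B (z j))).1 fun S => by
      rcases S.eq_empty_or_nonempty with rfl | ⟨j, hj⟩
      · simp
      have h1 := hFγ ⟨z j, hzA j, hzB j⟩
      have h2 : (q : ℝ) ≤ (F.filter (Absorbs G s A B (z j))).card := by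
        refine le_trans ?_ h1
        rw [hV']
        nlinarith [mul_nonneg hγ.le (Nat.cast_nonneg (α := ℝ) n)]
      calc S.card ≤ q := (card_le_univ S).trans (by simp)
        _ ≤ (F.filter (Absorbs G s A B (z j))).card := by exact_mod_cast h2
        _ ≤ _ := card_le_card (subset_biUnion_of_mem (fun j => F.filter (Absorbs G s A B (z j))) hj)
  have hpF' : ∀ j, p j ∈ F := fun j => (mem_filter.1 (hpF j)).1
  have hWf : ∀ j, Disjoint W (f j ∪ g j) := fun j => disjoint_union_right.2
    ⟨disjoint_sdiff.mono_right ((hf j).1.trans sdiff_subset),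
      disjoint_sdiff.mono_right ((hg j).1.trans sdiff_subset)⟩
  have hT := hF.til hidle hp hpF' (u := fun j => f j ∪ g j) (fun i j hne => by
    rw [disjoint_union_left, disjoint_union_right, disjoint_union_right]
    exact ⟨⟨hfd i j hne, h.disj.mono (hfA i) (hgB j)⟩,
      h.disj.symm.mono (hgB i) (hfA j), hgd i j hne⟩) hWf fun j => by
    simp only [← hzU j]
    refine (mem_filter.1 (hpF j)).2.til_active hs h.disj (hF.1 _ (hpF' j)) (hzi j)
      (fun i k hik => ?_) (hzA j) (hzB j)
    refine disjoint_left.1 (hWf j) (mem_biUnion.2 ⟨p j, hpF' j, mem_image_of_mem _ (mem_univ k)⟩) ?_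
    rw [← hik, ← hzU j]
    exact mem_image_of_mem _ (mem_univ i)
  have hU : (univ.biUnion fun j => f j ∪ g j) = ((A \ W) \ X) ∪ ((B \ W) \ Y) := by
    rw [← hfU, ← hgU]
    ext v
    simp only [mem_biUnion, mem_union, mem_univ, true_and, exists_or]
  refine hXY.of_parts ?_ (hX.trans sdiff_subset) (hY.trans sdiff_subset)
  convert hT using 1
  · rw [← hW, hU, sdiff_eq_union_inter hX (sdiff_subset.trans sdiff_subset) h.disj]
  · rw [← hW, hU, union_comm ((A \ W) \ X),
      sdiff_eq_union_inter hY (sdiff_subset.trans sdiff_subset) h.disj.symm]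

end NonExtremal

section Main

theorem exists_subset_half {n : ℕ} {ε : ℝ} (hn : 1 ≤ 2 * (ε * n)) {X : Finset V}
    (hX : (1 / 2 - ε) * n ≤ X.card) :
    ∃ Y ⊆ X, 2 * Y.card ≤ n ∧ (1 / 2 - ε) * n ≤ Y.card := by
  rcases le_total (2 * X.card) n with h | h
  · exact ⟨X, Subset.rfl, h, hX⟩
  · obtain ⟨Y, hY, hc⟩ := exists_subset_card_eq (show n / 2 ≤ X.card by omega)
    refine ⟨Y, hY, by omega, ?_⟩
    have : (n : ℝ) ≤ 2 * Y.card + 1 := by exact_mod_cast (show n ≤ 2 * Y.card + 1 by omega)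
    linarith

theorem exists_til (s : ℕ) (hs : 2 ≤ s) : ∃ n0 : ℕ, ∀ n, n0 ≤ n →
    ∀ (V : Type*) [Fintype V] [DecidableEq V] (G : SimpleGraph V) (A B : Finset V) (D0 k : ℕ),
      Disjoint A B → A ∪ B = univ → A.card = n → B.card = n → (∀ x ∈ A, D0 ≤ degS G x B) →
      (∀ x ∈ B, D0 ≤ degS G x A) →
      (n = 2 * (k * s) ∧ D0 = k * s + s - 1 ∨ n = 2 * (k * s) + s ∧ D0 = k * s + 2 * s - 2) →
      Til G s A B := by
  obtain ⟨L, n1, hL, H1⟩ := til_of_sparse_pair s hs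
  have hL1 : (1 : ℝ) ≤ L := by exact_mod_cast hL
  have hL0 : (0 : ℝ) < L := by linarith
  set α : ℝ := 1 / (2 * L) with hα
  have hα0 : 0 < α := by positivity
  have hαL : 2 * α * L = 1 := by
    rw [hα]
    field_simp
  obtain ⟨n2, H2⟩ := Robust.til hs hα0 (by nlinarith)
  refine ⟨max L (max n1 n2), fun n hn V _ _ G A B D0 k hd hu hA hB dA dB hp => ?_⟩
  have hnL : L ≤ n := (le_max_left _ _).trans hn
  have hn1 : n1 ≤ n := (le_max_left _ _).trans ((le_max_right _ _).trans hn)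
  have hn2 : n2 ≤ n := (le_max_right _ _).trans ((le_max_right _ _).trans hn)
  have hnL' : (L : ℝ) ≤ n := by exact_mod_cast hnL
  by_cases H : ∀ X ⊆ A, ∀ Y ⊆ B, (1 / 2 - α) * n ≤ X.card → (1 / 2 - α) * n ≤ Y.card →
    α * n ^ 2 ≤ eAB G X Y
  · have hD : n ≤ 2 * D0 := by omega
    refine H2 V G A B n hn2 ?_ ?_ ⟨hd, hA, hB, fun x hx => hD.trans (by have := dA x hx; omega),
      fun x hx => hD.trans (by have := dB x hx; omega), H⟩
    · rw [← card_univ, ← hu, card_union_of_disjoint hd]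
      omega
    · rcases hp with ⟨h, -⟩ | ⟨h, -⟩
      · exact ⟨2 * k, by rw [h]; ring⟩
      · exact ⟨2 * k + 1, by rw [h]; ring⟩
  · push Not at H
    obtain ⟨X, hX, Y, hY, cX, cY, he⟩ := H
    have hε : 1 ≤ 2 * (α * n) := by nlinarith
    obtain ⟨X', hX', hX2, cX'⟩ := exists_subset_half hε cX
    obtain ⟨Y', hY', hY2, cY'⟩ := exists_subset_half hε cY
    have hbig : ∀ {Z : Finset V}, (1 / 2 - α) * n ≤ Z.card → L * n ≤ 2 * L * Z.card + n := by
      intro Z hZ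
      have h1 := mul_le_mul_of_nonneg_left hZ (show (0 : ℝ) ≤ 2 * L by positivity)
      have h2 : 2 * (L : ℝ) * ((1 / 2 - α) * n) = L * n - 2 * α * L * n := by ring
      rw [h2, hαL, one_mul] at h1
      have : (L : ℝ) * n ≤ 2 * L * Z.card + n := by linarith
      exact_mod_cast this
    refine H1 n hn1 V G A B X' Y' D0 k hd hA hB dA dB hp (hX'.trans hX) (hY'.trans hY) (hbig cX')
      (hbig cY') hX2 hY2 ?_
    have h1 : (eAB G X' Y' : ℝ) ≤ α * n ^ 2 :=
      le_trans (by exact_mod_cast eAB_mono hX' hY') he.le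
    have h2 := mul_le_mul_of_nonneg_left h1 hL0.le
    have : (L : ℝ) * eAB G X' Y' ≤ n * n := by nlinarith [sq_nonneg (n : ℝ)]
    exact_mod_cast this

theorem IsBipartition.degS_univ [Fintype V] {G : SimpleGraph V} {A B : Finset V}
    (h : IsBipartition G A B) {v : V} (hv : v ∈ A) : degS G v univ = degS G v B := by
  unfold degS
  congr 1
  ext w
  simp only [mem_filter, mem_univ, true_and]
  refine ⟨fun hw => ⟨?_, hw⟩, fun hw => hw.2⟩
  rcases h.2.2 v w hw with h1 | h1
  · exact h1.2
  · exact (disjoint_left.1 h.1 hv h1.1).elim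

theorem IsBipartition.symm [Fintype V] {G : SimpleGraph V} {A B : Finset V}
    (h : IsBipartition G A B) : IsBipartition G B A :=
  ⟨h.1.symm, by rw [union_comm, h.2.1], fun u v huv => (h.2.2 u v huv).symm⟩

end Main

/-- Zhao: minimum degree condition for tiling a balanced
bipartite graph on `2n = 2ms` vertices with `K_{s,s}`. -/
theorem zhao_upper_bound (s : ℕ) (hs : 2 ≤ s) :
    ∃ m₀ : ℕ, ∀ m : ℕ, m₀ ≤ m →
      ∀ (V : Type) (_ : Fintype V) (_ : DecidableEq V),
      ∀ (G : SimpleGraph V) (A B : Finset V) (n : ℕ),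
        IsBipartition G A B → A.card = n → B.card = n → n = m * s →
        (∀ v : V,
          (Even m → (n : ℝ) / 2 + s - 1 ≤ (degS G v Finset.univ : ℝ)) ∧
          (Odd m → ((n : ℝ) + 3 * s) / 2 - 2 ≤ (degS G v Finset.univ : ℝ))) →
        KstTileable G s s := by
  obtain ⟨n0, H⟩ := exists_til s hs
  refine ⟨n0, fun m hm V _ _ G A B n hG hA hB hn hdeg => ?_⟩
  have hn0 : n0 ≤ n := by nlinarith
  obtain ⟨k, D0, hp, hD⟩ : ∃ k D0 : ℕ, (n = 2 * (k * s) ∧ D0 = k * s + s - 1 ∨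
      n = 2 * (k * s) + s ∧ D0 = k * s + 2 * s - 2) ∧ ∀ v, D0 ≤ degS G v univ := by
    rcases Nat.even_or_odd m with he | ho
    · obtain ⟨k, rfl⟩ := he
      have hn' : n = 2 * (k * s) := by rw [hn]; ring
      refine ⟨k, k * s + s - 1, .inl ⟨hn', rfl⟩, fun v => ?_⟩
      have h1 := (hdeg v).1 ⟨k, rfl⟩
      have h2 : (n : ℝ) = 2 * (k * s) := by exact_mod_cast hn'
      have h3 : ((k * s + s : ℕ) : ℝ) ≤ ((degS G v univ + 1 : ℕ) : ℝ) := by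
        push_cast
        linarith
      have h4 : k * s + s ≤ degS G v univ + 1 := by exact_mod_cast h3
      omega
    · obtain ⟨k, rfl⟩ := ho
      have hn' : n = 2 * (k * s) + s := by rw [hn]; ring
      refine ⟨k, k * s + 2 * s - 2, .inr ⟨hn', rfl⟩, fun v => ?_⟩
      have h1 := (hdeg v).2 ⟨k, rfl⟩
      have h2 : (n : ℝ) = 2 * (k * s) + s := by exact_mod_cast hn'
      have h3 : ((k * s + 2 * s : ℕ) : ℝ) ≤ ((degS G v univ + 2 : ℕ) : ℝ) := by
        push_cast
        linarith
      have h4 : k * s + 2 * s ≤ degS G v univ + 2 := by exact_mod_cast h3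
      omega
  exact (H n hn0 V G A B D0 k hG.1 hG.2.1 hA hB (fun x hx => hG.degS_univ hx ▸ hD x)
    (fun x hx => hG.symm.degS_univ hx ▸ hD x) hp).kstTileable hG.1 hG.2.1

end PaperTiling
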